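/- There exists ε > 0 such that for every origin-symmetric convex body K in ℝ³ with (1−ε)B³ ⊆ K ⊆ (1+ε)B³ that is not an ellipsoid (i.e., K is not the image of B³ under a nonsingular linear map), the optimal covering fraction satisfies θ(K) < θ(B³). In other words, the ball B³ is relatively worst covering in three dimensions. -/

import Mathlib

open Set Pointwise MeasureTheory

noncomputable section

abbrev Euc (n : ℕ) := EuclideanSpace ℝ (Fin n)

/-- An origin-symmetric convex body in `ℝⁿ`: compact, convex, nonempty interior, `K = -K`. -/
def IsSymmConvexBody {n : ℕ} (K : Set (Euc n)) : Prop :=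
  IsCompact K ∧ Convex ℝ K ∧ (interior K).Nonempty ∧ K = -K

/-- The closed Euclidean unit ball `Bⁿ`. -/
def unitBall (n : ℕ) : Set (Euc n) := Metric.closedBall 0 1

/-- The set of integer points `ℤⁿ ⊆ ℝⁿ`. -/
def intPoints (n : ℕ) : Set (Euc n) := {x | ∀ i, ∃ m : ℤ, x i = (m : ℝ)}

/-- The lattice `Λ = T(ℤⁿ)` is a covering lattice for `K`:
the translates of `K` by lattice vectors cover all of `ℝⁿ`. -/
def IsCoveringLattice {n : ℕ} (T : Euc n →ₗ[ℝ] Euc n) (K : Set (Euc n)) : Prop :=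
  (⋃ l ∈ T '' intPoints n, (l +ᵥ K)) = Set.univ

/-- The critical covering determinant `d_K`: the supremum of the determinants
`d(Λ) = |det T|` over all covering lattices `Λ = T(ℤⁿ)` of `K`. -/
def critCoveringDet {n : ℕ} (K : Set (Euc n)) : ℝ :=
  sSup {d | ∃ T : Euc n →ₗ[ℝ] Euc n,
    LinearMap.det T ≠ 0 ∧ IsCoveringLattice T K ∧ d = |LinearMap.det T|}

/-- The optimal covering fraction `θ(K) = vol K / d_K`. -/
def coveringFraction {n : ℕ} (K : Set (Euc n)) : ℝ :=
  (volume K).toReal / critCoveringDet K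

open scoped RealInnerProductSpace

theorem exists_inner_eq_of_linearIndependent {a b c : Euc 3}
    (h : LinearIndependent ℝ ![a, b, c]) (α β γ : ℝ) :
    ∃ x : Euc 3, ⟪x, a⟫ = α ∧ ⟪x, b⟫ = β ∧ ⟪x, c⟫ = γ := by
  let B := basisOfLinearIndependentOfCardEqFinrank h (by simp)
  let f : Euc 3 →ₗ[ℝ] ℝ := B.constr ℝ ![α, β, γ]
  refine ⟨(InnerProductSpace.toDual ℝ (Euc 3)).symm (LinearMap.toContinuousLinearMap f), ?_⟩
  have hB : ∀ i, B i = ![a, b, c] i := fun i => by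
    simp [B, coe_basisOfLinearIndependentOfCardEqFinrank]
  have hf : ∀ i, f (![a, b, c] i) = ![α, β, γ] i := fun i => by
    rw [← hB i]; exact B.constr_basis ℝ _ i
  refine ⟨?_, ?_, ?_⟩
  · simpa using hf 0
  · simpa using hf 1
  · simpa using hf 2

theorem sq_sub_self_nonneg_int (n : ℤ) : (0 : ℝ) ≤ (n : ℝ) ^ 2 - n := by
  have : n ≤ n ^ 2 := Int.le_self_sq n
  have h : (n : ℝ) ≤ (n : ℝ) ^ 2 := by exact_mod_cast this
  linarith

/-- A simplex `0, a, a + b, a + b + c` built from an obtuse superbase has an empty circumscribed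
sphere, so its edge lengths are controlled by the covering radius. -/
theorem sum_sq_edges_le_of_covering {a b c : Euc 3} {r : ℝ}
    (h : LinearIndependent ℝ ![a, b, c])
    (hab : ⟪a, b⟫ ≤ 0) (hac : ⟪a, c⟫ ≤ 0) (hbc : ⟪b, c⟫ ≤ 0)
    (had : 0 ≤ ⟪a, a + b + c⟫) (hbd : 0 ≤ ⟪b, a + b + c⟫) (hcd : 0 ≤ ⟪c, a + b + c⟫)
    (hcov : ∀ x : Euc 3, ∃ l m n : ℤ, ‖x - ((l : ℝ) • a + (m : ℝ) • b + (n : ℝ) • c)‖ ≤ r) :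
    ⟪a, a⟫ + ⟪b, b⟫ + ⟪c, c⟫ + ⟪a + b + c, a + b + c⟫ + ⟪a + b, a + b⟫ + ⟪b + c, b + c⟫
      ≤ 16 * r ^ 2 := by
  obtain ⟨x, hxa, hxb, hxc⟩ := exists_inner_eq_of_linearIndependent h (⟪a, a⟫ / 2)
    ((⟪b, b⟫ + 2 * ⟪a, b⟫) / 2) ((⟪c, c⟫ + 2 * ⟪a, c⟫ + 2 * ⟪b, c⟫) / 2)
  obtain ⟨l, m, n, hl⟩ := hcov x
  have h1 : ‖x - ((l : ℝ) • a + (m : ℝ) • b + (n : ℝ) • c)‖ ^ 2 ≤ r ^ 2 := by gcongr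
  have hba := real_inner_comm a b
  have hca := real_inner_comm a c
  have hcb := real_inner_comm b c
  have hax := real_inner_comm a x
  have hbx := real_inner_comm b x
  have hcx := real_inner_comm c x
  rw [← real_inner_self_eq_norm_sq] at h1
  have hmean : 0 ≤ ⟪(4 : ℝ) • x - ((3 : ℝ) • a + (2 : ℝ) • b + c),
    (4 : ℝ) • x - ((3 : ℝ) • a + (2 : ℝ) • b + c)⟫ := real_inner_self_nonneg
  simp only [inner_sub_left, inner_sub_right, inner_add_left, inner_add_right, inner_smul_left,
    inner_smul_right, conj_trivial, hba, hca, hcb, hax, hbx, hcx] at *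
  rw [hxa, hxb, hxc] at h1 hmean
  have e1 := sq_sub_self_nonneg_int (l - m)
  have e2 := sq_sub_self_nonneg_int (l - n)
  have e3 := sq_sub_self_nonneg_int (m - n)
  have e4 := sq_sub_self_nonneg_int l
  have e5 := sq_sub_self_nonneg_int m
  have e6 := sq_sub_self_nonneg_int n
  push_cast at e1 e2 e3
  have f1 := mul_nonneg e1 (neg_nonneg.2 hab)
  have f2 := mul_nonneg e2 (neg_nonneg.2 hac)
  have f3 := mul_nonneg e3 (neg_nonneg.2 hbc)
  have f4 := mul_nonneg e4 had
  have f5 := mul_nonneg e5 hbd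
  have f6 := mul_nonneg e6 hcd
  have hR : ⟪x, x⟫ ≤ r ^ 2 := by linarith
  linarith

theorem det_sq_le_of_posSemidef_entries {p q r u v w : ℝ} (hp : 0 ≤ p) (hq : 0 ≤ q) (hr : 0 ≤ r)
    (hu : u ^ 2 ≤ p * q) :
    p * q * r + 2 * u * v * w - p * w ^ 2 - q * v ^ 2 - r * u ^ 2 ≤ p * q * r := by
  have h1 : |u| ≤ √p * √q := by
    rw [← Real.sqrt_mul hp]; exact Real.abs_le_sqrt hu
  have h2 : u * (v * w) ≤ √p * √q * |v * w| :=
    (le_abs_self _).trans (by rw [abs_mul]; gcongr)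
  have h3 : 0 ≤ (√p * |w| - √q * |v|) ^ 2 := sq_nonneg _
  rw [abs_mul] at h2
  have h4 : (√p * |w| - √q * |v|) ^ 2 =
      p * w ^ 2 + q * v ^ 2 - 2 * (√p * √q * (|v| * |w|)) := by
    have a1 := Real.sq_sqrt hp
    have a2 := Real.sq_sqrt hq
    have a3 := sq_abs v
    have a4 := sq_abs w
    calc _ = √p ^ 2 * |w| ^ 2 + √q ^ 2 * |v| ^ 2 - 2 * (√p * √q * (|v| * |w|)) := by ring
      _ = _ := by rw [a1, a2, a3, a4]
  have h5 : 0 ≤ r * u ^ 2 := by positivity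
  linarith

theorem amgm_three {p q r : ℝ} (hp : 0 ≤ p) (hq : 0 ≤ q) (hr : 0 ≤ r) :
    p * q * r ≤ ((p + q + r) / 3) ^ 3 := by
  nlinarith [mul_nonneg hp (sq_nonneg (q - r)), mul_nonneg hq (sq_nonneg (p - r)),
    mul_nonneg hr (sq_nonneg (p - q)), mul_nonneg hp (sq_nonneg (p - r)),
    mul_nonneg hp (sq_nonneg (p - q)), mul_nonneg hq (sq_nonneg (q - r)),
    mul_nonneg hq (sq_nonneg (q - p)), mul_nonneg hr (sq_nonneg (r - q)),
    mul_nonneg hr (sq_nonneg (r - p))]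

theorem four_det_sq_le (a1 a2 a3 b1 b2 b3 c1 c2 c3 : ℝ) :
    4 * (a1 * (b2 * c3 - b3 * c2) - a2 * (b1 * c3 - b3 * c1) + a3 * (b1 * c2 - b2 * c1)) ^ 2 ≤
      (((a1 ^ 2 + b1 ^ 2 + c1 ^ 2 + (a1 + b1 + c1) ^ 2) +
        (a2 ^ 2 + b2 ^ 2 + c2 ^ 2 + (a2 + b2 + c2) ^ 2) +
        (a3 ^ 2 + b3 ^ 2 + c3 ^ 2 + (a3 + b3 + c3) ^ 2)) / 3) ^ 3 := by
  refine le_trans ?_ (amgm_three (by positivity) (by positivity) (by positivity))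
  refine le_trans (le_of_eq ?_) (det_sq_le_of_posSemidef_entries
    (u := a1 * a2 + b1 * b2 + c1 * c2 + (a1 + b1 + c1) * (a2 + b2 + c2))
    (v := a1 * a3 + b1 * b3 + c1 * c3 + (a1 + b1 + c1) * (a3 + b3 + c3))
    (w := a2 * a3 + b2 * b3 + c2 * c3 + (a2 + b2 + c2) * (a3 + b3 + c3))
    (by positivity) (by positivity) (by positivity) ?_)
  · ring
  · have h := Finset.sum_mul_sq_le_sq_mul_sq Finset.univ ![a1, b1, c1, a1 + b1 + c1]
      ![a2, b2, c2, a2 + b2 + c2]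
    simpa only [Fin.sum_univ_four, Matrix.cons_val_zero, Matrix.cons_val_one,
      Matrix.cons_val] using h

/-- The point of `ℝⁿ` with the given integer coordinates. -/
def intVec {n : ℕ} (z : Fin n → ℤ) : Euc n := WithLp.toLp 2 fun i => (z i : ℝ)

theorem intVec_apply {n : ℕ} (z : Fin n → ℤ) (i : Fin n) : intVec z i = z i := rfl

theorem intVec_mem {n : ℕ} (z : Fin n → ℤ) : intVec z ∈ intPoints n := fun i => ⟨z i, rfl⟩

theorem exists_eq_intVec {n : ℕ} {x : Euc n} (hx : x ∈ intPoints n) : ∃ z, x = intVec z := by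
  choose z hz using hx
  exact ⟨z, by ext i; simp [hz, intVec_apply]⟩

theorem isCoveringLattice_iff {n : ℕ} {T : Euc n →ₗ[ℝ] Euc n} {K : Set (Euc n)} :
    IsCoveringLattice T K ↔ ∀ x, ∃ z : Fin n → ℤ, x - T (intVec z) ∈ K := by
  rw [IsCoveringLattice, eq_univ_iff_forall]
  refine forall_congr' fun x => ?_
  simp only [mem_iUnion, mem_image, exists_prop]
  constructor
  · rintro ⟨_, ⟨y, hy, rfl⟩, k, hk, rfl⟩
    obtain ⟨z, rfl⟩ := exists_eq_intVec hy
    exact ⟨z, by simpa using hk⟩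
  · rintro ⟨z, hz⟩
    exact ⟨_, ⟨_, intVec_mem z, rfl⟩, _, hz, by simp⟩

/-- Integer quadruples that sum to zero and generate `ℤ³`. -/
def superbases : Set (Fin 4 → Fin 3 → ℤ) :=
  {u | ∑ i, u i = 0 ∧ ∀ z, ∃ n : Fin 4 → ℤ, z = ∑ i, n i • u i}

/-- The sum of the squared lengths of the vectors of a superbase. -/
def selling (T : Euc 3 →ₗ[ℝ] Euc 3) (u : Fin 4 → Fin 3 → ℤ) : ℝ :=
  ∑ i, ‖T (intVec (u i))‖ ^ 2

theorem superbases_nonempty : superbases.Nonempty := by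
  refine ⟨![![-1, -1, -1], ![1, 0, 0], ![0, 1, 0], ![0, 0, 1]], ?_, fun z => ?_⟩
  · ext i; fin_cases i <;> simp [Fin.sum_univ_four]
  · refine ⟨![0, z 0, z 1, z 2], ?_⟩
    ext i; fin_cases i <;> simp [Fin.sum_univ_four]

theorem finite_selling_le {T : Euc 3 →ₗ[ℝ] Euc 3} (hT : LinearMap.det T ≠ 0) (C : ℝ) :
    {u | selling T u ≤ C}.Finite := by
  have hinj : Function.Injective T := (LinearMap.equivOfDetNeZero T hT).injective
  obtain ⟨c, hc, hTc⟩ := LinearMap.exists_antilipschitzWith T (LinearMap.ker_eq_bot.2 hinj)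
  have hbd : ∀ x, ‖x‖ ≤ c * ‖T x‖ := fun x => by
    simpa using hTc.le_mul_dist x 0
  set B : ℤ := ⌈(c : ℝ) * √C⌉
  refine ((Set.finite_Icc (fun _ _ => -B : Fin 4 → Fin 3 → ℤ) (fun _ _ => B))).subset ?_
  intro u hu
  have key : ∀ i k, |u i k| ≤ B := fun i k => by
    have h1 : ‖T (intVec (u i))‖ ^ 2 ≤ C :=
      (Finset.single_le_sum (f := fun i => ‖T (intVec (u i))‖ ^ 2)
        (fun _ _ => by positivity) (Finset.mem_univ i)).trans hu
    have h2 : ‖T (intVec (u i))‖ ≤ √C := Real.le_sqrt_of_sq_le h1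
    have h3 : |(u i k : ℝ)| ≤ ‖intVec (u i)‖ := by
      simpa [intVec_apply] using PiLp.norm_apply_le (intVec (u i)) k
    have h4 : |(u i k : ℝ)| ≤ c * √C := h3.trans ((hbd _).trans (by gcongr))
    have h5 : ((|u i k| : ℤ) : ℝ) ≤ B := by
      push_cast; exact h4.trans (Int.le_ceil _)
    exact_mod_cast h5
  exact ⟨fun i k => (abs_le.1 (key i k)).1, fun i k => (abs_le.1 (key i k)).2⟩

theorem exists_minimal_superbase {T : Euc 3 →ₗ[ℝ] Euc 3} (hT : LinearMap.det T ≠ 0) :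
    ∃ u ∈ superbases, ∀ u' ∈ superbases, selling T u ≤ selling T u' := by
  obtain ⟨u₀, hu₀⟩ := superbases_nonempty
  have hfin := (finite_selling_le hT (selling T u₀)).inter_of_left superbases
  obtain ⟨u, hu, hmin⟩ := Set.exists_min_image _ (selling T) hfin ⟨u₀, le_refl (selling T u₀), hu₀⟩
  refine ⟨u, hu.2, fun u' hu' => ?_⟩
  by_cases h : selling T u' ≤ selling T u₀
  · exact hmin u' ⟨h, hu'⟩
  · exact (hu.1 : _ ≤ _).trans (le_of_not_ge h)

theorem superbases_comp {u : Fin 4 → Fin 3 → ℤ} (hu : u ∈ superbases) (σ : Equiv.Perm (Fin 4)) :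
    u ∘ σ ∈ superbases := by
  refine ⟨(Equiv.sum_comp σ u).trans hu.1, fun z => ?_⟩
  obtain ⟨n, hn⟩ := hu.2 z
  exact ⟨n ∘ σ, hn.trans (Equiv.sum_comp σ fun i => n i • u i).symm⟩

theorem selling_comp (T : Euc 3 →ₗ[ℝ] Euc 3) (u : Fin 4 → Fin 3 → ℤ) (σ : Equiv.Perm (Fin 4)) :
    selling T (u ∘ σ) = selling T u :=
  Equiv.sum_comp σ fun i => ‖T (intVec (u i))‖ ^ 2

theorem intVec_add {n : ℕ} (y z : Fin n → ℤ) : intVec (y + z) = intVec y + intVec z := by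
  ext i; simp [intVec_apply]

theorem intVec_neg {n : ℕ} (z : Fin n → ℤ) : intVec (-z) = -intVec z := by
  ext i; simp [intVec_apply]

theorem intVec_smul {n : ℕ} (m : ℤ) (z : Fin n → ℤ) : intVec (m • z) = (m : ℝ) • intVec z := by
  ext i; simp [intVec_apply]

theorem intVec_zero {n : ℕ} : intVec (0 : Fin n → ℤ) = 0 := by
  ext i; simp [intVec_apply]

theorem inner_zero_one_nonpos_of_minimal {T : Euc 3 →ₗ[ℝ] Euc 3} {u : Fin 4 → Fin 3 → ℤ}
    (hu : u ∈ superbases) (hmin : ∀ u' ∈ superbases, selling T u ≤ selling T u') :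
    ⟪T (intVec (u 0)), T (intVec (u 1))⟫ ≤ 0 := by
  have hmem : ![-u 0, u 1, u 2 + u 0, u 3 + u 0] ∈ superbases := by
    constructor
    · rw [← hu.1]; simp only [Fin.sum_univ_four]; simp; abel
    · intro z
      obtain ⟨n, rfl⟩ := hu.2 z
      refine ⟨![-n 0 + n 2 + n 3, n 1, n 2, n 3], ?_⟩
      simp only [Fin.sum_univ_four]
      ext k
      simp
      ring
  have h := hmin _ hmem
  have hsum : T (intVec (u 3)) = -(T (intVec (u 0)) + T (intVec (u 1)) + T (intVec (u 2))) := by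
    have := hu.1
    rw [Fin.sum_univ_four] at this
    rw [eq_neg_of_add_eq_zero_right this, intVec_neg, intVec_add, intVec_add, map_neg, map_add,
      map_add]
  simp only [selling, Fin.sum_univ_four] at h
  simp only [Matrix.cons_val_zero, Matrix.cons_val_one, Matrix.cons_val, intVec_add, intVec_neg,
    map_add, map_neg, hsum, ← real_inner_self_eq_norm_sq] at h
  have hc := fun x y : Euc 3 => real_inner_comm x y
  simp only [inner_add_left, inner_add_right, inner_neg_left, inner_neg_right] at h
  rw [hc (T (intVec (u 0))) (T (intVec (u 1))), hc (T (intVec (u 0))) (T (intVec (u 2))),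
    hc (T (intVec (u 1))) (T (intVec (u 2)))] at h
  linarith

theorem exists_obtuse_superbase {T : Euc 3 →ₗ[ℝ] Euc 3} (hT : LinearMap.det T ≠ 0) :
    ∃ u ∈ superbases, ∀ i j, i ≠ j → ⟪T (intVec (u i)), T (intVec (u j))⟫ ≤ 0 := by
  obtain ⟨u, hu, hmin⟩ := exists_minimal_superbase hT
  refine ⟨u, hu, fun i j hij => ?_⟩
  obtain ⟨σ, rfl, rfl⟩ : ∃ σ : Equiv.Perm (Fin 4), σ 0 = i ∧ σ 1 = j := by
    revert i j; decide
  exact inner_zero_one_nonpos_of_minimal (superbases_comp hu σ)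
    fun u' hu' => (selling_comp T u σ).trans_le (hmin u' hu')

theorem abs_det_superbase {u : Fin 4 → Fin 3 → ℤ} (hu : u ∈ superbases) :
    |(Matrix.of ![u 1, u 2, u 3]).det| = 1 := by
  have h0 : u 0 = -(u 1 + u 2 + u 3) := by
    have := hu.1
    rw [Fin.sum_univ_four, add_assoc, add_assoc] at this
    rw [eq_neg_of_add_eq_zero_left this, add_assoc]
  choose n hn using fun k : Fin 3 => hu.2 (Pi.single k 1)
  have hmul : (Matrix.of fun k => ![n k 1 - n k 0, n k 2 - n k 0, n k 3 - n k 0]) *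
      Matrix.of ![u 1, u 2, u 3] = 1 := by
    ext i j
    have := congrFun (hn i) j
    rw [Fin.sum_univ_four, h0] at this
    simp only [Matrix.mul_apply, Fin.sum_univ_three, Matrix.of_apply, Matrix.cons_val_zero,
      Matrix.cons_val_one, Matrix.cons_val, Matrix.one_apply]
    simp [Pi.single_apply] at this
    rw [show (if i = j then (1 : ℤ) else 0) = if j = i then 1 else 0 by simp [eq_comm], this]
    ring
  have hdet := congrArg Matrix.det hmul
  rw [Matrix.det_mul, Matrix.det_one] at hdet
  exact Int.isUnit_iff_abs_eq.1 (IsUnit.of_mul_eq_one_right _ hdet)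

/-- The matrix of a linear map of `ℝⁿ` in the standard basis. -/
def stdMatrix {n : ℕ} (T : Euc n →ₗ[ℝ] Euc n) : Matrix (Fin n) (Fin n) ℝ :=
  LinearMap.toMatrix (EuclideanSpace.basisFun (Fin n) ℝ).toBasis
    (EuclideanSpace.basisFun (Fin n) ℝ).toBasis T

theorem det_stdMatrix {n : ℕ} (T : Euc n →ₗ[ℝ] Euc n) :
    (stdMatrix T).det = LinearMap.det T := LinearMap.det_toMatrix _ T

theorem apply_intVec {n : ℕ} (T : Euc n →ₗ[ℝ] Euc n) (z : Fin n → ℤ) (i : Fin n) :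
    T (intVec z) i = ∑ k, stdMatrix T i k * z k := by
  have h := LinearMap.toMatrix_mulVec_repr (EuclideanSpace.basisFun (Fin n) ℝ).toBasis
    (EuclideanSpace.basisFun (Fin n) ℝ).toBasis T (intVec z)
  have := congrFun h i
  simpa [Matrix.mulVec, dotProduct, stdMatrix, intVec_apply] using this.symm

theorem abs_det_rows_superbase (T : Euc 3 →ₗ[ℝ] Euc 3) {u : Fin 4 → Fin 3 → ℤ}
    (hu : u ∈ superbases) :
    |(Matrix.of ![(T (intVec (u 1))).ofLp, (T (intVec (u 2))).ofLp,
      (T (intVec (u 3))).ofLp]).det| = |LinearMap.det T| := by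
  have h : Matrix.of ![(T (intVec (u 1))).ofLp, (T (intVec (u 2))).ofLp, (T (intVec (u 3))).ofLp] =
      (Matrix.of ![u 1, u 2, u 3]).map (Int.cast : ℤ → ℝ) * (stdMatrix T).transpose := by
    ext i j
    fin_cases i <;> simp [Matrix.mul_apply, apply_intVec, mul_comm]
  rw [h, Matrix.det_mul, Matrix.det_transpose, det_stdMatrix, abs_mul]
  have h1 := abs_det_superbase hu
  have h2 : ((Matrix.of ![u 1, u 2, u 3]).map (Int.cast : ℤ → ℝ)).det =
      (((Matrix.of ![u 1, u 2, u 3]).det : ℤ) : ℝ) :=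
    ((Int.castRingHom ℝ).map_det _).symm
  rw [h2, ← Int.cast_abs, h1]; simp

theorem inner_euc3 (x y : Euc 3) : ⟪x, y⟫ = x 0 * y 0 + x 1 * y 1 + x 2 * y 2 := by
  simp only [PiLp.inner_apply, Fin.sum_univ_three, RCLike.inner_apply, conj_trivial]
  ring

theorem det_sq_le_of_sum_sq_le (a b c : Euc 3) {r : ℝ}
    (h : ⟪a, a⟫ + ⟪b, b⟫ + ⟪c, c⟫ + ⟪a + b + c, a + b + c⟫ ≤ 48 / 5 * r ^ 2) :
    (Matrix.of ![a.ofLp, b.ofLp, c.ofLp]).det ^ 2 ≤ 1024 / 125 * (r ^ 2) ^ 3 := by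
  have key := four_det_sq_le (a 0) (a 1) (a 2) (b 0) (b 1) (b 2) (c 0) (c 1) (c 2)
  have h48 : ((a 0 ^ 2 + b 0 ^ 2 + c 0 ^ 2 + (a 0 + b 0 + c 0) ^ 2) +
        (a 1 ^ 2 + b 1 ^ 2 + c 1 ^ 2 + (a 1 + b 1 + c 1) ^ 2) +
        (a 2 ^ 2 + b 2 ^ 2 + c 2 ^ 2 + (a 2 + b 2 + c 2) ^ 2)) / 3 ≤ 16 / 5 * r ^ 2 := by
    simp only [inner_euc3, PiLp.add_apply] at h
    linarith
  have h4 := key.trans (pow_le_pow_left₀ (by positivity) h48 3)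
  have hd : (Matrix.of ![a.ofLp, b.ofLp, c.ofLp]).det =
      a 0 * (b 1 * c 2 - b 2 * c 1) - a 1 * (b 0 * c 2 - b 2 * c 0) +
        a 2 * (b 0 * c 1 - b 1 * c 0) := by
    rw [Matrix.det_fin_three]
    simp only [Matrix.of_apply, Matrix.cons_val_zero, Matrix.cons_val_one, Matrix.cons_val]
    ring
  rw [hd]
  generalize a 0 * (b 1 * c 2 - b 2 * c 1) - a 1 * (b 0 * c 2 - b 2 * c 0) +
        a 2 * (b 0 * c 1 - b 1 * c 0) = X at *
  rw [mul_pow] at h4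
  linarith

theorem det_sq_le_of_obtuse_covering {a b c : Euc 3} {r : ℝ}
    (hlin : LinearIndependent ℝ ![a, b, c])
    (h12 : ⟪a, b⟫ ≤ 0) (h13 : ⟪a, c⟫ ≤ 0) (h23 : ⟪b, c⟫ ≤ 0)
    (h01 : ⟪-(a + b + c), a⟫ ≤ 0) (h02 : ⟪-(a + b + c), b⟫ ≤ 0) (h03 : ⟪-(a + b + c), c⟫ ≤ 0)
    (hcov' : ∀ x : Euc 3, ∃ l m n : ℤ, ‖x - ((l : ℝ) • a + (m : ℝ) • b + (n : ℝ) • c)‖ ≤ r) :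
    (Matrix.of ![a.ofLp, b.ofLp, c.ofLp]).det ^ 2 ≤ 1024 / 125 * (r ^ 2) ^ 3 := by
  have hlin2 : LinearIndependent ℝ ![b, a, c] := by
    have h := hlin.comp ![1, 0, 2] (by decide)
    rwa [show ![a, b, c] ∘ ![1, 0, 2] = ![b, a, c] by ext i j; fin_cases i <;> rfl] at h
  have hlin3 : LinearIndependent ℝ ![a, c, b] := by
    have h := hlin.comp ![0, 2, 1] (by decide)
    rwa [show ![a, b, c] ∘ ![0, 2, 1] = ![a, c, b] by ext i j; fin_cases i <;> rfl] at h
  have hba := real_inner_comm a b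
  have hca := real_inner_comm a c
  have hcb := real_inner_comm b c
  rw [inner_neg_left, neg_nonpos, real_inner_comm] at h01 h02 h03
  have e1 := sum_sq_edges_le_of_covering hlin h12 h13 h23
    h01 h02 h03 hcov'
  have e2 := sum_sq_edges_le_of_covering (r := r) hlin2 (by linarith) h23 h13
    (by rwa [add_comm b a]) (by rwa [add_comm b a])
    (by rwa [add_comm b a])
    (fun x => by
      obtain ⟨l, m, n, h⟩ := hcov' x
      exact ⟨m, l, n, by rwa [add_comm ((m : ℝ) • b)]⟩)
  have e3 := sum_sq_edges_le_of_covering (r := r) hlin3 h13 h12 (by linarith)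
    (by rwa [add_right_comm]) (by rwa [add_right_comm])
    (by rwa [add_right_comm])
    (fun x => by
      obtain ⟨l, m, n, h⟩ := hcov' x
      exact ⟨l, n, m, by rwa [add_right_comm ((l : ℝ) • a)]⟩)
  refine det_sq_le_of_sum_sq_le a b c ?_
  simp only [inner_add_left, inner_add_right] at e1 e2 e3 ⊢
  linarith

/-- Bambah's bound for lattice coverings by balls of radius `r` in `ℝ³`. -/
theorem det_sq_le_of_isCoveringLattice_closedBall {T : Euc 3 →ₗ[ℝ] Euc 3} {r : ℝ}
    (hT : LinearMap.det T ≠ 0) (hcov : IsCoveringLattice T (Metric.closedBall 0 r)) :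
    LinearMap.det T ^ 2 ≤ 1024 / 125 * (r ^ 2) ^ 3 := by
  obtain ⟨u, hu, hobt⟩ := exists_obtuse_superbase hT
  have hdet := abs_det_rows_superbase T hu
  have hsum : T (intVec (u 0)) = -(T (intVec (u 1)) + T (intVec (u 2)) + T (intVec (u 3))) := by
    have h := hu.1
    rw [Fin.sum_univ_four, add_assoc, add_assoc] at h
    rw [eq_neg_of_add_eq_zero_left h, intVec_neg, intVec_add, intVec_add, map_neg, map_add,
      map_add, add_assoc]
  have hcov' : ∀ x : Euc 3, ∃ l m n : ℤ, ‖x - ((l : ℝ) • T (intVec (u 1)) +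
      (m : ℝ) • T (intVec (u 2)) + (n : ℝ) • T (intVec (u 3)))‖ ≤ r := by
    intro x
    obtain ⟨z, hz⟩ := isCoveringLattice_iff.1 hcov x
    obtain ⟨n, rfl⟩ := hu.2 z
    refine ⟨n 1 - n 0, n 2 - n 0, n 3 - n 0, ?_⟩
    have : T (intVec (∑ i, n i • u i)) = ((n 1 - n 0 : ℤ) : ℝ) • T (intVec (u 1)) +
      ((n 2 - n 0 : ℤ) : ℝ) • T (intVec (u 2)) + ((n 3 - n 0 : ℤ) : ℝ) • T (intVec (u 3)) := by
      simp only [Fin.sum_univ_four, intVec_add, intVec_smul, map_add, map_smul, hsum]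
      push_cast
      module
    rw [← this]
    simpa using hz
  have h01 := hobt 0 1 (by decide)
  have h02 := hobt 0 2 (by decide)
  have h03 := hobt 0 3 (by decide)
  have h12 := hobt 1 2 (by decide)
  have h13 := hobt 1 3 (by decide)
  have h23 := hobt 2 3 (by decide)
  rw [hsum] at h01 h02 h03
  have hlin : LinearIndependent ℝ ![T (intVec (u 1)), T (intVec (u 2)), T (intVec (u 3))] := by
    have h := Matrix.linearIndependent_rows_of_det_ne_zero (A := Matrix.of
      ![(T (intVec (u 1))).ofLp, (T (intVec (u 2))).ofLp, (T (intVec (u 3))).ofLp])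
      (by rw [← abs_ne_zero, hdet, abs_ne_zero]; exact hT)
    refine LinearIndependent.of_comp (WithLp.linearEquiv 2 ℝ (Fin 3 → ℝ)).toLinearMap ?_
    have he : (WithLp.linearEquiv 2 ℝ (Fin 3 → ℝ)).toLinearMap ∘
        ![T (intVec (u 1)), T (intVec (u 2)), T (intVec (u 3))] = (Matrix.of
      ![(T (intVec (u 1))).ofLp, (T (intVec (u 2))).ofLp, (T (intVec (u 3))).ofLp]).row := by
      ext i j; fin_cases i <;> rfl
    rw [he]
    exact h
  rw [← sq_abs (LinearMap.det T), ← hdet, sq_abs]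
  exact det_sq_le_of_obtuse_covering hlin h12 h13 h23 h01 h02 h03 hcov'

theorem abs_det_le_of_isCoveringLattice {T : Euc 3 →ₗ[ℝ] Euc 3} {r : ℝ} {K : Set (Euc 3)}
    (hr : 0 ≤ r) (hK : K ⊆ Metric.closedBall 0 r)
    (hT : LinearMap.det T ≠ 0) (hcov : IsCoveringLattice T K) :
    |LinearMap.det T| ≤ √(1024 / 125) * r ^ 3 := by
  have h := det_sq_le_of_isCoveringLattice_closedBall hT (r := r)
    (isCoveringLattice_iff.2 fun x => (isCoveringLattice_iff.1 hcov x).imp fun z hz => hK hz)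
  refine abs_le_of_sq_le_sq ?_ (by positivity) |> fun h => abs_le.2 ⟨(abs_le.1 h).1, (abs_le.1 h).2⟩
  rw [mul_pow, Real.sq_sqrt (by norm_num)]
  linarith

/-- A point of a simplex with vertices in a nearly round convex body is close to one of the
vertices, if no half-space through the origin misses all vertices. -/
theorem exists_vertex_sub_mem {K : Set (Euc 3)} {ε κ : ℝ} (hK : Convex ℝ K)
    (hin : Metric.closedBall 0 (1 - ε) ⊆ K) (hout : K ⊆ Metric.closedBall 0 (1 + ε))
    (hε1 : ε ≤ 1) (hκ : 0 < κ) (hεκ : 4 * ε ≤ κ ^ 2) (q : Fin 4 → Euc 3)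
    (hq : ∀ j, q j ∈ K)
    (hu : ∀ u : Euc 3, ∃ j, κ * ‖u‖ ≤ ⟪q j, u⟫) (t : Fin 4 → ℝ) (ht : ∀ j, 0 ≤ t j)
    (ht1 : ∑ j, t j = 1) : ∃ j, q j - ∑ i, t i • q i ∈ K := by
  set u := ∑ i, t i • q i with hu_def
  obtain ⟨j, -, hj⟩ := Finset.exists_max_image Finset.univ (fun j => ⟪q j, u⟫) ⟨0, by simp⟩
  have hj1 : κ * ‖u‖ ≤ ⟪q j, u⟫ := by
    obtain ⟨i, hi⟩ := hu u
    exact hi.trans (hj i (Finset.mem_univ _))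
  have hj2 : ‖u‖ ^ 2 ≤ ⟪q j, u⟫ := by
    calc ‖u‖ ^ 2 = ⟪u, u⟫ := (real_inner_self_eq_norm_sq u).symm
      _ = ∑ i, t i * ⟪q i, u⟫ := by
        nth_rw 1 [hu_def]; rw [sum_inner]; simp only [real_inner_smul_left]
      _ ≤ ∑ i, t i * ⟪q j, u⟫ := by
        gcongr with i hi
        · exact ht i
        · exact hj i hi
      _ = ⟪q j, u⟫ := by rw [← Finset.sum_mul, ht1, one_mul]
  have hqj : ‖q j‖ ^ 2 ≤ (1 + ε) ^ 2 := by
    have := hout (hq j)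
    rw [mem_closedBall_zero_iff] at this
    gcongr
  refine ⟨j, ?_⟩
  have hball : ∀ w : Euc 3, ‖w‖ ^ 2 ≤ (1 + ε) ^ 2 - κ ^ 2 → w ∈ K := fun w hw => hin <| by
    rw [mem_closedBall_zero_iff]
    refine le_of_sq_le_sq ?_ (by linarith)
    nlinarith
  rcases le_or_gt ‖u‖ κ with hle | hgt
  · rcases eq_or_ne ‖u‖ 0 with h0 | h0
    · rw [norm_eq_zero] at h0
      rw [h0, sub_zero]; exact hq j
    have hpos : 0 < ‖u‖ := lt_of_le_of_ne (norm_nonneg _) h0.symm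
    set s := ‖u‖ / κ with hs
    have hs0 : 0 < s := by positivity
    have hs1 : s ≤ 1 := (div_le_one hκ).2 hle
    have hz : q j - s⁻¹ • u ∈ K := by
      apply hball
      rw [norm_sub_sq_real, real_inner_smul_right, norm_smul, mul_pow, Real.norm_eq_abs, sq_abs]
      have e1 : s⁻¹ * ‖u‖ = κ := by rw [hs]; field_simp
      have e2 : s⁻¹ * (κ * ‖u‖) ≤ s⁻¹ * ⟪q j, u⟫ := by gcongr
      have e3 : s⁻¹ ^ 2 * ‖u‖ ^ 2 = κ ^ 2 := by rw [← mul_pow, e1]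
      rw [e3]
      nlinarith
    have := hK (hq j) hz (sub_nonneg.2 hs1) hs0.le (by ring)
    convert this using 1
    rw [smul_sub, smul_smul, mul_inv_cancel₀ hs0.ne', one_smul]
    module
  · apply hball
    rw [norm_sub_sq_real]
    nlinarith

theorem exists_cyclic_order (f : Fin 3 → ℝ) :
    ∃ a, (f (a + 1) ≤ f a ∧ f (a + 2) ≤ f (a + 1)) ∨ (f a ≤ f (a + 1) ∧ f (a + 1) ≤ f (a + 2)) := by
  rcases le_total (f 0) (f 1) with h1 | h1 <;> rcases le_total (f 1) (f 2) with h2 | h2 <;>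
    rcases le_total (f 2) (f 0) with h3 | h3
  · exact ⟨0, Or.inr ⟨h1, h2⟩⟩
  · exact ⟨0, Or.inr ⟨h1, h2⟩⟩
  · exact ⟨2, Or.inr ⟨h3, h1⟩⟩
  · exact ⟨1, Or.inl ⟨h2, h3⟩⟩
  · exact ⟨1, Or.inr ⟨h2, h3⟩⟩
  · exact ⟨2, Or.inl ⟨h3, h1⟩⟩
  · exact ⟨0, Or.inl ⟨h1, h2⟩⟩
  · exact ⟨0, Or.inl ⟨h1, h2⟩⟩

/-- A tiling by Kuhn simplices gives a lattice covering once the vertices of every simplex lie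
in a common translate of the body. -/
theorem isCoveringLattice_of_simplices {K : Set (Euc 3)} {ε κ : ℝ} (hK : Convex ℝ K)
    (hsymm : K = -K)
    (hin : Metric.closedBall 0 (1 - ε) ⊆ K) (hout : K ⊆ Metric.closedBall 0 (1 + ε))
    (hε1 : ε ≤ 1) (hκ : 0 < κ) (hεκ : 4 * ε ≤ κ ^ 2)
    {T : Euc 3 →ₗ[ℝ] Euc 3} (hT : LinearMap.det T ≠ 0) (q : Fin 3 → Fin 4 → Euc 3)
    (hq : ∀ a j, q a j ∈ K) (hu : ∀ a, ∀ u : Euc 3, ∃ j, κ * ‖u‖ ≤ ⟪q a j, u⟫)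
    (h1 : ∀ a, q a 1 = q a 0 + T (intVec (Pi.single a 1)))
    (h2 : ∀ a, q a 2 = q a 1 + T (intVec (Pi.single (a + 1) 1)))
    (h3 : ∀ a, q a 3 = q a 2 + T (intVec (Pi.single (a + 2) 1))) :
    IsCoveringLattice T K := by
  have hneg : ∀ x, x ∈ K → -x ∈ K := fun x hx => by rw [hsymm] at hx; simpa using hx
  have key : ∀ a, ∀ f : Euc 3, f a ≤ 1 → f (a + 1) ≤ f a → f (a + 2) ≤ f (a + 1) →
      0 ≤ f (a + 2) → ∃ z, T f - T (intVec z) ∈ K := by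
    intro a f hf1 hf2 hf3 hf4
    obtain ⟨j, hj⟩ := exists_vertex_sub_mem hK hin hout hε1 hκ hεκ (q a) (hq a) (hu a)
      ![1 - f a, f a - f (a + 1), f (a + 1) - f (a + 2), f (a + 2)]
      (by intro j; fin_cases j <;> simp <;> assumption) (by simp [Fin.sum_univ_four])
    have hTf : T f = f a • T (intVec (Pi.single a 1)) + f (a + 1) • T (intVec (Pi.single (a + 1) 1))
        + f (a + 2) • T (intVec (Pi.single (a + 2) 1)) := by
      rw [← map_smul, ← map_smul, ← map_smul, ← map_add, ← map_add]
      congr 1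
      ext i
      fin_cases a <;> fin_cases i <;> simp [intVec_apply]
    have hz : ∃ z, q a j = q a 0 + T (intVec z) := by
      fin_cases j
      · exact ⟨0, by simp [intVec_zero]⟩
      · exact ⟨_, h1 a⟩
      · exact ⟨Pi.single a 1 + Pi.single (a + 1) 1, by
          rw [intVec_add, map_add, ← add_assoc, ← h1]; exact h2 a⟩
      · exact ⟨Pi.single a 1 + Pi.single (a + 1) 1 + Pi.single (a + 2) 1, by
          rw [intVec_add, intVec_add, map_add, map_add, ← add_assoc, ← add_assoc, ← h1, ← h2]
          exact h3 a⟩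
    obtain ⟨z, hz⟩ := hz
    refine ⟨z, ?_⟩
    have := hneg _ hj
    convert this using 1
    rw [hz, hTf, Fin.sum_univ_four, h3, h2, h1]
    simp only [Matrix.cons_val_zero, Matrix.cons_val_one, Matrix.cons_val]
    module
  rw [isCoveringLattice_iff]
  intro x
  obtain ⟨y, rfl⟩ := (LinearMap.equivOfDetNeZero T hT).surjective x
  change ∃ z, T y - T (intVec z) ∈ K
  set f : Euc 3 := WithLp.toLp 2 fun i => Int.fract (y i) with hf
  have hf0 : ∀ i, 0 ≤ f i := fun i => Int.fract_nonneg _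
  have hf1 : ∀ i, f i ≤ 1 := fun i => (Int.fract_lt_one _).le
  have hy : y = f + intVec fun i => ⌊y i⌋ := by
    ext i; simp [hf, intVec_apply]
  have hTy : T y = T f + T (intVec fun i => ⌊y i⌋) := by rw [← map_add, ← hy]
  obtain ⟨a, ⟨ha, hb⟩ | ⟨ha, hb⟩⟩ := exists_cyclic_order f.ofLp
  · obtain ⟨z, hz⟩ := key a f (hf1 _) ha hb (hf0 _)
    refine ⟨z + fun i => ⌊y i⌋, ?_⟩
    rw [hTy, intVec_add, map_add, add_sub_add_right_eq_sub]
    exact hz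
  · obtain ⟨z, hz⟩ := key a (intVec 1 - f) (by simpa [intVec_apply] using hf0 a)
      (by simp [intVec_apply]; linarith)
      (by simp [intVec_apply]; linarith) (by simpa [intVec_apply] using hf1 _)
    refine ⟨1 + -z + fun i => ⌊y i⌋, ?_⟩
    have := hneg _ hz
    rw [hTy, intVec_add, map_add, add_sub_add_right_eq_sub]
    convert this using 1
    simp only [intVec_add, intVec_neg, map_add, map_neg, map_sub]
    abel

/-- Vertices of the cells of the body-centred cubic lattice, grouped into three quadruples. -/
def tetVec : Fin 3 → Fin 4 → Fin 3 → ℝ :=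
  ![![![0, 1 / 2, 1], ![1, -1 / 2, 0], ![0, 1 / 2, -1], ![-1, -1 / 2, 0]],
    ![![1, 0, 1 / 2], ![0, 1, -1 / 2], ![-1, 0, 1 / 2], ![0, -1, -1 / 2]],
    ![![1 / 2, 1, 0], ![-1 / 2, 0, 1], ![1 / 2, -1, 0], ![-1 / 2, 0, -1]]]

/-- The scale that makes the vectors `tetVec` unit vectors. -/
def bccScale : ℝ := 2 / √5

theorem bccScale_pos : 0 < bccScale := by unfold bccScale; positivity

theorem bccScale_sq : bccScale ^ 2 = 4 / 5 := by
  rw [bccScale, div_pow, Real.sq_sqrt (by norm_num)]; norm_num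

theorem bccScale_lt_one : bccScale < 1 := by
  nlinarith [bccScale_sq, bccScale_pos]

theorem bccScale_gt : 4 / 5 < bccScale := by
  nlinarith [bccScale_sq, bccScale_pos]

/-- The twelve unit vectors along `tetVec`. -/
def tetPoint (a : Fin 3) (j : Fin 4) : Euc 3 := WithLp.toLp 2 fun i => bccScale * tetVec a j i

theorem tetVec_sq (a : Fin 3) (j : Fin 4) : ∑ i, tetVec a j i ^ 2 = 5 / 4 := by
  fin_cases a <;> fin_cases j <;> simp [tetVec, Fin.sum_univ_three] <;> norm_num

theorem tetVec_abs_le (a : Fin 3) (j : Fin 4) (i : Fin 3) : |tetVec a j i| ≤ 1 := by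
  fin_cases a <;> fin_cases j <;> fin_cases i <;> simp [tetVec, abs_le] <;> norm_num

theorem norm_tetPoint (a : Fin 3) (j : Fin 4) : ‖tetPoint a j‖ = 1 := by
  have h : ‖tetPoint a j‖ ^ 2 = 1 := by
    rw [EuclideanSpace.norm_sq_eq]
    simp only [tetPoint, Real.norm_eq_abs, sq_abs, mul_pow, ← Finset.mul_sum, tetVec_sq,
      bccScale_sq]
    norm_num
  nlinarith [norm_nonneg (tetPoint a j)]

theorem norm_le_sum_abs (u : Euc 3) : ‖u‖ ≤ |u 0| + |u 1| + |u 2| := by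
  rw [EuclideanSpace.norm_eq, Real.sqrt_le_left (by positivity)]
  simp only [Real.norm_eq_abs, Fin.sum_univ_three]
  nlinarith [abs_nonneg (u 0), abs_nonneg (u 1), abs_nonneg (u 2),
    mul_nonneg (abs_nonneg (u 0)) (abs_nonneg (u 1)), mul_nonneg (abs_nonneg (u 0)) (abs_nonneg (u 2)),
    mul_nonneg (abs_nonneg (u 1)) (abs_nonneg (u 2))]

theorem not_all_small {k x y z n : ℝ} (hk : 4 / 5 < k) (hn : n ≤ |x| + |y| + |z|)
    (h0 : k * (y / 2 + z) < 1 / 5 * n) (h1 : k * (x - y / 2) < 1 / 5 * n)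
    (h2 : k * (y / 2 - z) < 1 / 5 * n) (h3 : k * (-x - y / 2) < 1 / 5 * n) : False := by
  have hs : 4 / 5 * (|x| + |y| + |z|) ≤ k * (|x| + |y| + |z|) := by gcongr
  have hz : k * (y / 2 + |z|) < 1 / 5 * n := by
    rcases abs_cases z with ⟨e, -⟩ | ⟨e, -⟩ <;> rw [e] <;> linarith
  have hx : k * (|x| - y / 2) < 1 / 5 * n := by
    rcases abs_cases x with ⟨e, -⟩ | ⟨e, -⟩ <;> rw [e] <;> linarith
  have hx0 : 0 ≤ k * |x| := by positivity
  have hz0 : 0 ≤ k * |z| := by positivity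
  rcases abs_cases y with ⟨e, -⟩ | ⟨e, -⟩ <;> rw [e] at hs hn <;> linarith

theorem exists_le_inner_tetPoint (a : Fin 3) (u : Euc 3) :
    ∃ j, 1 / 5 * ‖u‖ ≤ ⟪tetPoint a j, u⟫ := by
  have hn := norm_le_sum_abs u
  by_contra! h
  have h0 := h 0
  have h1 := h 1
  have h2 := h 2
  have h3 := h 3
  simp only [inner_euc3, tetPoint] at h0 h1 h2 h3
  fin_cases a
  · refine not_all_small (n := ‖u‖) (x := u 0) (y := u 1) (z := u 2) bccScale_gt hn ?_ ?_ ?_ ?_ <;>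
      simp [tetVec] at h0 h1 h2 h3 <;> linarith
  · refine not_all_small (n := ‖u‖) (x := u 1) (y := u 2) (z := u 0) bccScale_gt (by linarith) ?_ ?_ ?_ ?_ <;>
      simp [tetVec] at h0 h1 h2 h3 <;> linarith
  · refine not_all_small (n := ‖u‖) (x := u 2) (y := u 0) (z := u 1) bccScale_gt (by linarith) ?_ ?_ ?_ ?_ <;>
      simp [tetVec] at h0 h1 h2 h3 <;> linarith

/-- The lattice map of a body-centred orthorhombic lattice. -/
def bccMap (d : Fin 3 → ℝ) : Euc 3 →ₗ[ℝ] Euc 3 :=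
  Matrix.toEuclideanLin (Matrix.of fun i j => bccScale * (d i * if i = j then 1 else -1))

theorem bccMap_single (d : Fin 3 → ℝ) (i j : Fin 3) :
    bccMap d (intVec (Pi.single j 1)) i = bccScale * (d i * if i = j then 1 else -1) := by
  simp [bccMap, Matrix.toEuclideanLin, Matrix.toLpLin, Matrix.mulVec, dotProduct, intVec_apply, Pi.single_apply]

theorem det_bccMap (d : Fin 3 → ℝ) :
    LinearMap.det (bccMap d) = -(4 * bccScale ^ 3 * (d 0 * d 1 * d 2)) := by
  rw [← det_stdMatrix, Matrix.det_fin_three]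
  have : ∀ i j, stdMatrix (bccMap d) i j = bccScale * (d i * if i = j then 1 else -1) := by
    intro i j
    rw [← bccMap_single, apply_intVec]
    simp [Pi.single_apply]
  simp only [this]
  simp
  ring

theorem mem_of_orthogonal_perturbation {K : Set (Euc 3)} (hK : Convex ℝ K) {η r ω : ℝ}
    (hη : 0 < η) (hη6 : η ≤ 1 / 6) (hin : Metric.closedBall 0 (1 - η) ⊆ K) (hr : |r| ≤ η)
    {p v : Euc 3} (hp : ‖p‖ = 1) (hmem : (1 + r) • p ∈ K) (hv : ‖v‖ ≤ ω) (hpv : ⟪p, v⟫ = 0)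
    (hω : 0 < ω) (hω1 : ω ≤ 2 * √η) : (1 + r - 3 * √η * ω) • p + v ∈ K := by
  have hs : 0 < √η := Real.sqrt_pos.2 hη
  have hss : √η ^ 2 = η := Real.sq_sqrt hη.le
  set θ := ω / (2 * √η) with hθ
  have hθ0 : 0 < θ := by positivity
  have hθ1 : θ ≤ 1 := (div_le_one (by positivity)).2 hω1
  have hωθ : ω = 2 * √η * θ := by rw [hθ]; field_simp
  have hz : (1 + r - 6 * η) • p + θ⁻¹ • v ∈ K := by
    apply hin
    rw [mem_closedBall_zero_iff]
    refine le_of_sq_le_sq ?_ (by linarith)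
    rw [norm_add_sq_real, real_inner_smul_left, real_inner_smul_right, hpv, norm_smul, norm_smul,
      mul_pow, mul_pow, hp, Real.norm_eq_abs, Real.norm_eq_abs, sq_abs, sq_abs]
    have h1 : θ⁻¹ * ‖v‖ ≤ 2 * √η := by
      rw [inv_mul_le_iff₀ hθ0]; linarith
    have h2 : (θ⁻¹ * ‖v‖) ^ 2 ≤ 4 * η := by
      calc (θ⁻¹ * ‖v‖) ^ 2 ≤ (2 * √η) ^ 2 := by gcongr
        _ = 4 * η := by rw [mul_pow, hss]; norm_num
    rw [mul_pow] at h2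
    have := abs_le.1 hr
    nlinarith
  have := hK hmem hz (sub_nonneg.2 hθ1) hθ0.le (by ring)
  convert this using 1
  rw [smul_add, smul_smul θ, smul_smul θ, mul_inv_cancel₀ hθ0.ne', one_smul, smul_smul, ← add_assoc,
    ← add_smul]
  congr 2
  rw [hωθ]
  linear_combination (-6 * θ) * hss

theorem four_mul_bccScale_pow : 4 * bccScale ^ 3 = √(1024 / 125) := by
  rw [eq_comm, Real.sqrt_eq_iff_mul_self_eq (by norm_num) (by have := bccScale_pos; positivity)]
  have : (4 * bccScale ^ 3) * (4 * bccScale ^ 3) = 16 * (bccScale ^ 2) ^ 3 := by ring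
  rw [this, bccScale_sq]; norm_num

/-- A criterion for `bccMap d` to give a lattice covering. -/
theorem isCoveringLattice_bccMap {K : Set (Euc 3)} {ε : ℝ} (hK : Convex ℝ K)
    (hsymm : K = -K) (hin : Metric.closedBall 0 (1 - ε) ⊆ K)
    (hout : K ⊆ Metric.closedBall 0 (1 + ε)) (hε : ε ≤ 1 / 400)
    {d : Fin 3 → ℝ} (hd : d 0 * d 1 * d 2 ≠ 0) (v : Fin 3 → Fin 3 → ℝ)
    (hq : ∀ a j, (WithLp.toLp 2 fun i => bccScale * (d i * tetVec a j i + v a i)) ∈ K)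
    (hclose : ∀ a j, ‖(WithLp.toLp 2 fun i => bccScale * (d i * tetVec a j i + v a i)) -
      tetPoint a j‖ ≤ 1 / 10) :
    IsCoveringLattice (bccMap d) K := by
  have hdet : LinearMap.det (bccMap d) ≠ 0 := by
    rw [det_bccMap]
    have := bccScale_pos
    exact neg_ne_zero.2 (mul_ne_zero (by positivity) hd)
  refine isCoveringLattice_of_simplices (κ := 1 / 10) hK hsymm hin hout (by linarith)
    (by norm_num) (by linarith) hdet
    (fun a j => WithLp.toLp 2 fun i => bccScale * (d i * tetVec a j i + v a i)) hq ?_ ?_ ?_ ?_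
  · intro a u
    obtain ⟨j, hj⟩ := exists_le_inner_tetPoint a u
    refine ⟨j, ?_⟩
    set q : Euc 3 := WithLp.toLp 2 fun i => bccScale * (d i * tetVec a j i + v a i) with hqd
    have h1 : ⟪q, u⟫ = ⟪tetPoint a j, u⟫ + ⟪q - tetPoint a j, u⟫ := by
      rw [inner_sub_left]; ring
    have h2 := abs_real_inner_le_norm (q - tetPoint a j) u
    have h3 : ‖q - tetPoint a j‖ * ‖u‖ ≤ 1 / 10 * ‖u‖ := by gcongr; exact hclose a j
    have := (abs_le.1 h2).1
    linarith
  all_goals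
    intro a
    ext i
    simp only [PiLp.add_apply, bccMap_single]
    fin_cases a <;> fin_cases i <;> simp [tetVec] <;> ring

theorem isCoveringLattice_bccMap_unitBall : IsCoveringLattice (bccMap 1) (unitBall 3) := by
  have h : ∀ a j, (WithLp.toLp 2 fun i => bccScale * ((1 : Fin 3 → ℝ) i * tetVec a j i +
      (0 : Fin 3 → Fin 3 → ℝ) a i)) = tetPoint a j := by
    intro a j; ext i; simp [tetPoint]
  refine isCoveringLattice_bccMap (ε := 0) (convex_closedBall _ _) (by simp)
    (by simp) (by simp) (by norm_num) (by simp) 0 ?_ ?_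
  · intro a j
    rw [h]
    simp [norm_tetPoint]
  · intro a j
    rw [h]
    simp

theorem abs_det_bccMap_one : |LinearMap.det (bccMap 1)| = √(1024 / 125) := by
  rw [det_bccMap, abs_neg, ← four_mul_bccScale_pow]
  have := bccScale_pos
  simp only [Pi.one_apply, mul_one]
  exact abs_of_nonneg (by positivity)

theorem critCoveringDet_unitBall_ge : √(1024 / 125) ≤ critCoveringDet (unitBall 3) := by
  refine le_csSup ⟨√(1024 / 125) * 1 ^ 3, ?_⟩ ⟨bccMap 1, ?_, isCoveringLattice_bccMap_unitBall,
    abs_det_bccMap_one.symm⟩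
  · rintro _ ⟨T, hT, hcov, rfl⟩
    exact abs_det_le_of_isCoveringLattice zero_le_one subset_rfl hT hcov
  · rw [← abs_pos, abs_det_bccMap_one]; positivity

/-- Trace-free diagonal maps and translations realise all mean-zero radial displacements of the
twelve vectors `tetVec`. -/
theorem exists_tet_correction (x : Fin 3 → Fin 4 → ℝ) (hx : ∑ a, ∑ j, x a j = 0) {B : ℝ}
    (hB : ∀ a j, |x a j| ≤ B) : ∃ (s : Fin 3 → ℝ) (c : Fin 3 → Fin 3 → ℝ),
      s 0 + s 1 + s 2 = 0 ∧
      (∀ a j, ∑ i, tetVec a j i * (s i * tetVec a j i + c a i) = 5 / 4 * x a j) ∧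
      (∀ i, |s i| ≤ 5 * B) ∧ ∀ a i, |c a i| ≤ 15 * B := by
  set s : Fin 3 → ℝ := fun i => -(5 / 4) * ∑ j, x (i + 2) j with hs
  set e : Fin 3 → Fin 4 → ℝ := fun a j => 5 / 4 * x a j - ∑ i, s i * tetVec a j i ^ 2 with he
  set c : Fin 3 → Fin 3 → ℝ := fun a i => if i = a then (e a 1 - e a 3) / 2 else
    if i = a + 1 then e a 0 + e a 2 else (e a 0 - e a 2) / 2 with hc
  have hsB : ∀ i, |s i| ≤ 5 * B := fun i => by
    have h : |∑ j, x (i + 2) j| ≤ ∑ _j : Fin 4, B :=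
      (Finset.abs_sum_le_sum_abs _ _).trans (Finset.sum_le_sum fun j _ => hB _ j)
    simp only [hs, abs_mul]
    norm_num at h ⊢
    linarith
  have heB : ∀ a j, |e a j| ≤ 15 / 2 * B := fun a j => by
    have h1 : |∑ i, s i * tetVec a j i ^ 2| ≤ ∑ i, 5 * B * tetVec a j i ^ 2 := by
      refine (Finset.abs_sum_le_sum_abs _ _).trans (Finset.sum_le_sum fun i _ => ?_)
      rw [abs_mul, abs_of_nonneg (sq_nonneg (tetVec a j i))]
      gcongr
      exact hsB i
    rw [← Finset.mul_sum, tetVec_sq] at h1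
    have h2 := hB a j
    rw [abs_le] at h1 h2 ⊢
    constructor <;> simp only [he] <;> linarith
  have hs0 : s 0 + s 1 + s 2 = 0 := by
    simp only [Fin.sum_univ_three] at hx
    simp [hs]
    linarith
  refine ⟨s, c, hs0, ?_, hsB, fun a i => ?_⟩
  · intro a j
    simp only [Fin.sum_univ_three, Fin.sum_univ_four] at hx
    have hs2 : s 0 = -(5 / 4) * (x 2 0 + x 2 1 + x 2 2 + x 2 3) := by
      simp [hs, Fin.sum_univ_four]
    have hs1 : s 1 = -(5 / 4) * (x 0 0 + x 0 1 + x 0 2 + x 0 3) := by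
      simp [hs, Fin.sum_univ_four]
    have hs3 : s 2 = -(5 / 4) * (x 1 0 + x 1 1 + x 1 2 + x 1 3) := by
      simp [hs, Fin.sum_univ_four]
    clear_value s
    fin_cases a <;> fin_cases j <;>
      simp [hc, he, Fin.sum_univ_three, tetVec] <;> linarith
  · have h0 := abs_le.1 (heB a 0)
    have h1 := abs_le.1 (heB a 1)
    have h2 := abs_le.1 (heB a 2)
    have h3 := abs_le.1 (heB a 3)
    rw [abs_le]
    simp only [hc]
    split_ifs <;> constructor <;> linarith

theorem one_add_le_prod {τ δ s0 s1 s2 : ℝ} (hs : s0 + s1 + s2 = 0) (h0 : |s0| ≤ 10 * δ)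
    (h1 : |s1| ≤ 10 * δ) (h2 : |s2| ≤ 10 * δ) (hδ : δ ≤ 1) (hτ : |τ| ≤ 1) :
    1 + 3 * τ - 1600 * δ ^ 2 ≤ (1 + τ + s0) * (1 + τ + s1) * (1 + τ + s2) := by
  have hδ0 : 0 ≤ δ := by linarith [abs_nonneg s0]
  have hp : ∀ a b : ℝ, |a| ≤ 10 * δ → |b| ≤ 10 * δ → |a * b| ≤ 100 * δ ^ 2 := fun a b ha hb => by
    rw [abs_mul]
    calc |a| * |b| ≤ (10 * δ) * (10 * δ) := by gcongr
      _ = 100 * δ ^ 2 := by ring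
  have h01 := hp _ _ h0 h1
  have h02 := hp _ _ h0 h2
  have h12 := hp _ _ h1 h2
  have h012 : |s0 * s1 * s2| ≤ 1000 * δ ^ 2 := by
    rw [abs_mul]
    calc |s0 * s1| * |s2| ≤ (100 * δ ^ 2) * (10 * 1) := by gcongr; linarith
      _ = 1000 * δ ^ 2 := by ring
  have he : |s0 * s1 + s0 * s2 + s1 * s2| ≤ 300 * δ ^ 2 := by
    rw [abs_le] at *; constructor <;> linarith
  have hτ' := abs_le.1 hτ
  have he2 : |(1 + τ) * (s0 * s1 + s0 * s2 + s1 * s2)| ≤ 600 * δ ^ 2 := by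
    rw [abs_mul, abs_of_nonneg (by linarith : 0 ≤ 1 + τ)]
    calc (1 + τ) * |s0 * s1 + s0 * s2 + s1 * s2| ≤ 2 * (300 * δ ^ 2) := by gcongr; linarith
      _ = 600 * δ ^ 2 := by ring
  have expand : (1 + τ + s0) * (1 + τ + s1) * (1 + τ + s2) = 1 + 3 * τ + τ ^ 2 * (3 + τ) +
      (1 + τ) ^ 2 * (s0 + s1 + s2) + (1 + τ) * (s0 * s1 + s0 * s2 + s1 * s2) + s0 * s1 * s2 := by
    ring
  rw [expand, hs]
  have : 0 ≤ τ ^ 2 * (3 + τ) := mul_nonneg (sq_nonneg _) (by linarith)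
  have := (abs_le.1 he2).1
  have := (abs_le.1 h012).1
  linarith

/-- If the mean radial deviation of a nearly round body at the twelve points `tetPoint` is
positive and not too small compared with the mean absolute deviation, then the body has a lattice
covering thinner than the best one of the ball. -/
theorem exists_isCoveringLattice_of_sum_pos {K : Set (Euc 3)} (hK : Convex ℝ K) (hsymm : K = -K)
    {η : ℝ} (hη : 0 < η) (hη1 : η ≤ 1 / 10 ^ 8) (hin : Metric.closedBall 0 (1 - η) ⊆ K)
    (hout : K ⊆ Metric.closedBall 0 (1 + η)) (r : Fin 3 → Fin 4 → ℝ) (hr : ∀ a j, |r a j| ≤ η)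
    (hmem : ∀ a j, (1 + r a j) • tetPoint a j ∈ K)
    (hsum : 10 ^ 5 * √η * ∑ a, ∑ j, |r a j| < ∑ a, ∑ j, r a j) :
    ∃ T : Euc 3 →ₗ[ℝ] Euc 3, IsCoveringLattice T K ∧ √(1024 / 125) < |LinearMap.det T| := by
  set δ := ∑ a, ∑ j, |r a j| with hδ
  set m := (∑ a, ∑ j, r a j) / 12 with hm
  have hs0 : 0 < √η := Real.sqrt_pos.2 hη
  have hss : √η ^ 2 = η := Real.sq_sqrt hη.le
  have hs1 : √η ≤ 1 / 10 ^ 4 := by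
    rw [Real.sqrt_le_left (by norm_num)]; norm_num at hη1 ⊢; linarith
  have hδ0 : 0 < δ := by
    have h0 : 0 ≤ δ := by positivity
    have h1 : ∑ a, ∑ j, r a j ≤ δ :=
      Finset.sum_le_sum fun a _ => Finset.sum_le_sum fun j _ => le_abs_self _
    rcases h0.eq_or_lt with h | h
    · rw [← h] at hsum h1; linarith
    · exact h
  have hδη : δ ≤ 12 * η := by
    calc δ ≤ ∑ _a : Fin 3, ∑ _j : Fin 4, η := by rw [hδ]; gcongr with a _ j _; exact hr a j
      _ = 12 * η := by simp; ring
  have hrδ : ∀ a j, |r a j| ≤ δ := fun a j =>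
    (Finset.single_le_sum (f := fun j => |r a j|) (fun _ _ => abs_nonneg _)
      (Finset.mem_univ j)).trans (Finset.single_le_sum (f := fun a => ∑ j, |r a j|)
      (fun _ _ => by positivity) (Finset.mem_univ a))
  have hmδ : |m| ≤ δ := by
    rw [hm, abs_div, abs_of_pos (by norm_num : (0 : ℝ) < 12)]
    have : |∑ a, ∑ j, r a j| ≤ δ := (Finset.abs_sum_le_sum_abs _ _).trans
      (Finset.sum_le_sum fun a _ => Finset.abs_sum_le_sum_abs _ _)
    linarith
  obtain ⟨s, c, hstr, hsc, hsB, hcB⟩ := exists_tet_correction (fun a j => r a j - m)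
    (B := 2 * δ) (by simp [Finset.sum_sub_distrib, hm]; ring)
    (fun a j => (abs_sub _ _).trans (by linarith [hrδ a j]))
  set τ := m - 3 * √η * (126 * δ) with hτ
  have hγ : 3 * √η * (126 * δ) ≤ δ := by nlinarith
  have hγ0 : 0 < 3 * √η * (126 * δ) := by positivity
  have hτδ : |τ| ≤ 2 * δ := by
    rw [abs_le] at hmδ ⊢
    constructor <;> linarith
  have hδ1 : δ ≤ 1 / 10 ^ 6 := hδη.trans (by norm_num at hη1 ⊢; linarith)
  have hdet : 1 < (1 + τ + s 0) * (1 + τ + s 1) * (1 + τ + s 2) := by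
    refine lt_of_lt_of_le ?_ (one_add_le_prod (δ := δ) hstr (by linarith [hsB 0]) (by linarith [hsB 1])
      (by linarith [hsB 2]) (by linarith) (by linarith))
    have h1 : δ ^ 2 ≤ 12 * (√η * δ) := by
      have : η ≤ √η := by nlinarith
      nlinarith
    have h2 : 12 * m = ∑ a, ∑ j, r a j := by rw [hm]; ring
    have h3 : 0 < √η * δ := by positivity
    rw [← h2] at hsum
    rw [hτ]
    nlinarith
  refine ⟨bccMap fun i => 1 + τ + s i, ?_, ?_⟩
  · have hv : ∀ a j i, |s i * tetVec a j i + c a i| ≤ 40 * δ := fun a j i => by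
      refine (abs_add_le _ _).trans ?_
      have h1 : |s i * tetVec a j i| ≤ 5 * (2 * δ) * 1 := by
        rw [abs_mul]
        gcongr
        · exact hsB i
        · exact tetVec_abs_le a j i
      linarith [hcB a i]
    refine isCoveringLattice_bccMap hK hsymm hin hout (by norm_num at hη1 ⊢; linarith) (by linarith)
      c (fun a j => ?_) (fun a j => ?_)
    · set v : Euc 3 := WithLp.toLp 2 fun i =>
        bccScale * (s i * tetVec a j i + c a i - (r a j - m) * tetVec a j i) with hvdef
      have hk := bccScale_pos
      have hk1 := bccScale_lt_one
      have hvi : ∀ i, |v i| ≤ 42 * δ := fun i => by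
        have h1 : |(r a j - m) * tetVec a j i| ≤ 2 * δ * 1 := by
          rw [abs_mul]
          gcongr
          · exact (abs_sub _ _).trans (by linarith [hrδ a j])
          · exact tetVec_abs_le a j i
        have h2 := (abs_sub _ _).trans (add_le_add (hv a j i) h1)
        calc |v i| = bccScale * |s i * tetVec a j i + c a i - (r a j - m) * tetVec a j i| := by
              rw [hvdef, abs_mul, abs_of_pos hk]
          _ ≤ 1 * (40 * δ + 2 * δ * 1) := by gcongr
          _ = 42 * δ := by ring
      have hvn : ‖v‖ ≤ 126 * δ := (norm_le_sum_abs v).trans (by linarith [hvi 0, hvi 1, hvi 2])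
      have horth : ⟪tetPoint a j, v⟫ = 0 := by
        have h1 := hsc a j
        have h2 := tetVec_sq a j
        simp only [Fin.sum_univ_three] at h1 h2
        simp only [inner_euc3, hvdef, tetPoint]
        linear_combination bccScale ^ 2 * h1 - bccScale ^ 2 * (r a j - m) * h2
      have := mem_of_orthogonal_perturbation hK hη (by norm_num at hη1 ⊢; linarith) hin (hr a j)
        (norm_tetPoint a j) (hmem a j) hvn horth (by positivity) (by nlinarith)
      convert this using 1
      ext i
      simp [hvdef, tetPoint, hτ]
      ring
    · refine (norm_le_sum_abs _).trans ?_
      have hk := bccScale_pos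
      have hk1 := bccScale_lt_one
      have h : ∀ i, |((WithLp.toLp 2 fun i => bccScale * ((1 + τ + s i) * tetVec a j i + c a i) :
          Euc 3) - tetPoint a j) i| ≤ 1 / 30 := fun i => by
        have h1 : ((WithLp.toLp 2 fun i => bccScale * ((1 + τ + s i) * tetVec a j i + c a i) :
            Euc 3) - tetPoint a j) i =
            bccScale * (τ * tetVec a j i + (s i * tetVec a j i + c a i)) := by
          simp [tetPoint]; ring
        have h2 : |τ * tetVec a j i| ≤ 2 * δ * 1 := by
          rw [abs_mul]; gcongr; exact tetVec_abs_le a j i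
        have h3 := (abs_add_le _ _).trans (add_le_add h2 (hv a j i))
        rw [h1, abs_mul, abs_of_pos hk]
        calc bccScale * |τ * tetVec a j i + (s i * tetVec a j i + c a i)|
            ≤ 1 * (2 * δ * 1 + 40 * δ) := by gcongr
          _ ≤ 1 / 30 := by norm_num at hδ1 ⊢; linarith
      linarith [h 0, h 1, h 2]
  · rw [det_bccMap, abs_neg, four_mul_bccScale_pow]
    have : (0 : ℝ) < √(1024 / 125) := by positivity
    rw [abs_of_pos (by positivity)]
    exact lt_mul_of_one_lt_right this hdet

theorem exists_odd_factorial_two_mul (i : ℕ) :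
    ∃ o : ℕ, Odd o ∧ (2 * i).factorial = 2 ^ i * i.factorial * o := by
  induction i with
  | zero => exact ⟨1, odd_one, rfl⟩
  | succ i ih =>
    obtain ⟨o, ho, h⟩ := ih
    refine ⟨(2 * i + 1) * o, (odd_two_mul_add_one i).mul ho, ?_⟩
    rw [show 2 * (i + 1) = 2 * i + 1 + 1 by ring, Nat.factorial_succ, Nat.factorial_succ, h,
      Nat.factorial_succ]
    ring

theorem not_two_pow_dvd_choose (m : ℕ) : ¬ 2 ^ (m + 1) ∣ (2 * m).choose m := by
  intro h
  obtain ⟨o, ho, hf⟩ := exists_odd_factorial_two_mul m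
  have h1 := Nat.choose_mul_factorial_mul_factorial (show m ≤ 2 * m by omega)
  rw [show 2 * m - m = m by omega, hf] at h1
  have h2 : (2 * m).choose m * m.factorial = 2 ^ m * o := by
    apply Nat.eq_of_mul_eq_mul_right m.factorial_pos
    rw [h1]; ring
  have h3 : 2 ^ m * 2 ∣ 2 ^ m * o := by
    rw [← h2, ← pow_succ]; exact h.mul_right _
  have h4 := Nat.dvd_of_mul_dvd_mul_left (by positivity) h3
  exact (Nat.not_even_iff_odd.2 ho) (even_iff_two_dvd.2 h4)

theorem choose_mul_odd_dvd {m i k o : ℕ} (hm : m = i + k)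
    (ho : (2 * i).factorial = 2 ^ i * i.factorial * o) :
    (2 * m).choose m ∣ 2 ^ i * o * ((2 * m).choose (2 * k) * (2 * k).choose k) := by
  refine ⟨m.choose k * m.choose k * i.factorial, ?_⟩
  have h1 := Nat.choose_mul_factorial_mul_factorial (show 2 * k ≤ 2 * m by omega)
  have h2 := Nat.choose_mul_factorial_mul_factorial (show k ≤ 2 * k by omega)
  have h3 := Nat.choose_mul_factorial_mul_factorial (show m ≤ 2 * m by omega)
  have h4 := Nat.choose_mul_factorial_mul_factorial (show k ≤ m by omega)
  rw [show 2 * m - 2 * k = 2 * i by omega] at h1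
  rw [show 2 * k - k = k by omega] at h2
  rw [show 2 * m - m = m by omega] at h3
  rw [show m - k = i by omega] at h4
  have hpos : 0 < i.factorial * k.factorial * k.factorial := by positivity
  apply Nat.eq_of_mul_eq_mul_right hpos
  calc 2 ^ i * o * ((2 * m).choose (2 * k) * (2 * k).choose k) *
        (i.factorial * k.factorial * k.factorial)
      = (2 * m).choose (2 * k) * ((2 * k).choose k * k.factorial * k.factorial) *
        (2 ^ i * i.factorial * o) := by ring
    _ = (2 * m).factorial := by rw [h2, ← ho, h1]
    _ = (2 * m).choose m * (m.choose k * k.factorial * i.factorial) *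
        (m.choose k * k.factorial * i.factorial) := by rw [h4, h3]
    _ = _ := by ring

/-- Integral multiples of the even Legendre polynomials, at `√(w / 25)`. -/
def legendreInt (m : ℕ) (w : ℤ) : ℤ :=
  ∑ j ∈ Finset.range (m + 1),
    ((2 * m).choose (2 * j) * (2 * j).choose j : ℤ) * ((4 * w) ^ (m - j) * (w - 25) ^ j)

theorem four_pow_dvd_legendreInt (m : ℕ) {w : ℤ} (hw : 4 ∣ w - 25) :
    4 ^ m ∣ legendreInt m w := by
  refine Finset.dvd_sum fun j hj => Dvd.dvd.mul_left ?_ _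
  have hj' : j ≤ m := Nat.lt_succ_iff.1 (Finset.mem_range.1 hj)
  rw [← Nat.sub_add_cancel hj', pow_add, Nat.sub_add_cancel hj']
  exact mul_dvd_mul (pow_dvd_pow_of_dvd (Dvd.intro _ rfl) _) (pow_dvd_pow_of_dvd hw _)

theorem odd_bracket (m : ℕ) :
    ∃ u : ℤ, Odd u ∧ (-25) ^ m + 4 * (-21) ^ m + 3 * (-9) ^ m = 8 * u := by
  have h : ((-25) ^ m + 4 * (-21) ^ m + 3 * (-9) ^ m : ℤ) ≡ 8 [ZMOD 16] := by
    have h1 : ((-25) ^ m + 4 * (-21) ^ m + 3 * (-9) ^ m : ℤ) ≡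
        7 ^ m + 4 * 11 ^ m + 3 * 7 ^ m [ZMOD 16] := by
      gcongr <;> decide
    refine h1.trans ?_
    rw [show (7 ^ m + 4 * 11 ^ m + 3 * 7 ^ m : ℤ) = 4 * (7 ^ m + 11 ^ m) by ring]
    change _ ≡ 4 * 2 [ZMOD 4 * 4]
    refine Int.ModEq.mul_left' ?_
    have h2 : (7 ^ m + 11 ^ m : ℤ) ≡ 3 ^ m + 3 ^ m [ZMOD 4] := by gcongr <;> decide
    refine h2.trans ?_
    rw [← two_mul]
    change _ ≡ 2 * 1 [ZMOD 2 * 2]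
    refine Int.ModEq.mul_left' ?_
    have := (show (3 : ℤ) ≡ 1 [ZMOD 2] by decide).pow m
    simpa using this
  obtain ⟨t, ht⟩ := h.symm.dvd
  exact ⟨2 * t + 1, odd_two_mul_add_one t, by linarith⟩

theorem legendreInt_sum_ne_zero {m : ℕ} (hm : 2 ≤ m) :
    legendreInt m 25 + legendreInt m 9 + 2 * legendreInt m 1 + 4 * legendreInt m 4 +
      3 * legendreInt m 16 + legendreInt m 0 ≠ 0 := by
  rcases Nat.lt_or_ge m 4 with hlt | hm4
  · interval_cases m <;> decide
  intro hzero
  choose o ho hof using exists_odd_factorial_two_mul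
  set O : ℕ := ∏ i ∈ Finset.range (m + 1), o i with hO
  have hOodd : Odd O := Finset.prod_induction _ Odd (fun _ _ => Odd.mul) odd_one fun i _ => ho i
  obtain ⟨u, hu, hbr⟩ := odd_bracket m
  obtain ⟨P, hP⟩ : (4 : ℤ) ^ m ∣ legendreInt m 25 + legendreInt m 9 + 2 * legendreInt m 1 :=
    dvd_add (dvd_add (four_pow_dvd_legendreInt m (by decide))
      (four_pow_dvd_legendreInt m (by decide)))
      ((four_pow_dvd_legendreInt m (by decide)).mul_left _)
  obtain ⟨R, hR⟩ : (32 * (2 * m).choose m : ℤ) ∣ (O : ℤ) * ∑ j ∈ Finset.range m,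
      ((2 * m).choose (2 * j) * (2 * j).choose j : ℤ) *
        (4 * (16 ^ (m - j) * (-21) ^ j) + 3 * (64 ^ (m - j) * (-9) ^ j)) := by
    rw [Finset.mul_sum]
    refine Finset.dvd_sum fun j hj => ?_
    have hj' : j < m := Finset.mem_range.1 hj
    obtain ⟨i, hi⟩ : ∃ i, m - j = i + 1 := ⟨m - j - 1, by omega⟩
    have h1 := choose_mul_odd_dvd (m := m) (i := i + 1) (k := j) (by omega) (hof (i + 1))
    obtain ⟨y, hy⟩ := h1
    obtain ⟨z, hz⟩ : o (i + 1) ∣ O := Finset.dvd_prod_of_mem _ (Finset.mem_range.2 (by omega))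
    have hy' : (2 ^ (i + 1) * o (i + 1) * ((2 * m).choose (2 * j) * (2 * j).choose j) : ℤ) =
      (2 * m).choose m * y := by exact_mod_cast hy
    rw [hi, hz]
    push_cast
    refine ⟨y * z * (8 ^ i * (-21) ^ j + 3 * (32 ^ i * (-9) ^ j)), ?_⟩
    have e16 : (16 : ℤ) ^ i = 2 ^ i * 8 ^ i := by rw [← mul_pow]; norm_num
    have e64 : (64 : ℤ) ^ i = 2 ^ i * 32 ^ i := by rw [← mul_pow]; norm_num
    rw [pow_succ] at hy'
    rw [pow_succ, pow_succ, e16, e64]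
    linear_combination (32 * (8 ^ i * (-21) ^ j + 3 * (32 ^ i * (-9) ^ j)) * z) * hy'
  have h0 : legendreInt m 0 = (2 * m).choose m * (-25) ^ m := by
    rw [legendreInt, Finset.sum_range_succ, Finset.sum_eq_zero]
    · simp
    · intro j hj
      have := Finset.mem_range.1 hj
      simp [show m - j ≠ 0 by omega]
  have h4 : 4 * legendreInt m 4 + 3 * legendreInt m 16 =
      (∑ j ∈ Finset.range m, ((2 * m).choose (2 * j) * (2 * j).choose j : ℤ) *
        (4 * (16 ^ (m - j) * (-21) ^ j) + 3 * (64 ^ (m - j) * (-9) ^ j))) +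
      (2 * m).choose m * (4 * (-21) ^ m + 3 * (-9) ^ m) := by
    rw [legendreInt, legendreInt, Finset.sum_range_succ, Finset.sum_range_succ, mul_add, mul_add,
      Finset.mul_sum, Finset.mul_sum, add_add_add_comm, ← Finset.sum_add_distrib]
    congr 1
    · refine Finset.sum_congr rfl fun j _ => ?_
      norm_num
      ring
    · norm_num
      ring
  have key : (4 : ℤ) ^ m * (O * P) + 8 * (2 * m).choose m * (O * u + 4 * R) = 0 := by
    have : (O : ℤ) * (4 ^ m * P + ((2 * m).choose m * (8 * u)) + ∑ j ∈ Finset.range m,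
      ((2 * m).choose (2 * j) * (2 * j).choose j : ℤ) *
        (4 * (16 ^ (m - j) * (-21) ^ j) + 3 * (64 ^ (m - j) * (-9) ^ j))) = 0 := by
      rw [← hP, ← hbr]
      have e := hzero
      rw [add_assoc (_ + _ + _) (4 * _), h4, h0] at e
      rw [← mul_zero (O : ℤ), ← e]
      ring
    rw [mul_add, hR] at this
    linear_combination this
  have hodd : Odd ((O : ℤ) * u + 4 * R) := by
    refine Odd.add_even (Odd.mul (by exact_mod_cast hOodd) hu) ?_
    exact (show Even (4 : ℤ) by decide).mul_right R
  have hdvd : (4 : ℤ) ^ m ∣ (8 * (2 * m).choose m) * (O * u + 4 * R) :=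
    ⟨-(O * P), by linear_combination key⟩
  have hcop : IsCoprime ((4 : ℤ) ^ m) (O * u + 4 * R) := by
    rw [show (4 : ℤ) = 2 ^ 2 by norm_num, ← pow_mul]
    refine IsCoprime.pow_left ?_
    obtain ⟨k, hk⟩ := hodd
    exact ⟨-k, 1, by linear_combination hk⟩
  have h8 : (8 * 2 ^ (m + 1) : ℤ) ∣ 8 * (2 * m).choose m := by
    refine dvd_trans ?_ (hcop.dvd_of_dvd_mul_right hdvd)
    rw [show (4 : ℤ) = 2 ^ 2 by norm_num, ← pow_mul, show (8 : ℤ) = 2 ^ 3 by norm_num, ← pow_add]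
    exact pow_dvd_pow _ (by omega)
  have h9 := Int.dvd_of_mul_dvd_mul_left (by norm_num) h8
  exact not_two_pow_dvd_choose m (by exact_mod_cast h9)

/-- The polynomials
`s ↦ ∑ j, C(2 * m, 2 * j) * C(2 * j, j) * 4⁻ʲ * s ^ (2 * m - 2 * j) * (s² - 1) ^ j`, in terms of `y = s²`. -/
def legendreEven (m : ℕ) (y : ℝ) : ℝ :=
  ∑ j ∈ Finset.range (m + 1),
    ((2 * m).choose (2 * j) * ((2 * j).choose j / 4 ^ j) : ℝ) * (y ^ (m - j) * (y - 1) ^ j)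

theorem legendreEven_eq (m : ℕ) (w : ℤ) :
    100 ^ m * legendreEven m (w / 25) = legendreInt m w := by
  rw [legendreEven, legendreInt, Finset.mul_sum]
  push_cast
  refine Finset.sum_congr rfl fun j hj => ?_
  have hj' : j ≤ m := Nat.lt_succ_iff.1 (Finset.mem_range.1 hj)
  obtain ⟨k, rfl⟩ := Nat.exists_eq_add_of_le hj'
  rw [Nat.add_sub_cancel_left, div_pow, show (w : ℝ) / 25 - 1 = (w - 25) / 25 by ring, div_pow,
    show (100 : ℝ) = 4 * 25 by norm_num, mul_pow, pow_add, pow_add, mul_pow]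
  field_simp

theorem legendreEven_sum_ne_zero {m : ℕ} (hm : 2 ≤ m) :
    ∑ a, ∑ j, legendreEven m (⟪tetPoint a j, tetPoint 0 0⟫ ^ 2) ≠ 0 := by
  have hinner : ∀ a j, ⟪tetPoint a j, tetPoint 0 0⟫ =
      4 / 5 * (tetVec a j 0 * tetVec 0 0 0 + tetVec a j 1 * tetVec 0 0 1 +
        tetVec a j 2 * tetVec 0 0 2) := by
    intro a j
    rw [← bccScale_sq, inner_euc3]
    simp only [tetPoint]
    ring
  intro h
  apply legendreInt_sum_ne_zero hm
  have h' : (100 : ℝ) ^ m * ∑ a, ∑ j, legendreEven m (⟪tetPoint a j, tetPoint 0 0⟫ ^ 2) =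
      (legendreInt m 25 + legendreInt m 9 + 2 * legendreInt m 1 + 4 * legendreInt m 4 +
      3 * legendreInt m 16 + legendreInt m 0 : ℤ) := by
    push_cast
    simp only [← legendreEven_eq, hinner, Fin.sum_univ_three, Fin.sum_univ_four]
    simp [tetVec]
    norm_num
    ring
  rw [h, mul_zero] at h'
  exact_mod_cast h'.symm

/-- The rotation invariant probability measure on the unit sphere, as a measure on `ℝ³`. -/
def sphereMeasure : Measure (Euc 3) :=
  (3 * volume (Metric.ball (0 : Euc 3) 1))⁻¹ •
    Measure.map Subtype.val (volume : Measure (Euc 3)).toSphere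

theorem volume_ball_ne_zero : volume (Metric.ball (0 : Euc 3) 1) ≠ 0 :=
  (Metric.measure_ball_pos _ _ one_pos).ne'

theorem sphereMeasure_apply {s : Set (Euc 3)} (hs : MeasurableSet s) :
    sphereMeasure s = (volume (Metric.ball (0 : Euc 3) 1))⁻¹ *
      volume {x : Euc 3 | x ≠ 0 ∧ ‖x‖ < 1 ∧ ‖x‖⁻¹ • x ∈ s} := by
  have hset : Ioo (0 : ℝ) 1 • ((↑) '' ((↑) ⁻¹' s : Set (Metric.sphere (0 : Euc 3) 1))) =
      {x : Euc 3 | x ≠ 0 ∧ ‖x‖ < 1 ∧ ‖x‖⁻¹ • x ∈ s} := by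
    ext x
    simp only [Set.mem_smul, mem_image, mem_preimage, Subtype.exists, mem_sphere_zero_iff_norm,
      exists_and_left, exists_prop, exists_eq_right_right, mem_ofPred_eq, mem_Ioo]
    constructor
    · rintro ⟨t, ⟨h0, h1⟩, y, ⟨hy, hy1⟩, rfl⟩
      have hn : ‖t • y‖ = t := by rw [norm_smul, hy1, Real.norm_of_nonneg h0.le, mul_one]
      refine ⟨?_, by rw [hn]; exact h1, ?_⟩
      · intro h; rw [h, norm_zero] at hn; linarith
      · rw [hn, smul_smul, inv_mul_cancel₀ h0.ne', one_smul]; exact hy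
    · rintro ⟨h0, h1, h2⟩
      have hn : 0 < ‖x‖ := norm_pos_iff.2 h0
      refine ⟨‖x‖, ⟨hn, h1⟩, ‖x‖⁻¹ • x, ⟨h2, ?_⟩, ?_⟩
      · rw [norm_smul, norm_inv, norm_norm, inv_mul_cancel₀ hn.ne']
      · rw [smul_smul, mul_inv_cancel₀ hn.ne', one_smul]
  rw [sphereMeasure, Measure.smul_apply, Measure.map_apply measurable_subtype_coe hs,
    Measure.toSphere_apply' _ (measurable_subtype_coe hs), hset, smul_eq_mul, ← mul_assoc,
    finrank_euclideanSpace_fin]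
  congr 1
  rw [ENNReal.mul_inv (Or.inl (by simp)) (Or.inl (by simp)), mul_comm, ← mul_assoc]
  norm_num
  rw [ENNReal.mul_inv_cancel (by simp) (by simp), one_mul]

instance : IsProbabilityMeasure sphereMeasure where
  measure_univ := by
    rw [sphereMeasure, Measure.smul_apply, Measure.map_apply measurable_subtype_coe .univ,
      preimage_univ, Measure.toSphere_apply_univ, finrank_euclideanSpace_fin, smul_eq_mul]
    exact ENNReal.inv_mul_cancel (mul_ne_zero (by simp) volume_ball_ne_zero)
      (ENNReal.mul_ne_top (by simp) measure_ball_lt_top.ne)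

theorem ae_norm_eq_one : ∀ᵐ x ∂sphereMeasure, ‖x‖ = 1 := by
  refine Measure.ae_smul_measure ?_ _
  rw [ae_map_iff measurable_subtype_coe.aemeasurable
    (measurableSet_eq_fun measurable_norm measurable_const)]
  exact Filter.Eventually.of_forall fun x => mem_sphere_zero_iff_norm.1 x.2

theorem measurePreserving_isometry (L : Euc 3 ≃ₗᵢ[ℝ] Euc 3) :
    MeasurePreserving L sphereMeasure sphereMeasure := by
  refine ⟨L.continuous.measurable, ?_⟩
  ext s hs
  rw [Measure.map_apply L.continuous.measurable hs, sphereMeasure_apply hs,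
    sphereMeasure_apply (L.continuous.measurable hs)]
  congr 1
  rw [← L.measurePreserving.measure_preimage_equiv (f := L.toMeasurableEquiv)
    {x | x ≠ 0 ∧ ‖x‖ < 1 ∧ ‖x‖⁻¹ • x ∈ s}]
  congr 1
  ext x
  simp

theorem integral_comp_isometry (L : Euc 3 ≃ₗᵢ[ℝ] Euc 3) (f : Euc 3 → ℝ) :
    ∫ x, f (L x) ∂sphereMeasure = ∫ x, f x ∂sphereMeasure :=
  (measurePreserving_isometry L).integral_comp L.toHomeomorph.measurableEmbedding f

theorem integrable_of_continuousOn_sphere {f : Euc 3 → ℝ} (hf : Continuous f) :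
    Integrable f sphereMeasure := by
  obtain ⟨C, hC⟩ := (isCompact_sphere (0 : Euc 3) 1).exists_bound_of_continuousOn hf.continuousOn
  refine Integrable.of_bound hf.aestronglyMeasurable C ?_
  filter_upwards [ae_norm_eq_one] with x hx
  exact hC x (mem_sphere_zero_iff_norm.2 hx)

theorem sphereMeasure_pos_of_isOpen {U : Set (Euc 3)} (hU : IsOpen U) {x : Euc 3} (hx : x ∈ U)
    (hx1 : ‖x‖ = 1) : 0 < sphereMeasure U := by
  rw [sphereMeasure, Measure.smul_apply, Measure.map_apply measurable_subtype_coe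
    hU.measurableSet, smul_eq_mul]
  refine ENNReal.mul_pos (ENNReal.inv_ne_zero.2
    (ENNReal.mul_ne_top (by simp) measure_ball_lt_top.ne)) ?_
  exact ((hU.preimage continuous_subtype_val).measure_pos _
    ⟨⟨x, mem_sphere_zero_iff_norm.2 hx1⟩, hx⟩).ne'

theorem setIntegral_star (K : Set (Euc 3)) (hK : MeasurableSet K) (r h : Euc 3 → ℝ)
    (hr0 : ∀ u, ‖u‖ = 1 → 0 < r u)
    (hKr : ∀ u, ‖u‖ = 1 → ∀ t : ℝ, 0 < t → (t • u ∈ K ↔ t ≤ r u))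
    (n : ℕ) (hh : ∀ (t : ℝ) u, h (t • u) = t ^ n * h u) (hint : IntegrableOn h K) :
    ∫ x in K, h x = volume.real (Metric.ball (0 : Euc 3) 1) * (3 / (n + 3)) *
      ∫ x, r x ^ (n + 3) * h x ∂sphereMeasure := by
  have hmp := (volume : Measure (Euc 3)).measurePreserving_homeomorphUnitSphereProd
  have h1 : ∫ x in K, h x = ∫ x : ({0}ᶜ : Set (Euc 3)), K.indicator h x
      ∂(volume : Measure (Euc 3)).comap (↑) := by
    rw [integral_subtype_comap (measurableSet_singleton _).compl (K.indicator h),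
      restrict_compl_singleton, integral_indicator hK]
  have h2 : ∀ x : ({0}ᶜ : Set (Euc 3)), K.indicator h x =
      (fun p : Metric.sphere (0 : Euc 3) 1 × Ioi (0 : ℝ) => K.indicator h ((p.2 : ℝ) • (p.1 : Euc 3)))
        (homeomorphUnitSphereProd (Euc 3) x) := by
    intro x
    have : (x : Euc 3) ≠ 0 := x.2
    simp [smul_smul, this]
  have hI : Integrable (fun p : Metric.sphere (0 : Euc 3) 1 × Ioi (0 : ℝ) =>
      K.indicator h ((p.2 : ℝ) • (p.1 : Euc 3)))
      ((volume : Measure (Euc 3)).toSphere.prod (Measure.volumeIoiPow (Module.finrank ℝ (Euc 3) - 1))) := by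
    rw [← hmp.integrable_comp_emb (Homeomorph.measurableEmbedding _)]
    have := (integrableOn_iff_comap_subtypeVal (measurableSet_singleton (0 : Euc 3)).compl).1
      (hint.integrable_indicator hK).integrableOn
    exact this.congr (Filter.Eventually.of_forall h2)
  rw [h1, integral_congr_ae (Filter.Eventually.of_forall h2)]
  refine (hmp.integral_comp (Homeomorph.measurableEmbedding _)
    (fun p : Metric.sphere (0 : Euc 3) 1 × Ioi (0 : ℝ) =>
      K.indicator h ((p.2 : ℝ) • (p.1 : Euc 3)))).trans ?_
  rw [integral_prod _ hI]
  have h3 : ∀ u : Metric.sphere (0 : Euc 3) 1,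
      ∫ t : Ioi (0 : ℝ), K.indicator h ((t : ℝ) • (u : Euc 3))
        ∂Measure.volumeIoiPow (Module.finrank ℝ (Euc 3) - 1) =
      1 / (n + 3) * (r u ^ (n + 3) * h u) := by
    intro u
    have hu := mem_sphere_zero_iff_norm.1 u.2
    rw [Measure.volumeIoiPow, integral_withDensity_eq_integral_toReal_smul]
    rotate_left
    · fun_prop
    · simp
    rw [integral_subtype_comap measurableSet_Ioi (fun t : ℝ => (ENNReal.ofReal (t ^ (Module.finrank ℝ (Euc 3) - 1))).toReal • K.indicator h (t • (u : Euc 3)))]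
    rw [setIntegral_congr_fun (g := (Iic (r u)).indicator (fun t => t ^ (n + 2) * h u)) measurableSet_Ioi]
    · rw [setIntegral_indicator measurableSet_Iic, Ioi_inter_Iic,
        ← intervalIntegral.integral_of_le (hr0 u hu).le, intervalIntegral.integral_mul_const,
        integral_pow]
      push_cast
      ring
    · intro t ht
      have ht : 0 < t := ht
      simp only [finrank_euclideanSpace_fin, smul_eq_mul]
      rw [ENNReal.toReal_ofReal (by positivity)]
      by_cases hm : t ≤ r u
      · rw [indicator_of_mem (show t ∈ Iic (r u) from hm),
          indicator_of_mem ((hKr u hu t ht).2 hm), hh]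
        ring
      · rw [indicator_of_notMem (show t ∉ Iic (r u) from hm),
          indicator_of_notMem (fun h => hm ((hKr u hu t ht).1 h)), mul_zero]
  simp_rw [h3]
  have hV : volume.real (Metric.ball (0 : Euc 3) 1) ≠ 0 :=
    (ENNReal.toReal_pos volume_ball_ne_zero measure_ball_lt_top.ne).ne'
  rw [integral_const_mul, sphereMeasure, integral_smul_measure,
    (MeasurableEmbedding.subtype_coe Metric.isClosed_sphere.measurableSet).integral_map,
    ENNReal.toReal_inv, ENNReal.toReal_mul, smul_eq_mul]
  change _ = _ * ((_ * volume.real _)⁻¹ * _)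
  norm_num
  field_simp

theorem norm_euc3 (x : Euc 3) : ‖x‖ = √(x 0 ^ 2 + x 1 ^ 2 + x 2 ^ 2) := by
  rw [EuclideanSpace.norm_eq]; simp [Fin.sum_univ_three]

theorem volume_cone_eq_zero {A : Set ℝ} (hA : MeasurableSet A)
    (h : sphereMeasure {x | x 2 ∈ A} = 0) :
    volume {x : Euc 3 | x ≠ 0 ∧ x 2 / ‖x‖ ∈ A} = 0 := by
  have hm : MeasurableSet {x : Euc 3 | x 2 ∈ A} :=
    (by fun_prop : Continuous fun x : Euc 3 => x 2).measurable hA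
  rw [sphereMeasure_apply hm, mul_eq_zero] at h
  have h0 := h.resolve_left (ENNReal.inv_ne_zero.2 measure_ball_lt_top.ne)
  refine measure_mono_null (t := ⋃ n : ℕ, ((n : ℝ) + 1) •
    {x : Euc 3 | x ≠ 0 ∧ ‖x‖ < 1 ∧ ‖x‖⁻¹ • x ∈ {x : Euc 3 | x 2 ∈ A}}) ?_ ?_
  · rintro x ⟨hx, hxA⟩
    obtain ⟨n, hn⟩ := exists_nat_gt ‖x‖
    have hn1 : (0 : ℝ) < n + 1 := by positivity
    refine mem_iUnion.2 ⟨n, (mem_smul_set_iff_inv_smul_mem₀ hn1.ne' _ _).2 ⟨?_, ?_, ?_⟩⟩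
    · exact smul_ne_zero (inv_ne_zero hn1.ne') hx
    · rw [norm_smul, norm_inv, Real.norm_of_nonneg hn1.le, inv_mul_lt_iff₀ hn1]
      linarith
    · have hx0 : ‖x‖ ≠ 0 := norm_ne_zero_iff.2 hx
      have : (‖((n : ℝ) + 1)⁻¹ • x‖⁻¹ • ((n : ℝ) + 1)⁻¹ • x) 2 = x 2 / ‖x‖ := by
        rw [norm_smul, norm_inv, Real.norm_of_nonneg hn1.le]
        simp only [PiLp.smul_apply, smul_eq_mul]
        field_simp
      rw [mem_ofPred_eq, this]
      exact hxA
  · refine measure_iUnion_null fun n => ?_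
    rw [Measure.addHaar_smul, h0, mul_zero]

theorem volume_eq_zero_of_sphereMeasure_eq_zero {A : Set ℝ} (hA : MeasurableSet A)
    (h : sphereMeasure {x | x 2 ∈ A} = 0) : volume (A ∩ Ioo (-1) 1) = 0 := by
  have hc := volume_cone_eq_zero hA h
  have hC : ∀ᵐ x : Euc 3, ¬ (x ≠ 0 ∧ x 2 / ‖x‖ ∈ A) := by
    rw [ae_iff]; simpa using hc
  have e1 := PiLp.volume_preserving_toLp (Fin 3)
  have e2 := (volume_preserving_piFinSuccAbove (fun _ : Fin 3 => ℝ) 2).symm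
  have e3 : MeasurePreserving (Prod.swap : (Fin 2 → ℝ) × ℝ → ℝ × (Fin 2 → ℝ)) volume volume :=
    Measure.measurePreserving_swap
  have hq := ((e1.comp e2).comp e3).quasiMeasurePreserving.ae hC
  have hq2 := Measure.ae_ae_of_ae_prod hq
  have hne : ∀ᵐ y : Fin 2 → ℝ, y ≠ 0 := by
    rw [ae_iff]; simp
  obtain ⟨y, hy, hy0⟩ := (hq2.and hne).exists
  set q : ℝ := y 0 ^ 2 + y 1 ^ 2 with hqdef
  have hqpos : 0 < q := by
    have : y 0 ≠ 0 ∨ y 1 ≠ 0 := by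
      by_contra! hh
      exact hy0 (funext fun i => by fin_cases i <;> simp [hh.1, hh.2])
    rcases this with h | h <;> positivity
  have hz : ∀ᵐ z : ℝ, z / √(z ^ 2 + q) ∉ A := by
    filter_upwards [hy] with z hz hzA
    apply hz
    set x : Euc 3 := (WithLp.toLp 2 ∘ (MeasurableEquiv.piFinSuccAbove (fun _ : Fin 3 => ℝ) 2).symm ∘
      Prod.swap) (y, z) with hx
    have hx0 : x 0 = y 0 := rfl
    have hx1 : x 1 = y 1 := rfl
    have hx2 : x 2 = z := rfl
    have hn : ‖x‖ = √(z ^ 2 + q) := by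
      rw [norm_euc3, hx0, hx1, hx2, hqdef]; congr 1; ring
    refine ⟨fun h => ?_, ?_⟩
    · rw [← norm_eq_zero] at h
      have : 0 < ‖x‖ := by rw [hn]; positivity
      exact this.ne' h
    · change x 2 / ‖x‖ ∈ A
      rw [hn, hx2]
      exact hzA
  have himg := MeasureTheory.addHaar_image_eq_zero_of_differentiableOn_of_addHaar_eq_zero volume
    (f := fun z : ℝ => z / √(z ^ 2 + q)) (s := {z : ℝ | z / √(z ^ 2 + q) ∈ A}) (by
      intro z _
      have : z ^ 2 + q ≠ 0 := by positivity
      have h2 : √(z ^ 2 + q) ≠ 0 := by positivity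
      have h3 : DifferentiableAt ℝ (fun z : ℝ => √(z ^ 2 + q)) z :=
        DifferentiableAt.sqrt (by fun_prop) this
      exact (differentiableAt_fun_id.fun_div h3 h2).differentiableWithinAt)
    (by rw [ae_iff] at hz; simpa using hz)
  refine measure_mono_null ?_ himg
  rintro t ⟨htA, ht1, ht2⟩
  have h1 : 0 < 1 - t ^ 2 := by nlinarith
  have hval : (√q * t / √(1 - t ^ 2)) / √((√q * t / √(1 - t ^ 2)) ^ 2 + q) = t := by
    have : (√q * t / √(1 - t ^ 2)) ^ 2 + q = (√q / √(1 - t ^ 2)) ^ 2 := by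
      rw [div_pow, div_pow, mul_pow, Real.sq_sqrt hqpos.le, Real.sq_sqrt h1.le]
      field_simp
      ring
    rw [this, Real.sqrt_sq (by positivity)]
    have : √q ≠ 0 := by positivity
    have : √(1 - t ^ 2) ≠ 0 := by positivity
    field_simp
  exact ⟨_, by rw [mem_ofPred_eq, hval]; exact htA, hval⟩

theorem sphereMeasure_restrict_sphere :
    sphereMeasure.restrict (Metric.sphere 0 1) = sphereMeasure := by
  refine Measure.restrict_eq_self_of_ae_mem ?_
  filter_upwards [ae_norm_eq_one] with x hx
  exact mem_sphere_zero_iff_norm.2 hx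

theorem integrable_prod_sphereMeasure {X : Type*} [TopologicalSpace X] [T2Space X]
    [MeasurableSpace X] [OpensMeasurableSpace X] (ν : Measure X) [IsFiniteMeasureOnCompacts ν]
    [SFinite ν] {K : Set X} (hK : IsCompact K) {F : X × Euc 3 → ℝ} (hF : Continuous F) :
    Integrable F ((ν.restrict K).prod sphereMeasure) := by
  rw [← sphereMeasure_restrict_sphere, Measure.prod_restrict]
  exact hF.continuousOn.integrableOn_compact (hK.prod (isCompact_sphere 0 1))

/-- The rotation by the angle `θ` about the third coordinate axis. -/
def axisRotation (θ : ℝ) : Euc 3 ≃ₗᵢ[ℝ] Euc 3 :=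
  LinearIsometry.toLinearIsometryEquiv
    { toFun := fun x => !₂[Real.cos θ * x 0 - Real.sin θ * x 1,
        Real.sin θ * x 0 + Real.cos θ * x 1, x 2]
      map_add' := fun x y => by
        ext i; fin_cases i <;> simp <;> ring
      map_smul' := fun c x => by
        ext i; fin_cases i <;> simp <;> ring
      norm_map' := fun x => by
        rw [norm_euc3, norm_euc3]
        congr 1
        simp
        linear_combination (x 0 ^ 2 + x 1 ^ 2) * Real.sin_sq_add_cos_sq θ } rfl

theorem axisRotation_apply (θ : ℝ) (x : Euc 3) :
    axisRotation θ x = !₂[Real.cos θ * x 0 - Real.sin θ * x 1,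
        Real.sin θ * x 0 + Real.cos θ * x 1, x 2] := rfl

theorem exists_cos_sub_eq (a b : ℝ) :
    ∃ θ₀ : ℝ, ∀ θ, a * Real.cos θ + b * Real.sin θ = √(a ^ 2 + b ^ 2) * Real.cos (θ - θ₀) := by
  refine ⟨Complex.arg ⟨a, b⟩, fun θ => ?_⟩
  have h1 := Complex.norm_mul_cos_arg ⟨a, b⟩
  have h2 := Complex.norm_mul_sin_arg ⟨a, b⟩
  have h3 : ‖(⟨a, b⟩ : ℂ)‖ = √(a ^ 2 + b ^ 2) := by
    rw [Complex.norm_def, Complex.normSq_apply]; congr 1; ring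
  rw [h3] at h1 h2
  simp only at h1 h2
  rw [Real.cos_sub]
  linear_combination -Real.cos θ * h1 - Real.sin θ * h2

theorem integral_cos_pow_even_period (j : ℕ) :
    ∫ θ in (0 : ℝ)..2 * Real.pi, Real.cos θ ^ (2 * j) =
      2 * Real.pi * ((2 * j).choose j / 4 ^ j) := by
  induction j with
  | zero => simp
  | succ j ih =>
    rw [show 2 * (j + 1) = 2 * j + 2 by ring, integral_cos_pow, ih]
    have h := Nat.succ_mul_centralBinom_succ j
    rw [Nat.centralBinom_eq_two_mul_choose, Nat.centralBinom_eq_two_mul_choose] at h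
    have h' : ((j : ℝ) + 1) * ((2 * (j + 1)).choose (j + 1) : ℝ) =
        2 * (2 * j + 1) * ((2 * j).choose j : ℝ) := by exact_mod_cast h
    rw [show 2 * j + 2 = 2 * (j + 1) by ring]
    have : ((2 * (j + 1)).choose (j + 1) : ℝ) =
        2 * (2 * j + 1) * ((2 * j).choose j : ℝ) / (j + 1) := by
      rw [← h']; field_simp
    rw [this]
    simp
    field_simp
    ring

theorem integral_trig_pow_even (a b : ℝ) (j : ℕ) :
    ∫ θ in (0 : ℝ)..2 * Real.pi, (a * Real.cos θ + b * Real.sin θ) ^ (2 * j) =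
      2 * Real.pi * (((2 * j).choose j / 4 ^ j) * (a ^ 2 + b ^ 2) ^ j) := by
  obtain ⟨θ₀, h⟩ := exists_cos_sub_eq a b
  simp_rw [h, mul_pow]
  rw [intervalIntegral.integral_const_mul, pow_mul √_, Real.sq_sqrt (by positivity),
    intervalIntegral.integral_comp_sub_right (fun θ => Real.cos θ ^ (2 * j))]
  have hp : Function.Periodic (fun θ => Real.cos θ ^ (2 * j)) (2 * Real.pi) := fun θ => by
    simp [Real.cos_add_two_pi]
  have := hp.intervalIntegral_add_eq (0 - θ₀) 0
  rw [show 2 * Real.pi - θ₀ = 0 - θ₀ + 2 * Real.pi by ring, this, zero_add,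
    integral_cos_pow_even_period]
  ring

theorem integral_mul_pow_odd (ψ : ℝ → ℝ) (a b : ℝ) {k : ℕ} (hk : Odd k) :
    ∫ x, ψ (x 2) * (x 0 * a + x 1 * b) ^ k ∂sphereMeasure = 0 := by
  have h := integral_comp_isometry (axisRotation Real.pi)
    (fun x => ψ (x 2) * (x 0 * a + x 1 * b) ^ k)
  have h2 : ∀ x : Euc 3, ψ (axisRotation Real.pi x 2) *
      (axisRotation Real.pi x 0 * a + axisRotation Real.pi x 1 * b) ^ k =
      - (ψ (x 2) * (x 0 * a + x 1 * b) ^ k) := by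
    intro x
    simp only [axisRotation_apply]
    simp
    rw [← neg_add, hk.neg_pow]
    ring
  simp only [h2, integral_neg] at h
  linarith

theorem integral_mul_pow_even {ψ : ℝ → ℝ} (hψ : Continuous ψ) (a b : ℝ) (j : ℕ) :
    ∫ x, ψ (x 2) * (x 0 * a + x 1 * b) ^ (2 * j) ∂sphereMeasure =
      ((2 * j).choose j / 4 ^ j) * (a ^ 2 + b ^ 2) ^ j *
        ∫ x, ψ (x 2) * (1 - x 2 ^ 2) ^ j ∂sphereMeasure := by
  have h : ∀ θ : ℝ, ∫ x, ψ (x 2) * (x 0 * a + x 1 * b) ^ (2 * j) ∂sphereMeasure =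
      ∫ x, ψ (x 2) * ((x 0 * a + x 1 * b) * Real.cos θ + (x 0 * b - x 1 * a) * Real.sin θ) ^ (2 * j)
        ∂sphereMeasure := by
    intro θ
    rw [← integral_comp_isometry (axisRotation θ)]
    refine integral_congr_ae (Filter.Eventually.of_forall fun x => ?_)
    simp only [axisRotation_apply]
    simp
    left
    congr 1
    ring
  have hpi : (0 : ℝ) ≤ 2 * Real.pi := by positivity
  have h2 : 2 * Real.pi * ∫ x, ψ (x 2) * (x 0 * a + x 1 * b) ^ (2 * j) ∂sphereMeasure =
      ∫ θ in (0 : ℝ)..2 * Real.pi, ∫ x, ψ (x 2) *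
        ((x 0 * a + x 1 * b) * Real.cos θ + (x 0 * b - x 1 * a) * Real.sin θ) ^ (2 * j)
        ∂sphereMeasure := by
    simp_rw [← h]
    simp
  rw [intervalIntegral.integral_of_le hpi, ← integral_Icc_eq_integral_Ioc,
    integral_integral_swap] at h2
  rotate_left
  · refine integrable_prod_sphereMeasure volume isCompact_Icc ?_
    unfold Function.uncurry
    fun_prop
  have h3 : ∀ᵐ x ∂sphereMeasure, (∫ θ in Icc (0 : ℝ) (2 * Real.pi), ψ (x 2) *
        ((x 0 * a + x 1 * b) * Real.cos θ + (x 0 * b - x 1 * a) * Real.sin θ) ^ (2 * j)) =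
      2 * Real.pi * (((2 * j).choose j / 4 ^ j) * (a ^ 2 + b ^ 2) ^ j) *
        (ψ (x 2) * (1 - x 2 ^ 2) ^ j) := by
    filter_upwards [ae_norm_eq_one] with x hx
    rw [integral_Icc_eq_integral_Ioc, ← intervalIntegral.integral_of_le hpi,
      intervalIntegral.integral_const_mul, integral_trig_pow_even]
    rw [norm_euc3, Real.sqrt_eq_one] at hx
    rw [show (x 0 * a + x 1 * b) ^ 2 + (x 0 * b - x 1 * a) ^ 2 = (a ^ 2 + b ^ 2) * (1 - x 2 ^ 2) by
      linear_combination (a ^ 2 + b ^ 2) * hx, mul_pow]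
    ring
  rw [integral_congr_ae h3, integral_const_mul] at h2
  have : (2 * Real.pi) ≠ 0 := by positivity
  apply mul_left_cancel₀ this
  rw [h2]
  ring

theorem exists_isometry_apply_eq {u v : Euc 3} (h : ‖u‖ = ‖v‖) :
    ∃ L : Euc 3 ≃ₗᵢ[ℝ] Euc 3, L u = v :=
  ⟨(ℝ ∙ (u - v))ᗮ.reflection, Submodule.reflection_sub h⟩

theorem inner_single_two (x : Euc 3) : ⟪x, EuclideanSpace.single 2 1⟫ = x 2 := by
  simp [inner_euc3]

theorem sum_range_two_mul_of_odd_eq_zero (f : ℕ → ℝ) (hf : ∀ k, Odd k → f k = 0) (m : ℕ) :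
    ∑ k ∈ Finset.range (2 * m + 1), f k = ∑ j ∈ Finset.range (m + 1), f (2 * j) := by
  induction m with
  | zero => simp
  | succ m ih =>
    rw [show 2 * (m + 1) + 1 = 2 * m + 1 + 1 + 1 by ring, Finset.sum_range_succ,
      Finset.sum_range_succ, ih, hf _ (odd_two_mul_add_one m), Finset.sum_range_succ _ (m + 1)]
    ring_nf

open Polynomial in
/-- The conditional expectation of the `2 * m`-th power of a linear form given another one. -/
def rotationPoly (m : ℕ) (s : ℝ) : ℝ[X] :=
  ∑ j ∈ Finset.range (m + 1), C (((2 * m).choose (2 * j) : ℝ) * ((2 * j).choose j / 4 ^ j) *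
    s ^ (2 * m - 2 * j) * (1 - s ^ 2) ^ j) * (X ^ (2 * m - 2 * j) * (1 - X ^ 2) ^ j)

theorem integral_ridge_mul_pow {φ : ℝ → ℝ} (hφ : Continuous φ) {p : Euc 3} (hp : ‖p‖ = 1) (m : ℕ) :
    ∫ x, φ ⟪x, p⟫ * x 2 ^ (2 * m) ∂sphereMeasure =
      ∫ x, φ (x 2) * (rotationPoly m (p 2)).eval (x 2) ∂sphereMeasure := by
  obtain ⟨L, hL⟩ := exists_isometry_apply_eq (u := p) (v := EuclideanSpace.single 2 1)
    (by simp [hp])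
  set q : Euc 3 := L (EuclideanSpace.single 2 1) with hq
  have hq2 : q 2 = p 2 := by
    rw [← inner_single_two, ← hL, hq, LinearIsometryEquiv.inner_map_map, real_inner_comm,
      inner_single_two]
  have hq1 : q 0 ^ 2 + q 1 ^ 2 = 1 - p 2 ^ 2 := by
    have : ‖q‖ = 1 := by rw [hq, LinearIsometryEquiv.norm_map]; simp
    rw [norm_euc3, Real.sqrt_eq_one, hq2] at this
    linarith
  have h1 : ∫ x, φ ⟪x, p⟫ * x 2 ^ (2 * m) ∂sphereMeasure =
      ∫ x, φ (x 2) * (x 0 * q 0 + x 1 * q 1 + x 2 * p 2) ^ (2 * m) ∂sphereMeasure := by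
    rw [← integral_comp_isometry L
      (fun x => φ (x 2) * (x 0 * q 0 + x 1 * q 1 + x 2 * p 2) ^ (2 * m))]
    refine integral_congr_ae (Filter.Eventually.of_forall fun x => ?_)
    simp only
    rw [← hq2, ← inner_euc3, hq, LinearIsometryEquiv.inner_map_map, inner_single_two,
      ← inner_single_two (L x), ← hL, LinearIsometryEquiv.inner_map_map]
  have h2 : ∀ x : Euc 3, φ (x 2) * (x 0 * q 0 + x 1 * q 1 + x 2 * p 2) ^ (2 * m) =
      ∑ k ∈ Finset.range (2 * m + 1), (((2 * m).choose k : ℝ) * p 2 ^ (2 * m - k)) *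
        ((φ (x 2) * x 2 ^ (2 * m - k)) * (x 0 * q 0 + x 1 * q 1) ^ k) := by
    intro x
    rw [add_pow, Finset.mul_sum]
    refine Finset.sum_congr rfl fun k _ => ?_
    rw [mul_pow]; ring
  rw [h1]
  simp_rw [h2]
  rw [integral_finsetSum _ fun k _ => integrable_of_continuousOn_sphere (by fun_prop)]
  simp_rw [integral_const_mul]
  rw [sum_range_two_mul_of_odd_eq_zero _ fun k hk => by
    rw [integral_mul_pow_odd (fun t => φ t * t ^ (2 * m - k)) _ _ hk, mul_zero]]
  have h3 : ∀ x : Euc 3, φ (x 2) * (rotationPoly m (p 2)).eval (x 2) =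
      ∑ j ∈ Finset.range (m + 1), (((2 * m).choose (2 * j) : ℝ) * ((2 * j).choose j / 4 ^ j) *
        p 2 ^ (2 * m - 2 * j) * (1 - p 2 ^ 2) ^ j) *
          (φ (x 2) * x 2 ^ (2 * m - 2 * j) * (1 - x 2 ^ 2) ^ j) := by
    intro x
    rw [rotationPoly, Polynomial.eval_finsetSum, Finset.mul_sum]
    refine Finset.sum_congr rfl fun k _ => ?_
    simp
    ring
  simp_rw [h3]
  rw [integral_finsetSum _ fun k _ => integrable_of_continuousOn_sphere (by fun_prop)]
  refine Finset.sum_congr rfl fun j _ => ?_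
  rw [integral_mul_pow_even (ψ := fun t => φ t * t ^ (2 * m - 2 * j)) (by fun_prop), hq1,
    integral_const_mul]
  ring

theorem natDegree_rotationPoly_le (m : ℕ) (s : ℝ) : (rotationPoly m s).natDegree ≤ 2 * m := by
  refine Polynomial.natDegree_sum_le_of_forall_le _ _ fun j hj => ?_
  have hj : j ≤ m := by simpa [Nat.lt_succ_iff] using hj
  have hd : (1 - Polynomial.X ^ 2 : Polynomial ℝ).natDegree ≤ 2 := by compute_degree
  refine (Polynomial.natDegree_C_mul_le _ _).trans (Polynomial.natDegree_mul_le.trans ?_)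
  have := Polynomial.natDegree_pow_le_of_le j hd
  rw [Polynomial.natDegree_X_pow]
  omega

theorem coeff_rotationPoly (m : ℕ) (s : ℝ) :
    (rotationPoly m s).coeff (2 * m) = legendreEven m (s ^ 2) := by
  rw [rotationPoly, Polynomial.finsetSum_coeff, legendreEven]
  refine Finset.sum_congr rfl fun j hj => ?_
  have hj : j ≤ m := by simpa [Nat.lt_succ_iff] using hj
  have hd : (1 - Polynomial.X ^ 2 : Polynomial ℝ).natDegree ≤ 2 := by compute_degree
  have hc : (1 - Polynomial.X ^ 2 : Polynomial ℝ).coeff 2 = -1 := by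
    simp [Polynomial.coeff_one]
  have h1 := Polynomial.coeff_pow_of_natDegree_le (m := j) hd
  have h2 := Polynomial.coeff_mul_add_eq_of_natDegree_le
    (Polynomial.natDegree_X_pow_le (R := ℝ) (2 * m - 2 * j))
    (Polynomial.natDegree_pow_le_of_le j hd)
  rw [show 2 * m - 2 * j + j * 2 = 2 * m by omega, h1, hc] at h2
  rw [Polynomial.coeff_C_mul, h2, Polynomial.coeff_X_pow_self, ← pow_mul, Nat.mul_sub]
  have : (s ^ 2 - 1) ^ j = (1 - s ^ 2) ^ j * (-1) ^ j := by rw [← mul_pow]; ring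
  rw [this]
  ring

/-- A zonal profile `φ` whose value at the pole dominates it, whose sum over the directions `p`
is bounded by `N`, and whose first two even moments are bounded by `N`. -/
structure RidgeBound {ι : Type*} [Fintype ι] (p : ι → Euc 3) (φ : ℝ → ℝ) (N : ℝ) : Prop where
  cont : Continuous φ
  even : ∀ t, φ (-t) = φ t
  abs_le : ∀ t, |φ t| ≤ φ 1
  sum_le : ∀ x, ‖x‖ = 1 → |∑ i, φ ⟪x, p i⟫| ≤ N
  mass_le : |∫ x, φ (x 2) ∂sphereMeasure| ≤ N
  second_le : |∫ x, φ (x 2) * x 2 ^ 2 ∂sphereMeasure| ≤ N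

open Polynomial in
/-- The polynomials whose moments against a profile are controlled by its ridge bound. -/
def boundedMoments {ι : Type*} [Fintype ι] (p : ι → Euc 3) : Submodule ℝ ℝ[X] where
  carrier := {q | ∃ C : ℝ, ∀ φ N, RidgeBound p φ N →
    |∫ x, φ (x 2) * q.eval (x 2) ∂sphereMeasure| ≤ C * N}
  zero_mem' := ⟨0, fun φ N _ => by simp⟩
  add_mem' := by
    rintro q r ⟨C, hC⟩ ⟨D, hD⟩
    refine ⟨C + D, fun φ N h => ?_⟩
    have hφ := h.cont
    simp only [eval_add, mul_add]
    rw [integral_add (integrable_of_continuousOn_sphere (by fun_prop))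
      (integrable_of_continuousOn_sphere (by fun_prop)), add_mul]
    exact (abs_add_le _ _).trans (add_le_add (hC φ N h) (hD φ N h))
  smul_mem' := by
    rintro c q ⟨C, hC⟩
    refine ⟨|c| * C, fun φ N h => ?_⟩
    simp only [eval_smul, smul_eq_mul, mul_left_comm _ c]
    rw [integral_const_mul, abs_mul, mul_assoc]
    exact mul_le_mul_of_nonneg_left (hC φ N h) (abs_nonneg c)

theorem integral_comp_neg (f : Euc 3 → ℝ) :
    ∫ x, f (-x) ∂sphereMeasure = ∫ x, f x ∂sphereMeasure :=
  integral_comp_isometry (LinearIsometryEquiv.neg ℝ) f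

open Polynomial in
theorem X_pow_mem_boundedMoments {ι : Type*} [Fintype ι] (p : ι → Euc 3) (hp : ∀ i, ‖p i‖ = 1)
    (hL : ∀ m, 2 ≤ m → ∑ i, legendreEven m (p i 2 ^ 2) ≠ 0) (n : ℕ) :
    (X ^ n : ℝ[X]) ∈ boundedMoments p := by
  induction n using Nat.strong_induction_on with
  | _ n ih =>
  rcases Nat.even_or_odd' n with ⟨m, rfl | rfl⟩
  · rcases Nat.lt_or_ge m 2 with hm | hm
    · interval_cases m
      · exact ⟨1, fun φ N h => by simpa using h.mass_le⟩
      · exact ⟨1, fun φ N h => by simpa using h.second_le⟩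
    · set Q : ℝ[X] := ∑ i, rotationPoly m (p i 2) with hQ
      have hQm : Q ∈ boundedMoments p := by
        refine ⟨1, fun φ N h => ?_⟩
        have hφ := h.cont
        have h1 : ∫ x, φ (x 2) * Q.eval (x 2) ∂sphereMeasure =
            ∫ x, (∑ i, φ ⟪x, p i⟫) * x 2 ^ (2 * m) ∂sphereMeasure := by
          simp_rw [hQ, eval_finsetSum, Finset.mul_sum, Finset.sum_mul]
          rw [integral_finsetSum _ fun k _ => integrable_of_continuousOn_sphere (by fun_prop),
            integral_finsetSum _ fun k _ => integrable_of_continuousOn_sphere (by fun_prop)]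
          exact Finset.sum_congr rfl fun i _ => (integral_ridge_mul_pow hφ (hp i) m).symm
        rw [h1, one_mul, ← Real.norm_eq_abs]
        refine (norm_integral_le_of_norm_le_const (C := N) ?_).trans (by simp)
        filter_upwards [ae_norm_eq_one] with x hx
        rw [norm_mul, Real.norm_eq_abs]
        have h2 : ‖x 2 ^ (2 * m)‖ ≤ 1 := by
          rw [norm_pow]
          refine pow_le_one₀ (norm_nonneg _) ?_
          exact (PiLp.norm_apply_le x 2).trans hx.le
        have := h.sum_le x hx
        have h0 := abs_nonneg (∑ i, φ ⟪x, p i⟫)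
        nlinarith
      have hdeg : Q.natDegree < 2 * m + 1 :=
        Nat.lt_succ_of_le (natDegree_sum_le_of_forall_le _ _ fun i _ =>
          natDegree_rotationPoly_le m _)
      have hc : Q.coeff (2 * m) = ∑ i, legendreEven m (p i 2 ^ 2) := by
        rw [hQ, finsetSum_coeff]
        exact Finset.sum_congr rfl fun i _ => coeff_rotationPoly m _
      have hsum := Q.as_sum_range' (2 * m + 1) hdeg
      rw [Finset.sum_range_succ] at hsum
      have hlow : ∑ k ∈ Finset.range (2 * m), monomial k (Q.coeff k) ∈ boundedMoments p := by
        refine Submodule.sum_mem _ fun k hk => ?_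
        rw [← C_mul_X_pow_eq_monomial, ← smul_eq_C_mul]
        exact Submodule.smul_mem _ _ (ih k (Finset.mem_range.1 hk))
      have htop : monomial (2 * m) (Q.coeff (2 * m)) ∈ boundedMoments p := by
        have := Submodule.sub_mem _ hQm hlow
        rwa [sub_eq_of_eq_add' hsum] at this
      rw [← C_mul_X_pow_eq_monomial, ← smul_eq_C_mul] at htop
      exact (Submodule.smul_mem_iff _ (by rw [hc]; exact hL m hm)).1 htop
  · refine ⟨0, fun φ N h => ?_⟩
    have h1 := integral_comp_neg (fun x => φ (x 2) * (X ^ (2 * m + 1) : ℝ[X]).eval (x 2))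
    have h2 : ∀ x : Euc 3, φ ((-x) 2) * (X ^ (2 * m + 1) : ℝ[X]).eval ((-x) 2) =
        -(φ (x 2) * (X ^ (2 * m + 1) : ℝ[X]).eval (x 2)) := by
      intro x
      simp [h.even, (odd_two_mul_add_one m).neg_pow]
    simp only [h2, integral_neg] at h1
    rw [zero_mul, abs_nonpos_iff]
    linarith

open Polynomial in
theorem exists_moment_bound {ι : Type*} [Fintype ι] (p : ι → Euc 3) (hp : ∀ i, ‖p i‖ = 1)
    (hL : ∀ m, 2 ≤ m → ∑ i, legendreEven m (p i 2 ^ 2) ≠ 0) (q : ℝ[X]) :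
    ∃ C : ℝ, ∀ φ N, RidgeBound p φ N →
      |∫ x, φ (x 2) * q.eval (x 2) ∂sphereMeasure| ≤ C * N := by
  change q ∈ boundedMoments p
  rw [q.as_sum_range]
  refine Submodule.sum_mem _ fun k _ => ?_
  rw [← C_mul_X_pow_eq_monomial, ← smul_eq_C_mul]
  exact Submodule.smul_mem _ _ (X_pow_mem_boundedMoments p hp hL k)

/-- The law of a coordinate of a uniformly random point of the sphere. -/
def coordLaw : Measure ℝ := Measure.map (fun x : Euc 3 => x 2) sphereMeasure

theorem continuous_coord_two : Continuous fun x : Euc 3 => x 2 := by fun_prop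

instance : IsProbabilityMeasure coordLaw :=
  Measure.isProbabilityMeasure_map continuous_coord_two.measurable.aemeasurable

theorem integral_coordLaw {f : ℝ → ℝ} (hf : StronglyMeasurable f) :
    ∫ t, f t ∂coordLaw = ∫ x, f (x 2) ∂sphereMeasure :=
  integral_map_of_stronglyMeasurable continuous_coord_two.measurable hf

theorem ae_coordLaw : ∀ᵐ t ∂coordLaw, t ∈ Icc (-1 : ℝ) 1 := by
  refine (ae_map_iff continuous_coord_two.measurable.aemeasurable measurableSet_Icc).2 ?_
  filter_upwards [ae_norm_eq_one] with x hx
  exact abs_le.1 ((PiLp.norm_apply_le x 2).trans hx.le)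

theorem exists_polynomial_approx {μ : Measure ℝ} [IsFiniteMeasure μ] (hμ : μ ≪ coordLaw)
    {δ : ℝ} (hδ : 0 < δ) : ∃ q : Polynomial ℝ, ∀ (φ : ℝ → ℝ) (N : ℝ), Continuous φ →
      (∀ t, |φ t| ≤ N) → |∫ t, φ t ∂μ - ∫ x, φ (x 2) * q.eval (x 2) ∂sphereMeasure| ≤ δ * N := by
  set w : ℝ → ℝ := fun t => (μ.rnDeriv coordLaw t).toReal with hw
  have hwi : Integrable w coordLaw := Measure.integrable_toReal_rnDeriv
  obtain ⟨g, -, hg, hgc, hgi⟩ := hwi.exists_hasCompactSupport_integral_sub_le (half_pos hδ)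
  obtain ⟨q, hq⟩ := exists_polynomial_near_of_continuousOn (-1) 1 g hgc.continuousOn (δ / 2)
    (half_pos hδ)
  refine ⟨q, fun φ N hφ hN => ?_⟩
  have hφb : ∀ᵐ t ∂coordLaw, ‖φ t‖ ≤ N := Filter.Eventually.of_forall hN
  have hqi : Integrable (fun t => q.eval t) coordLaw := by
    have : Integrable (fun x : Euc 3 => q.eval (x 2)) sphereMeasure :=
      integrable_of_continuousOn_sphere (by fun_prop)
    rw [coordLaw]
    exact (integrable_map_measure (by fun_prop) continuous_coord_two.measurable.aemeasurable).2 this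
  have h1 : ∫ t, φ t ∂μ = ∫ t, w t * φ t ∂coordLaw := (integral_rnDeriv_smul hμ).symm
  have h2 : ∫ x, φ (x 2) * q.eval (x 2) ∂sphereMeasure = ∫ t, q.eval t * φ t ∂coordLaw := by
    rw [integral_coordLaw (by fun_prop : Continuous fun t => q.eval t * φ t).stronglyMeasurable]
    simp_rw [mul_comm]
  have hwφ : Integrable (fun t => w t * φ t) coordLaw := hwi.mul_bdd hφ.aestronglyMeasurable hφb
  have hqφ : Integrable (fun t => q.eval t * φ t) coordLaw :=
    hqi.mul_bdd hφ.aestronglyMeasurable hφb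
  have hN0 : 0 ≤ N := (abs_nonneg _).trans (hN 0)
  rw [h1, h2, ← integral_sub hwφ hqφ, ← Real.norm_eq_abs]
  have hint : Integrable (fun t => N * (‖w t - g t‖ + δ / 2)) coordLaw :=
    (((hwi.sub hgi).norm).add (integrable_const _)).const_mul _
  refine (norm_integral_le_of_norm_le hint ?_).trans ?_
  · filter_upwards [ae_coordLaw] with t ht
    rw [← sub_mul, norm_mul, mul_comm]
    refine mul_le_mul (hN t) ?_ (norm_nonneg _) hN0
    have h3 := hq t ht
    calc ‖w t - q.eval t‖ = ‖(w t - g t) + (g t - q.eval t)‖ := by ring_nf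
      _ ≤ ‖w t - g t‖ + ‖g t - q.eval t‖ := norm_add_le _ _
      _ ≤ _ := by
        gcongr
        rw [norm_sub_rev]
        exact h3.le
  · rw [integral_const_mul, integral_add (f := fun t => ‖w t - g t‖) (hwi.sub hgi).norm (integrable_const _)]
    simp only [integral_const, probReal_univ, smul_eq_mul, one_mul]
    rw [mul_comm]
    gcongr
    linarith

theorem volume_cos_preimage_eq_zero {M : Set ℝ} (hM : volume M = 0) :
    volume {θ : ℝ | Real.cos θ ∈ M} = 0 := by
  have hd : ∀ ε : ℝ, ε = 1 ∨ ε = -1 → volume ((fun t => Real.arccos (ε * t)) '' (M ∩ Ioo (-1) 1)) = 0 := by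
    intro ε hε
    refine addHaar_image_eq_zero_of_differentiableOn_of_addHaar_eq_zero volume ?_
      (measure_mono_null inter_subset_left hM)
    rintro t ⟨-, h1, h2⟩
    refine DifferentiableAt.differentiableWithinAt ?_
    refine (Real.differentiableAt_arccos.2 ⟨?_, ?_⟩).comp t (by fun_prop) <;>
      rcases hε with rfl | rfl <;> intro h <;> linarith
  have hsub : {θ : ℝ | Real.cos θ ∈ M} ⊆ (⋃ m : ℤ, {(m : ℝ) * Real.pi}) ∪
      ⋃ m : ℤ, ((((m : ℝ) * Real.pi) +ᵥ ((fun t => Real.arccos (1 * t)) '' (M ∩ Ioo (-1) 1))) ∪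
        (((m : ℝ) * Real.pi) +ᵥ ((fun t => Real.arccos (-1 * t)) '' (M ∩ Ioo (-1) 1)))) := by
    intro θ hθ
    have hθ : Real.cos θ ∈ M := hθ
    by_cases hs : Real.sin θ = 0
    · obtain ⟨m, hm⟩ := Real.sin_eq_zero_iff.1 hs
      exact Or.inl (mem_iUnion.2 ⟨m, hm.symm⟩)
    right
    set m : ℤ := ⌊θ / Real.pi⌋ with hm
    refine mem_iUnion.2 ⟨m, ?_⟩
    have h0 : 0 ≤ θ - m * Real.pi := by
      have := Int.floor_le (θ / Real.pi)
      rw [le_div_iff₀ Real.pi_pos] at this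
      linarith
    have h1 : θ - m * Real.pi ≤ Real.pi := by
      have := (Int.lt_floor_add_one (θ / Real.pi)).le
      rw [div_le_iff₀ Real.pi_pos] at this
      linarith
    have hc : Real.cos θ ∈ Ioo (-1 : ℝ) 1 := by
      have h2 := Real.sin_sq_add_cos_sq θ
      have h3 : 0 < Real.sin θ ^ 2 := by positivity
      constructor <;> nlinarith
    have hcos := Real.cos_sub_int_mul_pi θ m
    rcases Int.even_or_odd m with he | ho
    · left
      rw [he.neg_one_zpow] at hcos
      refine mem_vadd_set.2 ⟨θ - m * Real.pi, ⟨Real.cos θ, ⟨hθ, hc⟩, ?_⟩, by simp⟩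
      simp only
      rw [← hcos, Real.arccos_cos h0 h1]
    · right
      rw [ho.neg_one_zpow] at hcos
      refine mem_vadd_set.2 ⟨θ - m * Real.pi, ⟨Real.cos θ, ⟨hθ, hc⟩, ?_⟩, by simp⟩
      simp only
      rw [← hcos, Real.arccos_cos h0 h1]
  refine measure_mono_null hsub (measure_union_null (measure_iUnion_null fun m => by simp)
    (measure_iUnion_null fun m => measure_union_null ?_ ?_))
  · rw [measure_vadd]; exact hd 1 (Or.inl rfl)
  · rw [measure_vadd]; exact hd (-1) (Or.inr rfl)

theorem map_trig_absolutelyContinuous (a b c : ℝ) (hab : a ≠ 0 ∨ b ≠ 0)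
    (hle : ∀ θ, a * Real.cos θ + b * Real.sin θ + c ∈ Icc (-1 : ℝ) 1) :
    Measure.map (fun θ => a * Real.cos θ + b * Real.sin θ + c) (volume.restrict (Icc 0 1)) ≪
      coordLaw := by
  refine Measure.AbsolutelyContinuous.mk fun A hA h0 => ?_
  have hcont : Continuous fun θ => a * Real.cos θ + b * Real.sin θ + c := by fun_prop
  rw [coordLaw, Measure.map_apply continuous_coord_two.measurable hA] at h0
  have hA0 := volume_eq_zero_of_sphereMeasure_eq_zero hA h0
  have hA1 : volume (A ∩ Icc (-1) 1) = 0 := by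
    refine measure_mono_null (t := (A ∩ Ioo (-1) 1) ∪ {1, -1}) ?_
      (measure_union_null hA0 ((Set.toFinite _).measure_zero _))
    rintro t ⟨ht, h1, h2⟩
    rcases h1.lt_or_eq with h1 | h1
    · rcases h2.lt_or_eq with h2 | h2
      · exact Or.inl ⟨ht, h1, h2⟩
      · exact Or.inr (by simp [h2])
    · exact Or.inr (by simp [← h1])
  obtain ⟨θ₀, hθ⟩ := exists_cos_sub_eq a b
  have hr : √(a ^ 2 + b ^ 2) ≠ 0 := by
    have : 0 < a ^ 2 + b ^ 2 := by rcases hab with h | h <;> positivity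
    positivity
  set r := √(a ^ 2 + b ^ 2)
  rw [Measure.map_apply hcont.measurable hA]
  refine Measure.restrict_le_self.absolutelyContinuous ?_
  set M : Set ℝ := (fun t => (t - c) / r) '' (A ∩ Icc (-1) 1)
  have hM : volume M = 0 :=
    addHaar_image_eq_zero_of_differentiableOn_of_addHaar_eq_zero volume (by fun_prop) hA1
  have h2 := volume_cos_preimage_eq_zero hM
  refine measure_mono_null (fun θ hθA => ?_)
    ((measurePreserving_sub_right volume θ₀).quasiMeasurePreserving.preimage_null h2)
  refine ⟨_, ⟨hθA, hle θ⟩, ?_⟩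
  simp only
  rw [hθ θ]
  field_simp
  ring

/-- The parallel of height `s` on the unit sphere. -/
def parallel (s θ : ℝ) : Euc 3 := !₂[√(1 - s ^ 2) * Real.cos θ, √(1 - s ^ 2) * Real.sin θ, s]

theorem norm_parallel {s : ℝ} (hs : s ^ 2 ≤ 1) (θ : ℝ) : ‖parallel s θ‖ = 1 := by
  rw [norm_euc3, Real.sqrt_eq_one]
  simp only [parallel, PiLp.toLp_apply, Matrix.cons_val]
  have := Real.sq_sqrt (sub_nonneg.2 hs)
  linear_combination (Real.sin θ ^ 2 + Real.cos θ ^ 2) * this +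
    (1 - s ^ 2) * Real.sin_sq_add_cos_sq θ

theorem inner_parallel (s θ : ℝ) (p : Euc 3) :
    ⟪parallel s θ, p⟫ = (√(1 - s ^ 2) * p 0) * Real.cos θ + (√(1 - s ^ 2) * p 1) * Real.sin θ
      + s * p 2 := by
  rw [inner_euc3]
  simp only [parallel, PiLp.toLp_apply, Matrix.cons_val]
  ring

theorem sq_coord_le_one {p : Euc 3} (hp : ‖p‖ = 1) : p 2 ^ 2 ≤ 1 := by
  rw [norm_euc3, Real.sqrt_eq_one] at hp
  nlinarith [sq_nonneg (p 0), sq_nonneg (p 1)]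

theorem exists_parallel_average_bound {ι : Type*} [Fintype ι] (p : ι → Euc 3)
    (hp : ∀ i, ‖p i‖ = 1) (hL : ∀ m, 2 ≤ m → ∑ i, legendreEven m (p i 2 ^ 2) ≠ 0)
    {s : ℝ} (hs : s ^ 2 < 1) {v : Euc 3} (hv : ‖v‖ = 1) (hv2 : v 2 ^ 2 ≠ 1) {δ : ℝ} (hδ : 0 < δ) :
    ∃ D : ℝ, ∀ φ N, RidgeBound p φ N →
      |∫ θ in Icc (0 : ℝ) 1, φ ⟪parallel s θ, v⟫| ≤ D * N + δ * φ 1 := by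
  have hσ : √(1 - s ^ 2) ≠ 0 := by
    have : 0 < 1 - s ^ 2 := by linarith
    positivity
  have hv' := hv
  rw [norm_euc3, Real.sqrt_eq_one] at hv'
  have hab : √(1 - s ^ 2) * v 0 ≠ 0 ∨ √(1 - s ^ 2) * v 1 ≠ 0 := by
    by_contra! h
    have h0 := (mul_eq_zero.1 h.1).resolve_left hσ
    have h1 := (mul_eq_zero.1 h.2).resolve_left hσ
    apply hv2
    rw [h0, h1] at hv'
    linarith
  have hle : ∀ θ, (√(1 - s ^ 2) * v 0) * Real.cos θ + (√(1 - s ^ 2) * v 1) * Real.sin θ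
      + s * v 2 ∈ Icc (-1 : ℝ) 1 := by
    intro θ
    rw [← inner_parallel, mem_Icc, ← abs_le]
    refine (abs_real_inner_le_norm _ _).trans ?_
    rw [norm_parallel hs.le, hv, one_mul]
  have hcont : Continuous fun θ => (√(1 - s ^ 2) * v 0) * Real.cos θ +
    (√(1 - s ^ 2) * v 1) * Real.sin θ + s * v 2 := by fun_prop
  obtain ⟨q, hq⟩ := exists_polynomial_approx (map_trig_absolutelyContinuous _ _ _ hab hle) hδ
  obtain ⟨D, hD⟩ := exists_moment_bound p hp hL q
  refine ⟨D, fun φ N h => ?_⟩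
  have h1 := hq φ (φ 1) h.cont h.abs_le
  have h2 := hD φ N h
  rw [integral_map_of_stronglyMeasurable hcont.measurable h.cont.stronglyMeasurable] at h1
  simp_rw [inner_parallel]
  rw [abs_le] at *
  constructor <;> linarith [h1.1, h1.2, h2.1, h2.2]

theorem exists_ridge_inversion {ι : Type*} [Fintype ι] [DecidableEq ι] (p : ι → Euc 3) (i₀ : ι)
    (hp : ∀ i, ‖p i‖ = 1) (h0 : p i₀ = EuclideanSpace.single 2 1)
    (hne : ∀ i, i ≠ i₀ → p i 2 ^ 2 ≠ 1)
    (hL : ∀ m, 2 ≤ m → ∑ i, legendreEven m (p i 2 ^ 2) ≠ 0) :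
    ∃ C : ℝ, ∀ φ N, RidgeBound p φ N → φ 1 ≤ C * N := by
  set c : ℝ := (Fintype.card ι : ℝ) with hc
  have hc0 : 0 ≤ c := by positivity
  set δ : ℝ := 1 / (2 * (c ^ 2 + 1)) with hδ
  have hδ0 : 0 < δ := by positivity
  have hlt : ∀ i, i ≠ i₀ → p i 2 ^ 2 < 1 := fun i hi =>
    lt_of_le_of_ne (sq_coord_le_one (hp i)) (hne i hi)
  have hD : ∀ i k, ∃ D : ℝ, i ≠ i₀ → k ≠ i₀ → ∀ φ N, RidgeBound p φ N →
      |∫ θ in Icc (0 : ℝ) 1, φ ⟪parallel (p i 2) θ, p k⟫| ≤ D * N + δ * φ 1 := by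
    intro i k
    by_cases hi : i = i₀
    · exact ⟨0, fun h => absurd hi h⟩
    by_cases hk : k = i₀
    · exact ⟨0, fun _ h => absurd hk h⟩
    obtain ⟨D, h⟩ := exists_parallel_average_bound p hp hL (hlt i hi) (hp k) (hne k hk) hδ0
    exact ⟨D, fun _ _ => h⟩
  choose D hD using hD
  refine ⟨2 * (1 + ∑ i ∈ Finset.univ.erase i₀, (1 + ∑ k ∈ Finset.univ.erase i₀, D i k)),
    fun φ N h => ?_⟩
  have hφ := h.cont
  have hφ1 : 0 ≤ φ 1 := (abs_nonneg _).trans (h.abs_le 0)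
  have hinner : ∀ x : Euc 3, ⟪x, p i₀⟫ = x 2 := fun x => by rw [h0, inner_single_two]
  have hpole : |φ 1 + ∑ i ∈ Finset.univ.erase i₀, φ (p i 2)| ≤ N := by
    have := h.sum_le (p i₀) (hp i₀)
    rw [← Finset.add_sum_erase _ _ (Finset.mem_univ i₀), real_inner_self_eq_norm_sq, hp] at this
    simp only [real_inner_comm _ (p i₀), hinner] at this
    simpa using this
  have hi : ∀ i ∈ Finset.univ.erase i₀, |φ (p i 2)| ≤
      (1 + ∑ k ∈ Finset.univ.erase i₀, D i k) * N + c * δ * φ 1 := by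
    intro i hi
    have hi := (Finset.mem_erase.1 hi).1
    have hcont : ∀ k, Continuous fun θ => φ ⟪parallel (p i 2) θ, p k⟫ := by
      intro k
      simp_rw [inner_parallel]
      fun_prop
    have hInt : ∀ k, IntegrableOn (fun θ => φ ⟪parallel (p i 2) θ, p k⟫) (Icc (0 : ℝ) 1) :=
      fun k => (hcont k).continuousOn.integrableOn_compact isCompact_Icc
    have h1 : |∫ θ in Icc (0 : ℝ) 1, ∑ k, φ ⟪parallel (p i 2) θ, p k⟫| ≤ N := by
      rw [← Real.norm_eq_abs]
      refine (norm_integral_le_of_norm_le_const (C := N)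
        (Filter.Eventually.of_forall fun θ => ?_)).trans ?_
      · exact h.sum_le _ (norm_parallel (hlt i hi).le θ)
      · simp
    rw [integral_finsetSum _ fun k _ => hInt k,
      ← Finset.add_sum_erase _ _ (Finset.mem_univ i₀)] at h1
    have h2 : ∫ θ in Icc (0 : ℝ) 1, φ ⟪parallel (p i 2) θ, p i₀⟫ = φ (p i 2) := by
      simp only [hinner]
      simp [parallel]
    rw [h2] at h1
    have h3 : |∑ k ∈ Finset.univ.erase i₀, ∫ θ in Icc (0 : ℝ) 1, φ ⟪parallel (p i 2) θ, p k⟫| ≤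
        (∑ k ∈ Finset.univ.erase i₀, D i k) * N + c * δ * φ 1 := by
      refine (Finset.abs_sum_le_sum_abs _ _).trans ((Finset.sum_le_sum fun k hk =>
        hD i k hi (Finset.mem_erase.1 hk).1 φ N h).trans ?_)
      rw [Finset.sum_add_distrib, Finset.sum_mul, Finset.sum_const, nsmul_eq_mul, mul_assoc c]
      gcongr
      rw [hc]
      exact_mod_cast Finset.card_le_univ _
    rw [abs_le] at *
    constructor <;> linarith [h1.1, h1.2, h3.1, h3.2]
  have hsum : |∑ i ∈ Finset.univ.erase i₀, φ (p i 2)| ≤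
      (∑ i ∈ Finset.univ.erase i₀, (1 + ∑ k ∈ Finset.univ.erase i₀, D i k)) * N +
        c * (c * δ * φ 1) := by
    refine (Finset.abs_sum_le_sum_abs _ _).trans ((Finset.sum_le_sum hi).trans ?_)
    rw [Finset.sum_add_distrib, Finset.sum_mul, Finset.sum_const, nsmul_eq_mul]
    gcongr
    rw [hc]
    exact_mod_cast Finset.card_le_univ _
  have hcδ : c * (c * δ * φ 1) ≤ φ 1 / 2 := by
    have : c * (c * δ) ≤ 1 / 2 := by
      rw [hδ]
      field_simp
      linarith
    nlinarith
  rw [abs_le] at hpole hsum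
  linarith [hpole.2, hsum.1]

theorem RidgeBound.comp_isometry {ι : Type*} [Fintype ι] {p : ι → Euc 3} {φ : ℝ → ℝ} {N : ℝ}
    (h : RidgeBound p φ N) (L : Euc 3 ≃ₗᵢ[ℝ] Euc 3) : RidgeBound (fun i => L (p i)) φ N where
  cont := h.cont
  even := h.even
  abs_le := h.abs_le
  sum_le x hx := by
    have := h.sum_le (L.symm x) (by simpa using hx)
    have h2 : ∀ i, ⟪x, L (p i)⟫ = ⟪L.symm x, p i⟫ := fun i => by
      rw [← L.inner_map_map (L.symm x), L.apply_symm_apply]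
    simpa only [h2] using this
  mass_le := h.mass_le
  second_le := h.second_le

theorem inner_tetPoint_sq_ne_one {i : Fin 3 × Fin 4} (hi : i ≠ (0, 0)) :
    ⟪tetPoint i.1 i.2, tetPoint 0 0⟫ ^ 2 ≠ 1 := by
  obtain ⟨a, j⟩ := i
  have hinner : ∀ a j, ⟪tetPoint a j, tetPoint 0 0⟫ =
      4 / 5 * (tetVec a j 0 * tetVec 0 0 0 + tetVec a j 1 * tetVec 0 0 1 +
        tetVec a j 2 * tetVec 0 0 2) := by
    intro a j
    rw [← bccScale_sq, inner_euc3]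
    simp only [tetPoint]
    ring
  simp only [hinner]
  fin_cases a <;> fin_cases j <;> first | exact absurd rfl hi | (simp [tetVec]; try norm_num)

theorem exists_tetPoint_inversion : ∃ C : ℝ, ∀ φ N,
    RidgeBound (fun i : Fin 3 × Fin 4 => tetPoint i.1 i.2) φ N → φ 1 ≤ C * N := by
  obtain ⟨L, hL⟩ := exists_isometry_apply_eq (u := tetPoint 0 0) (v := EuclideanSpace.single 2 1)
    (by simp [norm_tetPoint])
  have hc : ∀ i : Fin 3 × Fin 4, (L (tetPoint i.1 i.2)) 2 = ⟪tetPoint i.1 i.2, tetPoint 0 0⟫ := by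
    intro i
    rw [← inner_single_two, ← hL, L.inner_map_map]
  obtain ⟨C, hC⟩ := exists_ridge_inversion (fun i : Fin 3 × Fin 4 => L (tetPoint i.1 i.2)) (0, 0)
    (fun i => by rw [L.norm_map, norm_tetPoint]) hL
    (fun i hi => by rw [hc]; exact inner_tetPoint_sq_ne_one hi)
    (fun m hm => by
      simp_rw [hc]
      rw [Fintype.sum_prod_type]
      exact legendreEven_sum_ne_zero hm)
  exact ⟨C, fun φ N h => hC φ N (h.comp_isometry L)⟩

instance : ContinuousStar (Euc 3 →L[ℝ] Euc 3) := ⟨ContinuousLinearMap.adjoint.continuous⟩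

/-- The orthogonal group of `ℝ³`. -/
abbrev OrthGroup := unitary (Euc 3 →L[ℝ] Euc 3)

instance : MeasurableSpace OrthGroup := borel _

instance : BorelSpace OrthGroup := ⟨rfl⟩

instance : CompactSpace OrthGroup := by
  have : ProperSpace (Euc 3 →L[ℝ] Euc 3) := FiniteDimensional.proper ℝ _
  refine isCompact_iff_compactSpace.1 (Metric.isCompact_of_isClosed_isBounded isClosed_unitary ?_)
  · refine (Metric.isBounded_closedBall (x := 0) (r := 1)).subset fun u hu => ?_
    rw [mem_closedBall_zero_iff]
    exact ContinuousLinearMap.opNorm_le_bound _ zero_le_one fun x => by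
      rw [ContinuousLinearMap.norm_map_of_mem_unitary hu, one_mul]

/-- The invariant probability measure on the orthogonal group. -/
def orthHaar : Measure OrthGroup := Measure.haarMeasure ⊤

instance : IsProbabilityMeasure orthHaar where
  measure_univ := Measure.haarMeasure_self (K₀ := (⊤ : TopologicalSpace.PositiveCompacts OrthGroup))

instance : orthHaar.IsMulLeftInvariant := by unfold orthHaar; infer_instance

/-- The action of the inverse of an orthogonal map on a vector. -/
def pull (g : OrthGroup) (x : Euc 3) : Euc 3 := ((g⁻¹ : OrthGroup) : Euc 3 →L[ℝ] Euc 3) x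

theorem continuous_pull : Continuous fun z : OrthGroup × Euc 3 => pull z.1 z.2 := by
  unfold pull
  have : Continuous fun z : OrthGroup × Euc 3 => ((z.1⁻¹ : OrthGroup) : Euc 3 →L[ℝ] Euc 3) :=
    continuous_subtype_val.comp (continuous_inv.comp continuous_fst)
  exact this.clm_apply continuous_snd

theorem continuous_pull_left (x : Euc 3) : Continuous fun g : OrthGroup => pull g x :=
  continuous_pull.comp (f := fun g : OrthGroup => (g, x)) (Continuous.prodMk_left x)

/-- `pull g` as a linear isometry. -/
def pullEquiv (g : OrthGroup) : Euc 3 ≃ₗᵢ[ℝ] Euc 3 := Unitary.linearIsometryEquiv g⁻¹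

theorem norm_pull (g : OrthGroup) (x : Euc 3) : ‖pull g x‖ = ‖x‖ := (pullEquiv g).norm_map x

theorem integral_pull_isometry (L : Euc 3 ≃ₗᵢ[ℝ] Euc 3) (F : Euc 3 → Euc 3 → ℝ) (u v : Euc 3) :
    ∫ g, F (pull g (L u)) (pull g (L v)) ∂orthHaar = ∫ g, F (pull g u) (pull g v) ∂orthHaar := by
  set h : OrthGroup := Unitary.linearIsometryEquiv.symm L with hh
  have hL : ∀ x, (h : Euc 3 →L[ℝ] Euc 3) x = L x := fun x => rfl
  rw [← integral_mul_left_eq_self (fun g => F (pull g u) (pull g v)) h⁻¹]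
  refine integral_congr_ae (Filter.Eventually.of_forall fun g => ?_)
  have : ∀ x, pull (h⁻¹ * g) x = pull g (L x) := fun x => by
    rw [pull, mul_inv_rev, inv_inv]
    rfl
  simp only [this]

theorem exists_isometry_pair {u v u' v' : Euc 3} (hu : ‖u‖ = ‖u'‖) (hv : ‖v‖ = ‖v'‖)
    (h : ⟪u, v⟫ = ⟪u', v'⟫) : ∃ L : Euc 3 ≃ₗᵢ[ℝ] Euc 3, L u = u' ∧ L v = v' := by
  obtain ⟨L, hL⟩ := exists_isometry_apply_eq hu
  have hw : ‖L v‖ = ‖v'‖ := by rw [L.norm_map, hv]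
  refine ⟨L.trans ((ℝ ∙ (L v - v'))ᗮ).reflection, ?_, ?_⟩
  · rw [LinearIsometryEquiv.trans_apply, hL]
    refine Submodule.reflection_mem_subspace_eq_self ?_
    rw [Submodule.mem_orthogonal_singleton_iff_inner_left, inner_sub_right, ← h, ← hL,
      L.inner_map_map, sub_self]
  · rw [LinearIsometryEquiv.trans_apply]
    exact Submodule.reflection_sub hw

instance : SecondCountableTopology OrthGroup := inferInstance

theorem integral_comp_pull (g : OrthGroup) (f : Euc 3 → ℝ) :
    ∫ x, f (pull g x) ∂sphereMeasure = ∫ x, f x ∂sphereMeasure :=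
  integral_comp_isometry (pullEquiv g) f

theorem inner_pull (g : OrthGroup) (x y : Euc 3) : ⟪pull g x, pull g y⟫ = ⟪x, y⟫ :=
  (pullEquiv g).inner_map_map x y

theorem integral_pull {χ : Euc 3 → ℝ} (hχ : Continuous χ) {M : ℝ} (hM : ∀ x, |χ x| ≤ M)
    {p : Euc 3} (hp : ‖p‖ = 1) :
    ∫ g, χ (pull g p) ∂orthHaar = ∫ x, χ x ∂sphereMeasure := by
  have hconst : ∀ x : Euc 3, ‖x‖ = 1 →
      ∫ g, χ (pull g x) ∂orthHaar = ∫ g, χ (pull g p) ∂orthHaar := fun x hx => by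
    obtain ⟨L, hL⟩ := exists_isometry_apply_eq (u := p) (v := x) (by rw [hp, hx])
    rw [← hL]
    exact integral_pull_isometry L (fun y _ => χ y) p p
  have hint : Integrable (fun z : Euc 3 × OrthGroup => χ (pull z.2 z.1))
      (sphereMeasure.prod orthHaar) :=
    Integrable.of_bound (C := M)
      (hχ.comp (continuous_pull.comp (continuous_swap))).aestronglyMeasurable
      (Filter.Eventually.of_forall fun z => hM _)
  calc ∫ g, χ (pull g p) ∂orthHaar
      = ∫ x, ∫ g, χ (pull g x) ∂orthHaar ∂sphereMeasure := by
        rw [integral_congr_ae (g := fun _ => ∫ g, χ (pull g p) ∂orthHaar)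
          (ae_norm_eq_one.mono fun x hx => hconst x hx)]
        simp
    _ = ∫ g, ∫ x, χ (pull g x) ∂sphereMeasure ∂orthHaar := integral_integral_swap hint
    _ = ∫ x, χ x ∂sphereMeasure := by
        simp [integral_comp_pull]

/-- A sign function that never vanishes. -/
def unitSign (y : ℝ) : ℝ := if 0 ≤ y then 1 else -1

theorem abs_unitSign (y : ℝ) : |unitSign y| = 1 := by
  unfold unitSign; split_ifs <;> simp

theorem unitSign_mul_self (y : ℝ) : unitSign y * y = |y| := by
  unfold unitSign
  split_ifs with h
  · rw [abs_of_nonneg h, one_mul]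
  · rw [abs_of_neg (not_le.1 h)]; ring

theorem measurable_unitSign : Measurable unitSign :=
  Measurable.ite measurableSet_Ici measurable_const measurable_const

/-- The correlation over the orthogonal group of the sign of `ρ` at `u` with `ρ` at `v`. -/
def signCorr (ρ : Euc 3 → ℝ) (u v : Euc 3) : ℝ :=
  ∫ g, unitSign (ρ (pull g u)) * ρ (pull g v) ∂orthHaar

/-- `signCorr` as a function of the inner product of its arguments. -/
def signCorrProfile (ρ : Euc 3 → ℝ) (t : ℝ) : ℝ :=
  signCorr ρ (EuclideanSpace.single 2 1) (parallel (max (-1) (min 1 t)) 0)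

section

variable {ρ : Euc 3 → ℝ} {M : ℝ}

theorem measurable_unitSign_pull (hρ : Continuous ρ) (u : Euc 3) :
    Measurable fun g => unitSign (ρ (pull g u)) :=
  measurable_unitSign.comp (hρ.comp (continuous_pull_left u)).measurable

theorem integrable_sign_mul (hρ : Continuous ρ) (hM : ∀ x, |ρ x| ≤ M) (u v : Euc 3) :
    Integrable (fun g => unitSign (ρ (pull g u)) * ρ (pull g v)) orthHaar :=
  Integrable.of_bound (C := M)
    ((measurable_unitSign_pull hρ u).mul
      (hρ.comp (continuous_pull_left v)).measurable).aestronglyMeasurable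
    (Filter.Eventually.of_forall fun g => by
      rw [Real.norm_eq_abs, abs_mul, abs_unitSign, one_mul]; exact hM _)

theorem clamp_sq_le (t : ℝ) : (max (-1) (min 1 t)) ^ 2 ≤ 1 := by
  have h1 : -1 ≤ max (-1) (min 1 t) := le_max_left _ _
  have h2 : max (-1) (min 1 t) ≤ 1 := max_le (by norm_num) (min_le_left _ _)
  nlinarith

theorem clamp_neg (t : ℝ) : max (-1) (min 1 (-t)) = -max (-1) (min 1 t) := by
  rcases le_total t (-1) with h | h <;> rcases le_total t 1 with h' | h' <;>
    simp only [max_def, min_def] <;> split_ifs <;> linarith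

theorem clamp_eq {t : ℝ} (ht : |t| ≤ 1) : max (-1) (min 1 t) = t := by
  rw [min_eq_right (abs_le.1 ht).2, max_eq_right (abs_le.1 ht).1]

theorem signCorrProfile_eq {u v : Euc 3} (hu : ‖u‖ = 1) (hv : ‖v‖ = 1) {t : ℝ}
    (ht : ⟪u, v⟫ = max (-1) (min 1 t)) : signCorrProfile ρ t = signCorr ρ u v := by
  obtain ⟨L, hL1, hL2⟩ := exists_isometry_pair (u := u) (v := v)
    (u' := EuclideanSpace.single 2 1) (v' := parallel (max (-1) (min 1 t)) 0)
    (by simp [hu]) (by rw [hv, norm_parallel (clamp_sq_le t)])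
    (by rw [ht, real_inner_comm, inner_single_two]; simp [parallel])
  unfold signCorrProfile signCorr
  rw [← hL1, ← hL2]
  exact integral_pull_isometry L (fun x y => unitSign (ρ x) * ρ y) u v

theorem signCorrProfile_inner {u v : Euc 3} (hu : ‖u‖ = 1) (hv : ‖v‖ = 1) :
    signCorrProfile ρ ⟪u, v⟫ = signCorr ρ u v :=
  signCorrProfile_eq hu hv (clamp_eq (by simpa [hu, hv] using abs_real_inner_le_norm u v)).symm

theorem pull_neg (g : OrthGroup) (x : Euc 3) : pull g (-x) = -pull g x :=
  (pullEquiv g).map_neg x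

theorem signCorrProfile_one (hρ : Continuous ρ) (hM : ∀ x, |ρ x| ≤ M) :
    signCorrProfile ρ 1 = ∫ x, |ρ x| ∂sphereMeasure := by
  have h1 : ‖(EuclideanSpace.single 2 1 : Euc 3)‖ = 1 := by simp
  rw [← integral_pull (χ := fun x => |ρ x|) hρ.abs (M := M) (fun x => by simpa using hM x) h1,
    signCorrProfile_eq (u := EuclideanSpace.single 2 1) (v := EuclideanSpace.single 2 1) h1 h1
      (by simp)]
  simp [signCorr, unitSign_mul_self]

theorem abs_signCorr_le (hρ : Continuous ρ) (hM : ∀ x, |ρ x| ≤ M) (u : Euc 3) {v : Euc 3}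
    (hv : ‖v‖ = 1) : |signCorr ρ u v| ≤ ∫ x, |ρ x| ∂sphereMeasure := by
  rw [← integral_pull (χ := fun x => |ρ x|) hρ.abs (M := M) (fun x => by simpa using hM x) hv]
  refine (abs_integral_le_integral_abs).trans_eq ?_
  simp [abs_mul, abs_unitSign]

theorem continuous_signCorrProfile (hρ : Continuous ρ) (hM : ∀ x, |ρ x| ≤ M) :
    Continuous (signCorrProfile ρ) := by
  refine continuous_of_dominated (bound := fun _ => M)
    (fun t => (integrable_sign_mul hρ hM _ _).aestronglyMeasurable)
    (fun t => Filter.Eventually.of_forall fun g => by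
      rw [Real.norm_eq_abs, abs_mul, abs_unitSign, one_mul]; exact hM _)
    (integrable_const _) (Filter.Eventually.of_forall fun g => ?_)
  refine continuous_const.mul (hρ.comp (((pullEquiv g).continuous).comp ?_))
  unfold parallel
  refine (PiLp.continuous_toLp 2 _).comp (continuous_pi fun i => ?_)
  fin_cases i <;> simp <;> fun_prop

theorem abs_integral_signCorr_mul_le (hρ : Continuous ρ) (hM : ∀ x, |ρ x| ≤ M) (u : Euc 3)
    {h : Euc 3 → ℝ} (hh : Continuous h) {N : ℝ}
    (hN : ∀ g, |∫ x, ρ (pull g x) * h x ∂sphereMeasure| ≤ N) :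
    |∫ x, signCorr ρ u x * h x ∂sphereMeasure| ≤ N := by
  have hint : Integrable (fun z : Euc 3 × OrthGroup =>
      unitSign (ρ (pull z.2 u)) * ρ (pull z.2 z.1) * h z.1) (sphereMeasure.prod orthHaar) := by
    refine Integrable.bdd_mul (c := M)
      ((integrable_of_continuousOn_sphere hh).comp_fst orthHaar) ?_ ?_
    · exact (((measurable_unitSign_pull hρ u).comp measurable_snd).mul
        (hρ.comp (continuous_pull.comp continuous_swap)).measurable).aestronglyMeasurable
    · exact Filter.Eventually.of_forall fun z => by
        rw [Real.norm_eq_abs, abs_mul, abs_unitSign, one_mul]; exact hM _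
  have : ∫ x, signCorr ρ u x * h x ∂sphereMeasure =
      ∫ g, unitSign (ρ (pull g u)) * ∫ x, ρ (pull g x) * h x ∂sphereMeasure ∂orthHaar := by
    simp only [signCorr, ← integral_mul_const]
    rw [integral_integral_swap hint]
    simp only [mul_assoc, integral_const_mul]
  rw [this, ← Real.norm_eq_abs]
  refine (norm_integral_le_of_norm_le_const (C := N)
    (Filter.Eventually.of_forall fun g => ?_)).trans_eq (by simp)
  rw [Real.norm_eq_abs, abs_mul, abs_unitSign, one_mul]
  exact hN g

theorem ridgeBound_signCorrProfile {ι : Type*} [Fintype ι] {p : ι → Euc 3} (hp : ∀ i, ‖p i‖ = 1)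
    (hρ : Continuous ρ) (hM : ∀ x, |ρ x| ≤ M) (heven : ∀ x, ρ (-x) = ρ x) {N : ℝ}
    (hsum : ∫ g, |∑ i, ρ (pull g (p i))| ∂orthHaar ≤ N)
    (hmass : |∫ x, ρ x ∂sphereMeasure| ≤ N)
    (hsecond : ∀ u, ‖u‖ = 1 → |∫ x, ρ x * ⟪x, u⟫ ^ 2 ∂sphereMeasure| ≤ N) :
    RidgeBound p (signCorrProfile ρ) N := by
  have h1 : ‖(EuclideanSpace.single 2 1 : Euc 3)‖ = 1 := by simp
  have hprof : ∀ x : Euc 3, ‖x‖ = 1 →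
      signCorrProfile ρ (x 2) = signCorr ρ (EuclideanSpace.single 2 1) x := fun x hx => by
    rw [← signCorrProfile_inner h1 hx, real_inner_comm, inner_single_two]
  refine ⟨continuous_signCorrProfile hρ hM, fun t => ?_, fun t => ?_, fun x hx => ?_, ?_, ?_⟩
  · have hpar := norm_parallel (clamp_sq_le t) (θ := 0)
    rw [signCorrProfile_eq (t := -t) h1 (v := -parallel (max (-1) (min 1 t)) 0)
      (by rw [norm_neg, hpar])
      (by rw [clamp_neg, inner_neg_right, real_inner_comm, inner_single_two]; simp [parallel])]
    simp only [signCorr, signCorrProfile, pull_neg, heven]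
  · rw [signCorrProfile_one hρ hM]
    exact abs_signCorr_le hρ hM _ (norm_parallel (clamp_sq_le t) 0)
  · refine le_trans ?_ hsum
    have : ∑ i, signCorrProfile ρ ⟪x, p i⟫ =
        ∫ g, unitSign (ρ (pull g x)) * ∑ i, ρ (pull g (p i)) ∂orthHaar := by
      simp only [signCorrProfile_inner hx (hp _), signCorr, Finset.mul_sum]
      rw [integral_finsetSum _ fun i _ => integrable_sign_mul hρ hM x (p i)]
    rw [this]
    refine (abs_integral_le_integral_abs).trans_eq ?_
    simp only [abs_mul, abs_unitSign, one_mul]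
  · rw [integral_congr_ae (g := fun x => signCorr ρ (EuclideanSpace.single 2 1) x * 1)
      (ae_norm_eq_one.mono fun x hx => by simpa using hprof x hx)]
    refine abs_integral_signCorr_mul_le hρ hM _ continuous_const fun g => ?_
    simpa only [mul_one, integral_comp_pull] using hmass
  · rw [integral_congr_ae
      (g := fun x => signCorr ρ (EuclideanSpace.single 2 1) x * x 2 ^ 2)
      (ae_norm_eq_one.mono fun x hx => by simp only [hprof x hx])]
    refine abs_integral_signCorr_mul_le hρ hM _ (by fun_prop) fun g => ?_
    have := integral_comp_pull g fun y => ρ y * ⟪y, pull g (EuclideanSpace.single 2 1)⟫ ^ 2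
    simp only [inner_pull, inner_single_two] at this
    rw [this]
    exact hsecond _ (by rw [norm_pull, h1])

end

theorem exists_abs_integral_le : ∃ C : ℝ, ∀ (ρ : Euc 3 → ℝ) (M N : ℝ), Continuous ρ →
    (∀ x, |ρ x| ≤ M) → (∀ x, ρ (-x) = ρ x) →
    ∫ g : OrthGroup, |∑ a, ∑ j, ρ (pull g (tetPoint a j))| ∂orthHaar ≤ N →
    |∫ x, ρ x ∂sphereMeasure| ≤ N →
    (∀ u, ‖u‖ = 1 → |∫ x, ρ x * ⟪x, u⟫ ^ 2 ∂sphereMeasure| ≤ N) →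
    ∫ x, |ρ x| ∂sphereMeasure ≤ C * N := by
  obtain ⟨C, hC⟩ := exists_tetPoint_inversion
  refine ⟨C, fun ρ M N hρ hM heven hsum hmass hsecond => ?_⟩
  rw [← signCorrProfile_one hρ hM]
  have hp : ∀ i : Fin 3 × Fin 4, ‖tetPoint i.1 i.2‖ = 1 := fun i => norm_tetPoint _ _
  refine hC _ _ (ridgeBound_signCorrProfile (p := fun i : Fin 3 × Fin 4 => tetPoint i.1 i.2)
    ?_ hρ hM heven ?_ hmass hsecond)
  · exact hp
  · simpa only [Fintype.sum_prod_type] using hsum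

/-- A symmetric convex body lying between the concentric balls of radii `1 - η` and `1 + η`. -/
structure NearBall (η : ℝ) (K : Set (Euc 3)) : Prop where
  isCompact : IsCompact K
  convex : Convex ℝ K
  symm : K = -K
  inner_subset : Metric.closedBall 0 (1 - η) ⊆ K
  subset_outer : K ⊆ Metric.closedBall 0 (1 + η)

/-- The deviation from `1` of the radial function of `K`, on the unit sphere. -/
def radialDev (K : Set (Euc 3)) (x : Euc 3) : ℝ := (max (gauge K x) (1 / 2))⁻¹ - 1

namespace NearBall

variable {η : ℝ} {K : Set (Euc 3)}

theorem mem_nhds (h : NearBall η K) (hη1 : η ≤ 1 / 10) : K ∈ nhds 0 :=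
  Filter.mem_of_superset (Metric.closedBall_mem_nhds 0 (by linarith)) h.inner_subset

theorem continuous_radialDev (h : NearBall η K) (hη1 : η ≤ 1 / 10) : Continuous (radialDev K) := by
  have := continuous_gauge h.convex (h.mem_nhds hη1)
  unfold radialDev
  refine ((this.max continuous_const).inv₀ fun x => ?_).sub continuous_const
  have : (1 / 2 : ℝ) ≤ max (gauge K x) (1 / 2) := le_max_right _ _
  positivity

theorem abs_radialDev_le_one (K : Set (Euc 3)) (x : Euc 3) : |radialDev K x| ≤ 1 := by
  have h1 : (1 / 2 : ℝ) ≤ max (gauge K x) (1 / 2) := le_max_right _ _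
  have h2 : (max (gauge K x) (1 / 2))⁻¹ ≤ (1 / 2)⁻¹ := inv_anti₀ (by norm_num) h1
  have h3 : 0 < (max (gauge K x) (1 / 2))⁻¹ := inv_pos.2 (by linarith)
  rw [radialDev, abs_le]
  norm_num at h2
  constructor <;> linarith

theorem radialDev_neg (h : NearBall η K) (x : Euc 3) : radialDev K (-x) = radialDev K x := by
  unfold radialDev
  rw [gauge_neg]
  intro y hy
  rw [h.symm]
  simpa using hy

theorem gauge_bounds (h : NearBall η K) (hη : 0 < η) (hη1 : η ≤ 1 / 10) {u : Euc 3}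
    (hu : ‖u‖ = 1) : (1 + η)⁻¹ ≤ gauge K u ∧ gauge K u ≤ (1 - η)⁻¹ := by
  have habs : Absorbent ℝ K := absorbent_nhds_zero (h.mem_nhds hη1)
  constructor
  · have := le_gauge_of_subset_closedBall habs (by linarith : (0 : ℝ) ≤ 1 + η)
      h.subset_outer (x := u)
    rwa [hu, one_div] at this
  · refine gauge_le_of_mem (inv_nonneg.2 (by linarith)) ?_
    rw [mem_inv_smul_set_iff₀ (by linarith)]
    refine h.inner_subset ?_
    rw [mem_closedBall_zero_iff, norm_smul, hu, mul_one, Real.norm_of_nonneg (by linarith)]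

theorem one_add_radialDev (h : NearBall η K) (hη : 0 < η) (hη1 : η ≤ 1 / 10) {u : Euc 3}
    (hu : ‖u‖ = 1) : 1 + radialDev K u = (gauge K u)⁻¹ := by
  have h1 := (h.gauge_bounds hη hη1 hu).1
  have h2 : (1 / 2 : ℝ) ≤ (1 + η)⁻¹ := by
    rw [one_div]; exact inv_anti₀ (by linarith) (by linarith)
  rw [radialDev, max_eq_left (h2.trans h1)]
  ring

theorem abs_radialDev_le (h : NearBall η K) (hη : 0 < η) (hη1 : η ≤ 1 / 10) {u : Euc 3}
    (hu : ‖u‖ = 1) : |radialDev K u| ≤ η := by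
  obtain ⟨h1, h2⟩ := h.gauge_bounds hη hη1 hu
  have h3 := h.one_add_radialDev hη hη1 hu
  have h0 : 0 < (1 + η)⁻¹ := inv_pos.2 (by linarith)
  have h4 := inv_anti₀ h0 h1
  have h5 := inv_anti₀ (h0.trans_le h1) h2
  rw [inv_inv] at h4 h5
  rw [abs_le]
  constructor <;> linarith

theorem smul_mem_iff (h : NearBall η K) (hη : 0 < η) (hη1 : η ≤ 1 / 10) {u : Euc 3}
    (hu : ‖u‖ = 1) {t : ℝ} (ht : 0 < t) : t • u ∈ K ↔ t ≤ 1 + radialDev K u := by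
  have h1 := (h.gauge_bounds hη hη1 hu).1
  have h0 : 0 < gauge K u := (inv_pos.2 (by linarith)).trans_le h1
  rw [h.one_add_radialDev hη hη1 hu, le_inv_comm₀ ht h0, ← h.isCompact.isClosed.closure_eq,
    ← gauge_le_one_iff_mem_closure h.convex (h.mem_nhds hη1), gauge_smul_of_nonneg ht.le,
    h.isCompact.isClosed.closure_eq, smul_eq_mul, inv_eq_one_div, le_div_iff₀ ht, mul_comm]

theorem eq_closedBall (h : NearBall η K) (hη : 0 < η) (hη1 : η ≤ 1 / 10)
    (h0 : ∀ u : Euc 3, ‖u‖ = 1 → radialDev K u = 0) : K = Metric.closedBall 0 1 := by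
  ext x
  rw [mem_closedBall_zero_iff]
  rcases eq_or_ne x 0 with rfl | hx
  · simpa using mem_of_mem_nhds (h.mem_nhds hη1)
  · have hx0 : 0 < ‖x‖ := norm_pos_iff.2 hx
    have hu : ‖‖x‖⁻¹ • x‖ = 1 := by rw [norm_smul, norm_inv, norm_norm, inv_mul_cancel₀ hx0.ne']
    have := h.smul_mem_iff hη hη1 hu hx0
    rwa [h0 _ hu, smul_inv_smul₀ hx0.ne', add_zero] at this

end NearBall

theorem integral_inner_sq_eq {u : Euc 3} (hu : ‖u‖ = 1) (f : ℝ → ℝ) :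
    ∫ x, f ⟪x, u⟫ ∂sphereMeasure = ∫ x, f (x 2) ∂sphereMeasure := by
  obtain ⟨L, hL⟩ := exists_isometry_apply_eq (u := u) (v := EuclideanSpace.single 2 1)
    (by simp [hu])
  rw [← integral_comp_isometry L fun x => f (x 2)]
  simp_rw [← inner_single_two, ← hL, L.inner_map_map]

theorem sum_inner_sq (b : OrthonormalBasis (Fin 3) ℝ (Euc 3)) (x : Euc 3) :
    ∑ i, ⟪x, b i⟫ ^ 2 = ‖x‖ ^ 2 := by
  rw [← b.sum_sq_norm_inner_left x]
  simp

theorem integral_inner_sq {u : Euc 3} (hu : ‖u‖ = 1) :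
    ∫ x, ⟪x, u⟫ ^ 2 ∂sphereMeasure = 1 / 3 := by
  have hs : ∀ i : Fin 3, ∫ x, ⟪x, EuclideanSpace.basisFun (Fin 3) ℝ i⟫ ^ 2 ∂sphereMeasure =
      ∫ x, x 2 ^ 2 ∂sphereMeasure := fun i =>
    integral_inner_sq_eq (by simp) fun t => t ^ 2
  have hsum : ∑ i : Fin 3, ∫ x, ⟪x, EuclideanSpace.basisFun (Fin 3) ℝ i⟫ ^ 2 ∂sphereMeasure
      = 1 := by
    rw [← integral_finsetSum _ fun i _ => integrable_of_continuousOn_sphere (by fun_prop)]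
    rw [integral_congr_ae (g := fun _ => (1 : ℝ))
      (ae_norm_eq_one.mono fun x hx => by simp only [sum_inner_sq, hx, one_pow])]
    simp
  rw [Finset.sum_congr rfl fun i _ => hs i] at hsum
  rw [integral_inner_sq_eq hu fun t => t ^ 2]
  simp at hsum
  linarith

namespace NearBall

variable {η : ℝ} {K : Set (Euc 3)}

theorem setIntegral_eq (h : NearBall η K) (hη : 0 < η) (hη1 : η ≤ 1 / 10) (n : ℕ)
    {f : Euc 3 → ℝ} (hf : ∀ (t : ℝ) u, f (t • u) = t ^ n * f u) (hfc : Continuous f) :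
    ∫ x in K, f x = volume.real (Metric.ball (0 : Euc 3) 1) * (3 / (n + 3)) *
      ∫ x, (1 + radialDev K x) ^ (n + 3) * f x ∂sphereMeasure :=
  setIntegral_star K h.isCompact.measurableSet (fun u => 1 + radialDev K u) f
    (fun u hu => by linarith [(abs_le.1 (h.abs_radialDev_le hη hη1 hu)).1])
    (fun u hu t ht => h.smul_mem_iff hη hη1 hu ht) n hf
    (hfc.continuousOn.integrableOn_compact h.isCompact)

theorem volume_ball_pos : 0 < volume.real (Metric.ball (0 : Euc 3) 1) :=
  ENNReal.toReal_pos (Metric.measure_ball_pos volume _ one_pos).ne' measure_ball_lt_top.ne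

theorem integral_cube (h : NearBall η K) (hη : 0 < η) (hη1 : η ≤ 1 / 10)
    (hvol : volume.real K = volume.real (Metric.ball (0 : Euc 3) 1)) :
    ∫ x, (1 + radialDev K x) ^ 3 ∂sphereMeasure = 1 := by
  have := h.setIntegral_eq hη hη1 0 (f := fun _ => 1) (fun _ _ => by simp) continuous_const
  rw [setIntegral_const, hvol] at this
  have hpos := volume_ball_pos
  simp at this
  simpa [hpos.ne'] using this

theorem integral_fifth (h : NearBall η K) (hη : 0 < η) (hη1 : η ≤ 1 / 10) {c : ℝ}
    (hc : ∀ u : Euc 3, ‖u‖ = 1 → ∫ x in K, ⟪x, u⟫ ^ 2 = c) {u : Euc 3} (hu : ‖u‖ = 1) :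
    ∫ x, (1 + radialDev K x) ^ 5 * (⟪x, u⟫ ^ 2 - 1 / 3) ∂sphereMeasure = 0 := by
  have hρ := h.continuous_radialDev hη1
  have hmom : ∀ v : Euc 3, ‖v‖ = 1 →
      ∫ x, (1 + radialDev K x) ^ 5 * ⟪x, v⟫ ^ 2 ∂sphereMeasure =
        c / (volume.real (Metric.ball (0 : Euc 3) 1) * (3 / 5)) := fun v hv => by
    have := h.setIntegral_eq hη hη1 2 (f := fun x => ⟪x, v⟫ ^ 2)
      (fun t u => by rw [real_inner_smul_left]; ring) (by fun_prop)
    rw [hc v hv] at this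
    have hpos := volume_ball_pos
    rw [this]
    norm_num
    field_simp
  have htot : ∫ x, (1 + radialDev K x) ^ 5 ∂sphereMeasure =
      3 * (c / (volume.real (Metric.ball (0 : Euc 3) 1) * (3 / 5))) := by
    have hsum : ∑ i : Fin 3, ∫ x, (1 + radialDev K x) ^ 5 *
        ⟪x, EuclideanSpace.basisFun (Fin 3) ℝ i⟫ ^ 2 ∂sphereMeasure =
        ∫ x, (1 + radialDev K x) ^ 5 ∂sphereMeasure := by
      rw [← integral_finsetSum _ fun i _ => integrable_of_continuousOn_sphere (by fun_prop)]
      exact integral_congr_ae (ae_norm_eq_one.mono fun x hx => by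
        simp only [← Finset.mul_sum, sum_inner_sq, hx, one_pow, mul_one])
    rw [← hsum, Finset.sum_congr rfl fun i _ => hmom _ (by simp)]
    simp
  have : ∀ x : Euc 3, (1 + radialDev K x) ^ 5 * (⟪x, u⟫ ^ 2 - 1 / 3) =
      (1 + radialDev K x) ^ 5 * ⟪x, u⟫ ^ 2 - 1 / 3 * (1 + radialDev K x) ^ 5 := fun x => by ring
  simp only [this]
  rw [integral_sub (integrable_of_continuousOn_sphere (by fun_prop))
    (integrable_of_continuousOn_sphere (by fun_prop)), integral_const_mul, htot, hmom u hu]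
  ring

theorem abs_integral_le_of_ae_abs_le {f g : Euc 3 → ℝ} (hg : Continuous g)
    (hle : ∀ x : Euc 3, ‖x‖ = 1 → |f x| ≤ g x) :
    |∫ x, f x ∂sphereMeasure| ≤ ∫ x, g x ∂sphereMeasure := by
  rw [← Real.norm_eq_abs]
  exact norm_integral_le_of_norm_le (integrable_of_continuousOn_sphere hg)
    (ae_norm_eq_one.mono hle)

theorem abs_integral_radialDev_le (h : NearBall η K) (hη : 0 < η) (hη1 : η ≤ 1 / 10)
    (hvol : volume.real K = volume.real (Metric.ball (0 : Euc 3) 1)) :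
    |∫ x, radialDev K x ∂sphereMeasure| ≤
      2 * η * ∫ x, |radialDev K x| ∂sphereMeasure := by
  have hρ := h.continuous_radialDev hη1
  have h3 := h.integral_cube hη hη1 hvol
  have hlin : ∫ x, (3 * radialDev K x - ((1 + radialDev K x) ^ 3 - 1)) ∂sphereMeasure =
      3 * ∫ x, radialDev K x ∂sphereMeasure := by
    rw [integral_sub (integrable_of_continuousOn_sphere (by fun_prop))
      (integrable_of_continuousOn_sphere (by fun_prop)), integral_sub
      (integrable_of_continuousOn_sphere (by fun_prop)) (integrable_const _), h3,
      integral_const_mul]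
    simp
  have := abs_integral_le_of_ae_abs_le
    (f := fun x => 3 * radialDev K x - ((1 + radialDev K x) ^ 3 - 1))
    (g := fun x => 4 * η * |radialDev K x|) (by fun_prop) fun x hx => by
      have hb := h.abs_radialDev_le hη hη1 hx
      set y := radialDev K x
      have : 3 * y - ((1 + y) ^ 3 - 1) = -(y * (y * (3 + y))) := by ring
      rw [this, abs_neg, abs_mul, abs_mul, mul_comm]
      have h4 : |3 + y| ≤ 4 := by
        rw [abs_le] at hb ⊢; constructor <;> linarith
      calc |y| * |3 + y| * |y| ≤ η * 4 * |y| := by gcongr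
        _ = 4 * η * |y| := by ring
  rw [hlin, integral_const_mul, abs_mul, abs_of_pos (by norm_num : (0 : ℝ) < 3)] at this
  have h0 : 0 ≤ ∫ x, |radialDev K x| ∂sphereMeasure := integral_nonneg fun x => abs_nonneg _
  nlinarith [mul_nonneg hη.le h0]

theorem abs_integral_radialDev_mul_le (h : NearBall η K) (hη : 0 < η) (hη1 : η ≤ 1 / 10)
    (hvol : volume.real K = volume.real (Metric.ball (0 : Euc 3) 1)) {c : ℝ}
    (hc : ∀ u : Euc 3, ‖u‖ = 1 → ∫ x in K, ⟪x, u⟫ ^ 2 = c) {u : Euc 3} (hu : ‖u‖ = 1) :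
    |∫ x, radialDev K x * ⟪x, u⟫ ^ 2 ∂sphereMeasure| ≤
      5 * η * ∫ x, |radialDev K x| ∂sphereMeasure := by
  have hρ := h.continuous_radialDev hη1
  have h5 := h.integral_fifth hη hη1 hc hu
  have hq : ∫ x, (⟪x, u⟫ ^ 2 - 1 / 3) ∂sphereMeasure = 0 := by
    rw [integral_sub (integrable_of_continuousOn_sphere (by fun_prop)) (integrable_const _),
      integral_inner_sq hu]
    simp
  have hlin : ∫ x, (5 * radialDev K x * (⟪x, u⟫ ^ 2 - 1 / 3) -
      ((1 + radialDev K x) ^ 5 * (⟪x, u⟫ ^ 2 - 1 / 3) - (⟪x, u⟫ ^ 2 - 1 / 3))) ∂sphereMeasure =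
      5 * (∫ x, radialDev K x * ⟪x, u⟫ ^ 2 ∂sphereMeasure) -
        5 / 3 * ∫ x, radialDev K x ∂sphereMeasure := by
    rw [integral_sub (integrable_of_continuousOn_sphere (by fun_prop))
      (integrable_of_continuousOn_sphere (by fun_prop)), integral_sub
      (integrable_of_continuousOn_sphere (by fun_prop))
      (integrable_of_continuousOn_sphere (by fun_prop)), h5, hq, sub_zero, sub_zero,
      ← integral_const_mul, ← integral_const_mul,
      ← integral_sub (integrable_of_continuousOn_sphere (by fun_prop))
      (integrable_of_continuousOn_sphere (by fun_prop))]
    congr 1; ext x; ring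
  have := abs_integral_le_of_ae_abs_le
    (f := fun x => 5 * radialDev K x * (⟪x, u⟫ ^ 2 - 1 / 3) -
      ((1 + radialDev K x) ^ 5 * (⟪x, u⟫ ^ 2 - 1 / 3) - (⟪x, u⟫ ^ 2 - 1 / 3)))
    (g := fun x => 12 * η * |radialDev K x|) (by fun_prop) fun x hx => by
      have hb := h.abs_radialDev_le hη hη1 hx
      have hxu : ⟪x, u⟫ ^ 2 ≤ 1 := by
        have := abs_real_inner_le_norm x u
        rw [hx, hu, one_mul] at this
        rw [← sq_abs]
        exact pow_le_one₀ (abs_nonneg _) this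
      have hq1 : |⟪x, u⟫ ^ 2 - 1 / 3| ≤ 1 := by
        rw [abs_le]; constructor <;> nlinarith [sq_nonneg ⟪x, u⟫]
      set y := radialDev K x
      set q := ⟪x, u⟫ ^ 2 - 1 / 3
      have : 5 * y * q - ((1 + y) ^ 5 * q - q) =
          -(y * (q * (y * (10 + y * (10 + y * (5 + y)))))) := by ring
      rw [this, abs_neg, abs_mul, mul_comm]
      gcongr
      rw [abs_mul, abs_mul]
      have hy : |y| ≤ 1 / 10 := hb.trans hη1
      have h12 : |10 + y * (10 + y * (5 + y))| ≤ 12 := by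
        have h1 : |y * (10 + y * (5 + y))| ≤ 1 / 10 * (10 + 1 / 10 * (5 + 1 / 10)) := by
          rw [abs_mul]
          gcongr
          refine (abs_add_le _ _).trans ?_
          rw [abs_of_pos (by norm_num : (0 : ℝ) < 10), abs_mul]
          gcongr
          refine (abs_add_le _ _).trans ?_
          rw [abs_of_pos (by norm_num : (0 : ℝ) < 5)]
          gcongr
        refine (abs_add_le _ _).trans ?_
        rw [abs_of_pos (by norm_num : (0 : ℝ) < 10)]
        linarith
      calc |q| * (|y| * |10 + y * (10 + y * (5 + y))|) ≤ 1 * (η * 12) := by gcongr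
        _ = 12 * η := by ring
  rw [hlin, integral_const_mul] at this
  have h1 := h.abs_integral_radialDev_le hη hη1 hvol
  have h0 : 0 ≤ η * ∫ x, |radialDev K x| ∂sphereMeasure :=
    mul_nonneg hη.le (integral_nonneg fun x => abs_nonneg _)
  rw [abs_le] at this h1 ⊢
  constructor <;> linarith [this.1, this.2, h1.1, h1.2]

end NearBall

theorem IsCoveringLattice.of_preimage {n : ℕ} {T : Euc n →ₗ[ℝ] Euc n} {K : Set (Euc n)}
    (L : Euc n ≃ₗ[ℝ] Euc n) (h : IsCoveringLattice T (L ⁻¹' K)) :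
    IsCoveringLattice ((L : Euc n →ₗ[ℝ] Euc n) ∘ₗ T) K := by
  rw [isCoveringLattice_iff] at h ⊢
  intro x
  obtain ⟨z, hz⟩ := h (L.symm x)
  refine ⟨z, ?_⟩
  rwa [mem_preimage, map_sub, L.apply_symm_apply] at hz

theorem abs_det_isometry (L : Euc 3 ≃ₗᵢ[ℝ] Euc 3) :
    |LinearMap.det (L.toLinearEquiv : Euc 3 →ₗ[ℝ] Euc 3)| = 1 := by
  have h := Measure.addHaar_image_linearMap volume (L.toLinearEquiv : Euc 3 →ₗ[ℝ] Euc 3)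
    (Metric.ball 0 1)
  have himg : ((L.toLinearEquiv : Euc 3 →ₗ[ℝ] Euc 3) : Euc 3 → Euc 3) '' Metric.ball 0 1 =
      Metric.ball 0 1 := by
    have := L.image_ball 0 1
    rwa [map_zero] at this
  rw [himg] at h
  have h' := congrArg ENNReal.toReal h
  rw [ENNReal.toReal_mul, ENNReal.toReal_ofReal (abs_nonneg _)] at h'
  have hpos : 0 < (volume (Metric.ball (0 : Euc 3) 1)).toReal := NearBall.volume_ball_pos
  exact (mul_right_cancel₀ hpos.ne' (by rw [← h', one_mul]))

namespace NearBall

variable {η : ℝ} {K : Set (Euc 3)}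

theorem exists_isCoveringLattice_of_sum_pos (h : NearBall η K) (hη : 0 < η) (hη1 : η ≤ 1 / 10 ^ 8)
    (g : OrthGroup)
    (hsum : 10 ^ 5 * √η * ∑ a, ∑ j, |radialDev K (pull g (tetPoint a j))| <
      ∑ a, ∑ j, radialDev K (pull g (tetPoint a j))) :
    ∃ T : Euc 3 →ₗ[ℝ] Euc 3, IsCoveringLattice T K ∧ √(1024 / 125) < |LinearMap.det T| := by
  set L := pullEquiv g with hL
  have hη2 : η ≤ 1 / 10 := hη1.trans (by norm_num)
  have hsymm : L ⁻¹' K = -(L ⁻¹' K) := by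
    ext x
    rw [Set.mem_neg, mem_preimage, mem_preimage, map_neg, ← Set.mem_neg, ← h.symm]
  have hin : Metric.closedBall 0 (1 - η) ⊆ L ⁻¹' K := fun x hx => h.inner_subset (by
    rw [mem_closedBall_zero_iff] at hx ⊢
    rwa [L.norm_map])
  have hout : L ⁻¹' K ⊆ Metric.closedBall 0 (1 + η) := fun x hx => by
    have := h.subset_outer hx
    rw [mem_closedBall_zero_iff] at this ⊢
    rwa [L.norm_map] at this
  have hunit : ∀ a j, ‖pull g (tetPoint a j)‖ = 1 := fun a j => by rw [norm_pull, norm_tetPoint]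
  obtain ⟨T, hT, hdet⟩ := _root_.exists_isCoveringLattice_of_sum_pos
    (h.convex.linear_preimage (L.toLinearEquiv : Euc 3 →ₗ[ℝ] Euc 3)) hsymm hη hη1 hin hout
    (fun a j => radialDev K (pull g (tetPoint a j)))
    (fun a j => h.abs_radialDev_le hη hη2 (hunit a j))
    (fun a j => by
      change L _ ∈ K
      rw [map_smul]
      refine (h.smul_mem_iff hη hη2 (hunit a j) ?_).2 le_rfl
      linarith [(abs_le.1 (h.abs_radialDev_le hη hη2 (hunit a j))).1]) hsum
  refine ⟨(L.toLinearEquiv : Euc 3 →ₗ[ℝ] Euc 3) ∘ₗ T, hT.of_preimage L.toLinearEquiv, ?_⟩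
  rwa [LinearMap.det_comp, abs_mul, abs_det_isometry, one_mul]

theorem integral_sum_pull {χ : Euc 3 → ℝ} (hχ : Continuous χ) {M : ℝ} (hM : ∀ x, |χ x| ≤ M) :
    ∫ g, ∑ a, ∑ j, χ (pull g (tetPoint a j)) ∂orthHaar = 12 * ∫ x, χ x ∂sphereMeasure := by
  have hint : ∀ p, Integrable (fun g => χ (pull g p)) orthHaar := fun p =>
    Integrable.of_bound (C := M) (hχ.comp (continuous_pull_left p)).aestronglyMeasurable
      (Filter.Eventually.of_forall fun g => hM _)
  rw [integral_finsetSum _ fun a _ => integrable_finsetSum _ fun j _ => hint _]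
  simp_rw [integral_finsetSum _ fun j _ => hint _, integral_pull hχ hM (norm_tetPoint _ _)]
  simp
  ring

theorem radialDev_eq_zero (h : NearBall η K) (hη1 : η ≤ 1 / 10)
    (hN : ∫ x, |radialDev K x| ∂sphereMeasure = 0) {u : Euc 3} (hu : ‖u‖ = 1) :
    radialDev K u = 0 := by
  have hρ := h.continuous_radialDev hη1
  by_contra hne
  have hpos := sphereMeasure_pos_of_isOpen (U := {x | radialDev K x ≠ 0})
    (isOpen_ne_fun hρ continuous_const) hne hu
  rw [integral_eq_zero_iff_of_nonneg (fun x => abs_nonneg _)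
    (integrable_of_continuousOn_sphere hρ.abs)] at hN
  refine hpos.ne' ?_
  refine measure_mono_null ?_ (ae_iff.1 hN)
  intro x hx
  simpa using hx

end NearBall

theorem exists_isCoveringLattice_of_isotropic : ∃ η : ℝ, 0 < η ∧ η ≤ 1 / 10 ^ 8 ∧
    ∀ (K : Set (Euc 3)) (c : ℝ), NearBall η K →
      volume.real K = volume.real (Metric.ball (0 : Euc 3) 1) →
      (∀ u : Euc 3, ‖u‖ = 1 → ∫ x in K, ⟪x, u⟫ ^ 2 = c) → K ≠ Metric.closedBall 0 1 →
      ∃ T : Euc 3 →ₗ[ℝ] Euc 3, IsCoveringLattice T K ∧ √(1024 / 125) < |LinearMap.det T| := by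
  obtain ⟨C, hC⟩ := exists_abs_integral_le
  set B := |C| * (3 * 10 ^ 6) + 10 ^ 4 with hB
  have hB0 : 10 ^ 4 ≤ B := by have := abs_nonneg C; rw [hB]; linarith
  have hBpos : 0 < B := lt_of_lt_of_le (by norm_num) hB0
  have hη8 : (B⁻¹) ^ 2 ≤ 1 / 10 ^ 8 := by
    have : B⁻¹ ≤ (10 ^ 4)⁻¹ := inv_anti₀ (by norm_num) hB0
    calc (B⁻¹) ^ 2 ≤ ((10 ^ 4 : ℝ)⁻¹) ^ 2 := by gcongr
      _ = 1 / 10 ^ 8 := by norm_num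
  refine ⟨(B⁻¹) ^ 2, by positivity, hη8, fun K c h hvol hc hne => ?_⟩
  have hη : 0 < (B⁻¹) ^ 2 := by positivity
  have hsqrt : √((B⁻¹) ^ 2) = B⁻¹ := Real.sqrt_sq (by positivity)
  have hle : (B⁻¹) ^ 2 ≤ B⁻¹ := by
    have : B⁻¹ ≤ 1 := inv_le_one_of_one_le₀ (by linarith)
    have h0 : 0 < B⁻¹ := by positivity
    nlinarith
  set η := (B⁻¹) ^ 2
  have hη1 : η ≤ 1 / 10 := hη8.trans (by norm_num)
  have hρ := h.continuous_radialDev hη1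
  have hM := NearBall.abs_radialDev_le_one K
  by_contra hno
  refine hne (h.eq_closedBall hη hη1 fun u hu => h.radialDev_eq_zero hη1 ?_ hu)
  set N := ∫ x, |radialDev K x| ∂sphereMeasure with hN
  have hN0 : 0 ≤ N := integral_nonneg fun x => abs_nonneg _
  have hall : ∀ g : OrthGroup, |∑ a, ∑ j, radialDev K (pull g (tetPoint a j))| ≤
      2 * (10 ^ 5 * B⁻¹ * ∑ a, ∑ j, |radialDev K (pull g (tetPoint a j))|) -
        ∑ a, ∑ j, radialDev K (pull g (tetPoint a j)) := fun g => by
    have hg : ∑ a, ∑ j, radialDev K (pull g (tetPoint a j)) ≤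
        10 ^ 5 * √η * ∑ a, ∑ j, |radialDev K (pull g (tetPoint a j))| := by
      by_contra hlt
      exact hno (h.exists_isCoveringLattice_of_sum_pos hη hη8 g (not_le.1 hlt))
    rw [hsqrt] at hg
    have hpos : 0 ≤ 10 ^ 5 * B⁻¹ * ∑ a, ∑ j, |radialDev K (pull g (tetPoint a j))| := by
      positivity
    rw [abs_le]
    constructor <;> linarith
  have hmass := h.abs_integral_radialDev_le hη hη1 hvol
  have hsec := fun u hu => h.abs_integral_radialDev_mul_le hη hη1 hvol hc (u := u) hu
  have hηN : η * N ≤ B⁻¹ * N := by gcongr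
  have hBN : 0 ≤ B⁻¹ * N := by positivity
  have hcont : ∀ a j, Continuous fun g => radialDev K (pull g (tetPoint a j)) := fun a j =>
    hρ.comp (continuous_pull_left _)
  have hint : ∀ f : OrthGroup → ℝ, Continuous f → Integrable f orthHaar := fun f hf =>
    hf.integrable_of_hasCompactSupport (HasCompactSupport.of_compactSpace f)
  have hsum : ∫ g, |∑ a, ∑ j, radialDev K (pull g (tetPoint a j))| ∂orthHaar ≤
      3 * 10 ^ 6 * B⁻¹ * N := by
    have hi := integral_mono (hint _ (by fun_prop)) (hint _ (by fun_prop)) hall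
    refine hi.trans ?_
    rw [integral_sub (hint _ (by fun_prop)) (hint _ (by fun_prop)), integral_const_mul,
      integral_const_mul, NearBall.integral_sum_pull hρ hM,
      NearBall.integral_sum_pull (χ := fun x => |radialDev K x|) hρ.abs (M := 1)
      (fun x => by rw [abs_abs]; exact hM x)]
    have := (abs_le.1 hmass).1
    rw [← hN] at this ⊢
    nlinarith
  have hfin := hC (radialDev K) 1 (3 * 10 ^ 6 * B⁻¹ * N) hρ hM h.radialDev_neg hsum
    (hmass.trans (by nlinarith)) (fun u hu => (hsec u hu).trans (by nlinarith))
  rw [← hN] at hfin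
  have h1 : C * (3 * 10 ^ 6 * B⁻¹ * N) ≤ |C| * (3 * 10 ^ 6) * (B⁻¹ * N) := by
    have := le_abs_self C
    nlinarith
  have h2 : B * (B⁻¹ * N) = N := by field_simp
  have h3 : (10 ^ 4 : ℝ) * (B⁻¹ * N) ≤ 0 := by
    have : B * (B⁻¹ * N) = |C| * (3 * 10 ^ 6) * (B⁻¹ * N) + 10 ^ 4 * (B⁻¹ * N) := by
      rw [hB]; ring
    linarith
  have h4 : B⁻¹ * N = 0 := by linarith
  rw [← h2, h4, mul_zero]

/-- The inertia operator `u ↦ ∫ ⟪x, u⟫ x` of a compact set. -/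
def inertia {K : Set (Euc 3)} (hK : IsCompact K) : Euc 3 →ₗ[ℝ] Euc 3 where
  toFun u := ∫ x in K, ⟪x, u⟫ • x
  map_add' u v := by
    rw [← integral_add]
    · simp only [inner_add_right, add_smul]
    all_goals exact (Continuous.continuousOn (by fun_prop)).integrableOn_compact hK
  map_smul' c u := by
    rw [RingHom.id_apply, ← integral_smul]
    simp only [real_inner_smul_right, mul_smul]

theorem inner_inertia {K : Set (Euc 3)} (hK : IsCompact K) (u v : Euc 3) :
    ⟪inertia hK u, v⟫ = ∫ x in K, ⟪u, x⟫ * ⟪v, x⟫ := by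
  rw [real_inner_comm]
  change ⟪v, ∫ x in K, ⟪x, u⟫ • x⟫ = _
  rw [← integral_inner ((Continuous.continuousOn (by fun_prop)).integrableOn_compact hK)]
  simp only [real_inner_smul_right, real_inner_comm]

theorem exists_diagonal_inertia {K : Set (Euc 3)} (hK : IsCompact K) :
    ∃ (L : Euc 3 ≃ₗᵢ[ℝ] Euc 3) (m : Fin 3 → ℝ),
      ∀ i j, ∫ x in K, (L x) i * (L x) j = if i = j then m i else 0 := by
  have hsym : (inertia hK).IsSymmetric := fun u v => by
    rw [inner_inertia, real_inner_comm, inner_inertia]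
    simp only [mul_comm]
  have hn : Module.finrank ℝ (Euc 3) = 3 := by simp
  refine ⟨(hsym.eigenvectorBasis hn).repr, hsym.eigenvalues hn, fun i j => ?_⟩
  simp only [OrthonormalBasis.repr_apply_apply]
  rw [← inner_inertia hK, hsym.apply_eigenvectorBasis, real_inner_smul_left,
    orthonormal_iff_ite.1 (hsym.eigenvectorBasis hn).orthonormal]
  simp

namespace NearBall

theorem setIntegral_inner_sq_mem {ε : ℝ} {K : Set (Euc 3)} (h : NearBall ε K) (hε : 0 < ε)
    (hε1 : ε ≤ 1 / 10) {u : Euc 3} (hu : ‖u‖ = 1) :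
    ∫ x in K, ⟪x, u⟫ ^ 2 ∈ Icc (volume.real (Metric.ball (0 : Euc 3) 1) / 5 * (1 - ε) ^ 5)
      (volume.real (Metric.ball (0 : Euc 3) 1) / 5 * (1 + ε) ^ 5) := by
  have hρ := h.continuous_radialDev hε1
  have hpos := volume_ball_pos
  have hI := h.setIntegral_eq hε hε1 2 (f := fun x => ⟪x, u⟫ ^ 2)
    (fun t u => by rw [real_inner_smul_left]; ring) (by fun_prop)
  have hmom : ∀ t : ℝ, ∫ x, t ^ 5 * ⟪x, u⟫ ^ 2 ∂sphereMeasure = t ^ 5 * (1 / 3) := fun t => by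
    rw [integral_const_mul, integral_inner_sq hu]
  have hlo : (1 - ε) ^ 5 * (1 / 3) ≤
      ∫ x, (1 + radialDev K x) ^ 5 * ⟪x, u⟫ ^ 2 ∂sphereMeasure := by
    rw [← hmom]
    refine integral_mono_ae (integrable_of_continuousOn_sphere (by fun_prop))
      (integrable_of_continuousOn_sphere (by fun_prop)) (ae_norm_eq_one.mono fun x hx => ?_)
    have := abs_le.1 (h.abs_radialDev_le hε hε1 hx)
    have h1 : (1 - ε) ^ 5 ≤ (1 + radialDev K x) ^ 5 :=
      pow_le_pow_left₀ (by linarith) (by linarith) 5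
    exact mul_le_mul_of_nonneg_right h1 (sq_nonneg _)
  have hhi : ∫ x, (1 + radialDev K x) ^ 5 * ⟪x, u⟫ ^ 2 ∂sphereMeasure ≤
      (1 + ε) ^ 5 * (1 / 3) := by
    rw [← hmom]
    refine integral_mono_ae (integrable_of_continuousOn_sphere (by fun_prop))
      (integrable_of_continuousOn_sphere (by fun_prop)) (ae_norm_eq_one.mono fun x hx => ?_)
    have := abs_le.1 (h.abs_radialDev_le hε hε1 hx)
    have h1 : (1 + radialDev K x) ^ 5 ≤ (1 + ε) ^ 5 :=
      pow_le_pow_left₀ (by linarith) (by linarith) 5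
    exact mul_le_mul_of_nonneg_right h1 (sq_nonneg _)
  rw [hI]
  norm_num
  constructor
  · calc volume.real (Metric.ball (0 : Euc 3) 1) / 5 * (1 - ε) ^ 5
        = volume.real (Metric.ball (0 : Euc 3) 1) * (3 / 5) * ((1 - ε) ^ 5 * (1 / 3)) := by ring
      _ ≤ _ := by gcongr
  · calc _ ≤ volume.real (Metric.ball (0 : Euc 3) 1) * (3 / 5) * ((1 + ε) ^ 5 * (1 / 3)) := by
          gcongr
      _ = _ := by ring

end NearBall

/-- The diagonal linear automorphism with nonzero entries `d`. -/
def diagEquiv (d : Fin 3 → ℝ) (hd : ∀ i, d i ≠ 0) : Euc 3 ≃ₗ[ℝ] Euc 3 where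
  toFun x := WithLp.toLp 2 fun i => d i * x i
  map_add' x y := by ext i; simp [mul_add]
  map_smul' c x := by ext i; simp; ring
  invFun x := WithLp.toLp 2 fun i => (d i)⁻¹ * x i
  left_inv x := by ext i; simp [hd i]
  right_inv x := by ext i; simp [hd i]

theorem diagEquiv_apply (d : Fin 3 → ℝ) (hd : ∀ i, d i ≠ 0) (x : Euc 3) (i : Fin 3) :
    diagEquiv d hd x i = d i * x i := rfl

theorem norm_diagEquiv_le {d : Fin 3 → ℝ} (hd : ∀ i, d i ≠ 0) {b : ℝ}
    (hb : ∀ i, |d i| ≤ b) (x : Euc 3) : ‖diagEquiv d hd x‖ ≤ b * ‖x‖ := by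
  have hb0 : 0 ≤ b := (abs_nonneg _).trans (hb 0)
  refine le_of_sq_le_sq ?_ (by positivity)
  rw [mul_pow, EuclideanSpace.real_norm_sq_eq, EuclideanSpace.real_norm_sq_eq, Finset.mul_sum]
  refine Finset.sum_le_sum fun i _ => ?_
  rw [diagEquiv_apply, mul_pow, ← sq_abs (d i)]
  gcongr
  exact hb i

theorem le_norm_diagEquiv {d : Fin 3 → ℝ} (hd : ∀ i, d i ≠ 0) {a : ℝ} (ha : 0 ≤ a)
    (hb : ∀ i, a ≤ |d i|) (x : Euc 3) : a * ‖x‖ ≤ ‖diagEquiv d hd x‖ := by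
  refine le_of_sq_le_sq ?_ (by positivity)
  rw [mul_pow, EuclideanSpace.real_norm_sq_eq, EuclideanSpace.real_norm_sq_eq, Finset.mul_sum]
  refine Finset.sum_le_sum fun i _ => ?_
  rw [diagEquiv_apply, mul_pow, ← sq_abs (d i)]
  gcongr
  exact hb i

theorem setIntegral_image_linearEquiv (T : Euc 3 ≃ₗ[ℝ] Euc 3) {K : Set (Euc 3)}
    (hK : MeasurableSet K) (f : Euc 3 → ℝ) :
    ∫ y in T '' K, f y = |LinearMap.det (T : Euc 3 →ₗ[ℝ] Euc 3)| * ∫ x in K, f (T x) := by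
  have h := integral_image_eq_integral_abs_det_fderiv_smul volume hK
    (f := T) (f' := fun _ => (T.toContinuousLinearEquiv : Euc 3 →L[ℝ] Euc 3))
    (fun x _ => (T.toContinuousLinearEquiv : Euc 3 →L[ℝ] Euc 3).hasFDerivWithinAt)
    T.injective.injOn f
  rw [h, ← integral_const_mul]
  rfl

theorem setIntegral_inner_diagEquiv_sq {K : Set (Euc 3)} (hK : IsCompact K)
    {L : Euc 3 ≃ₗᵢ[ℝ] Euc 3} {m : Fin 3 → ℝ}
    (hL : ∀ i j, ∫ x in K, (L x) i * (L x) j = if i = j then m i else 0)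
    {d : Fin 3 → ℝ} (hd : ∀ i, d i ≠ 0) {s : ℝ} (hdm : ∀ i, d i ^ 2 * m i = s) (u : Euc 3) :
    ∫ x in K, ⟪diagEquiv d hd (L x), u⟫ ^ 2 = s * ‖u‖ ^ 2 := by
  have hexp : ∀ x, ⟪diagEquiv d hd (L x), u⟫ ^ 2 =
      ∑ i, ∑ j, (d i * u i) * (d j * u j) * ((L x) i * (L x) j) := fun x => by
    rw [PiLp.inner_apply, sq, Finset.sum_mul_sum]
    refine Finset.sum_congr rfl fun i _ => Finset.sum_congr rfl fun j _ => ?_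
    simp only [diagEquiv_apply, RCLike.inner_apply, conj_trivial]
    ring
  have hint : ∀ i j, Integrable (fun x => (d i * u i) * (d j * u j) * ((L x) i * (L x) j))
      (volume.restrict K) := fun i j => by
    have := L.continuous
    exact (Continuous.continuousOn (by fun_prop)).integrableOn_compact hK
  simp only [hexp]
  rw [integral_finsetSum _ fun i _ => integrable_finsetSum _ fun j _ => hint i j]
  simp_rw [integral_finsetSum _ fun j _ => hint _ j, integral_const_mul, hL]
  rw [EuclideanSpace.real_norm_sq_eq, Finset.mul_sum]
  refine Finset.sum_congr rfl fun i _ => ?_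
  simp only [mul_ite, mul_zero, Finset.sum_ite_eq, Finset.mem_univ, if_true]
  rw [← hdm i]
  ring

theorem volume_real_smul {t : ℝ} (ht : 0 ≤ t) (S : Set (Euc 3)) :
    volume.real (t • S) = t ^ 3 * volume.real S := by
  rw [Measure.real, Measure.addHaar_smul, ENNReal.toReal_mul,
    ENNReal.toReal_ofReal (abs_nonneg _), abs_of_nonneg (by positivity)]
  simp [Measure.real]

theorem volume_real_closedBall {t : ℝ} (ht : 0 ≤ t) :
    volume.real (Metric.closedBall (0 : Euc 3) t) =
      t ^ 3 * volume.real (Metric.ball (0 : Euc 3) 1) := by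
  have := Measure.addHaar_real_closedBall volume (0 : Euc 3) ht
  simpa using this

theorem exists_nearBall_smul {S : Set (Euc 3)} (hS : IsCompact S) (hconv : Convex ℝ S)
    (hsymm : S = -S) {α β η : ℝ} (hα : 0 < α) (hη : 0 < η)
    (hβ : β ≤ (1 + η) * α) (hin : Metric.closedBall 0 α ⊆ S) (hout : S ⊆ Metric.closedBall 0 β) :
    ∃ κ : ℝ, 0 < κ ∧ NearBall η (κ • S) ∧
      volume.real (κ • S) = volume.real (Metric.ball (0 : Euc 3) 1) := by
  have hV := NearBall.volume_ball_pos
  set V := volume.real (Metric.ball (0 : Euc 3) 1)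
  have hfin : volume S ≠ ⊤ := hS.measure_lt_top.ne
  have hβ0 : 0 ≤ β := by
    have := hout (hin (Metric.mem_closedBall_self hα.le))
    simpa using this
  have h1 : α ^ 3 * V ≤ volume.real S := by
    rw [← volume_real_closedBall hα.le]
    exact measureReal_mono hin hfin
  have h2 : volume.real S ≤ β ^ 3 * V := by
    rw [← volume_real_closedBall hβ0]
    exact measureReal_mono hout (isCompact_closedBall _ _).measure_lt_top.ne
  have hvS : 0 < volume.real S := lt_of_lt_of_le (by positivity) h1
  set κ : ℝ := (V / volume.real S) ^ (1 / 3 : ℝ) with hκ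
  have hκ0 : 0 < κ := by positivity
  have hκ3 : κ ^ 3 * volume.real S = V := by
    rw [hκ, ← Real.rpow_natCast, ← Real.rpow_mul (by positivity)]
    norm_num
    field_simp
  have hκα : κ * α ≤ 1 := by
    have : (κ * α) ^ 3 * V ≤ 1 * V := by
      calc (κ * α) ^ 3 * V = κ ^ 3 * (α ^ 3 * V) := by ring
        _ ≤ κ ^ 3 * volume.real S := by gcongr
        _ = 1 * V := by rw [hκ3, one_mul]
    exact (pow_le_one_iff_of_nonneg (by positivity) (by norm_num)).1 (le_of_mul_le_mul_right this hV)
  have hκβ : 1 ≤ κ * β := by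
    have : 1 * V ≤ (κ * β) ^ 3 * V := by
      calc 1 * V = κ ^ 3 * volume.real S := by rw [hκ3, one_mul]
        _ ≤ κ ^ 3 * (β ^ 3 * V) := by gcongr
        _ = (κ * β) ^ 3 * V := by ring
    exact (one_le_pow_iff_of_nonneg (by positivity) (by norm_num)).1 (le_of_mul_le_mul_right this hV)
  have hβ' : κ * β ≤ (1 + η) * (κ * α) := by
    calc κ * β ≤ κ * ((1 + η) * α) := by gcongr
      _ = _ := by ring
  refine ⟨κ, hκ0, ⟨hS.smul κ, hconv.smul κ, ?_, ?_, ?_⟩, ?_⟩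
  · rw [← smul_set_neg, ← hsymm]
  · intro x hx
    rw [mem_closedBall_zero_iff] at hx
    rw [mem_smul_set_iff_inv_smul_mem₀ hκ0.ne']
    refine hin ?_
    rw [mem_closedBall_zero_iff, norm_smul, norm_inv, Real.norm_of_nonneg hκ0.le,
      inv_mul_le_iff₀ hκ0]
    nlinarith
  · intro x hx
    rw [mem_smul_set_iff_inv_smul_mem₀ hκ0.ne'] at hx
    have := hout hx
    rw [mem_closedBall_zero_iff, norm_smul, norm_inv, Real.norm_of_nonneg hκ0.le,
      inv_mul_le_iff₀ hκ0] at this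
    rw [mem_closedBall_zero_iff]
    nlinarith
  · rw [volume_real_smul hκ0.le, hκ3]

theorem pow_seven_le {ε : ℝ} (hε : 0 < ε) (hε1 : ε ≤ 1 / 10 ^ 8) :
    (1 + ε) ^ 7 ≤ (1 + 20 * ε) ^ 2 * (1 - ε) ^ 7 := by
  have h1 : 1 - 7 * ε ≤ (1 - ε) ^ 7 := by
    have := one_add_mul_le_pow (a := -ε) (by linarith) 7
    norm_num at this
    linarith
  have h2 : (1 + ε) ^ 7 * (1 - 7 * ε) ≤ 1 := by
    have h3 : (1 + ε) ^ 7 * (1 - ε) ^ 7 ≤ 1 := by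
      rw [← mul_pow]
      exact pow_le_one₀ (by nlinarith) (by nlinarith)
    refine le_trans ?_ h3
    gcongr
  have h3 : 1 ≤ (1 + 20 * ε) ^ 2 * (1 - 7 * ε) * (1 - 7 * ε) := by
    nlinarith [mul_pos hε hε, mul_pos (mul_pos hε hε) hε]
  have h4 : 0 < 1 - 7 * ε := by linarith
  have h5 : (1 + ε) ^ 7 * (1 - 7 * ε) ≤ ((1 + 20 * ε) ^ 2 * (1 - 7 * ε)) * (1 - 7 * ε) :=
    h2.trans h3
  refine (le_of_mul_le_mul_right h5 h4).trans ?_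
  gcongr

theorem exists_isotropic_position {ε : ℝ} {K : Set (Euc 3)} (h : NearBall ε K) (hε : 0 < ε)
    (hε1 : ε ≤ 1 / 10 ^ 8) :
    ∃ (T : Euc 3 ≃ₗ[ℝ] Euc 3) (c : ℝ), NearBall (20 * ε) (T '' K) ∧
      volume.real (T '' K) = volume.real (Metric.ball (0 : Euc 3) 1) ∧
      ∀ u : Euc 3, ‖u‖ = 1 → ∫ x in T '' K, ⟪x, u⟫ ^ 2 = c := by
  obtain ⟨L, m, hLm⟩ := exists_diagonal_inertia h.isCompact
  have hV := NearBall.volume_ball_pos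
  set q := volume.real (Metric.ball (0 : Euc 3) 1) / 5 with hq
  have hq0 : 0 < q := by positivity
  have hm : ∀ i, m i ∈ Icc (q * (1 - ε) ^ 5) (q * (1 + ε) ^ 5) := fun i => by
    have := h.setIntegral_inner_sq_mem hε (hε1.trans (by norm_num))
      (u := L.symm (EuclideanSpace.single i 1)) (by simp)
    have h2 : ∀ x, ⟪x, L.symm (EuclideanSpace.single i 1)⟫ = (L x) i := fun x => by
      rw [← L.inner_map_map, L.apply_symm_apply, EuclideanSpace.inner_single_right]
      simp
    simp only [h2, sq, hLm, if_true] at this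
    exact this
  have h1ε : 0 < 1 - ε := by linarith
  have hm0 : ∀ i, 0 < m i := fun i => lt_of_lt_of_le (by positivity) (hm i).1
  set d : Fin 3 → ℝ := fun i => (√(m i))⁻¹ with hd
  have hd0 : ∀ i, 0 < d i := fun i => inv_pos.2 (Real.sqrt_pos.2 (hm0 i))
  set a := (√(q * (1 + ε) ^ 5))⁻¹ with ha
  set b := (√(q * (1 - ε) ^ 5))⁻¹ with hb
  have ha0 : 0 < a := by positivity
  have hb0 : 0 < b := by positivity
  have hda : ∀ i, a ≤ |d i| := fun i => by
    rw [abs_of_pos (hd0 i)]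
    exact inv_anti₀ (Real.sqrt_pos.2 (hm0 i)) (Real.sqrt_le_sqrt (hm i).2)
  have hdb : ∀ i, |d i| ≤ b := fun i => by
    rw [abs_of_pos (hd0 i)]
    exact inv_anti₀ (Real.sqrt_pos.2 (by positivity)) (Real.sqrt_le_sqrt (hm i).1)
  have hdne : ∀ i, d i ≠ 0 := fun i => (hd0 i).ne'
  set T₁ : Euc 3 ≃ₗ[ℝ] Euc 3 := L.toLinearEquiv.trans (diagEquiv d hdne) with hT₁
  have hT₁a : ∀ x, T₁ x = diagEquiv d hdne (L x) := fun x => rfl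
  have hbound : b * (1 + ε) ≤ (1 + 20 * ε) * (a * (1 - ε)) := by
    refine le_of_sq_le_sq ?_ (by positivity)
    rw [mul_pow, mul_pow, mul_pow, ha, hb, inv_pow, inv_pow, Real.sq_sqrt (by positivity),
      Real.sq_sqrt (by positivity)]
    have h7 := pow_seven_le hε hε1
    have e1 : (q * (1 - ε) ^ 5)⁻¹ * (1 + ε) ^ 2 =
        (1 + ε) ^ 7 / (q * (1 - ε) ^ 5 * (1 + ε) ^ 5) := by field_simp
    have e2 : (1 + 20 * ε) ^ 2 * ((q * (1 + ε) ^ 5)⁻¹ * (1 - ε) ^ 2) =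
        (1 + 20 * ε) ^ 2 * (1 - ε) ^ 7 / (q * (1 - ε) ^ 5 * (1 + ε) ^ 5) := by field_simp
    rw [e1, e2]
    gcongr
  obtain ⟨κ, hκ, hnear, hvol⟩ := exists_nearBall_smul (S := T₁ '' K)
    (h.isCompact.image T₁.toContinuousLinearEquiv.continuous)
    (h.convex.linear_image (T₁ : Euc 3 →ₗ[ℝ] Euc 3))
    (by
      ext y
      rw [Set.mem_neg]
      constructor
      · rintro ⟨x, hx, rfl⟩
        exact ⟨-x, by rw [h.symm]; simpa using hx, map_neg T₁ x⟩
      · rintro ⟨x, hx, hxy⟩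
        exact ⟨-x, by rw [h.symm]; simpa using hx, by rw [map_neg, hxy, neg_neg]⟩)
    (by positivity : 0 < a * (1 - ε)) (by positivity : 0 < 20 * ε) hbound
    (fun y hy => by
      rw [mem_closedBall_zero_iff] at hy
      refine ⟨T₁.symm y, h.inner_subset ?_, T₁.apply_symm_apply y⟩
      rw [mem_closedBall_zero_iff]
      have := le_norm_diagEquiv hdne ha0.le hda (L (T₁.symm y))
      rw [← hT₁a, T₁.apply_symm_apply, L.norm_map] at this
      exact le_of_mul_le_mul_left (this.trans hy) ha0)
    (by
      rintro _ ⟨x, hx, rfl⟩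
      have hx' := h.subset_outer hx
      rw [mem_closedBall_zero_iff] at hx' ⊢
      have := norm_diagEquiv_le hdne hdb (L x)
      rw [L.norm_map] at this
      exact this.trans (by gcongr))
  set T : Euc 3 ≃ₗ[ℝ] Euc 3 := T₁.trans (LinearEquiv.smulOfNeZero ℝ (Euc 3) κ hκ.ne') with hT
  have hTa : ∀ x, T x = κ • T₁ x := fun x => rfl
  have hTK : T '' K = κ • (T₁ '' K) := by
    rw [← image_smul, image_image]
    rfl
  refine ⟨T, |LinearMap.det (T : Euc 3 →ₗ[ℝ] Euc 3)| * κ ^ 2, hTK ▸ hnear, hTK ▸ hvol,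
    fun u hu => ?_⟩
  rw [setIntegral_image_linearEquiv T h.isCompact.measurableSet]
  have hiso := setIntegral_inner_diagEquiv_sq h.isCompact hLm hdne (s := 1) (fun i => by
    rw [hd, inv_pow, Real.sq_sqrt (hm0 i).le, inv_mul_cancel₀ (hm0 i).ne']) u
  rw [hu] at hiso
  simp only [hTa, hT₁a, real_inner_smul_left, mul_pow]
  rw [integral_const_mul, hiso]
  ring

theorem bddAbove_coveringDets {r : ℝ} (hr : 0 ≤ r) {K : Set (Euc 3)}
    (hK : K ⊆ Metric.closedBall 0 r) :
    BddAbove {d | ∃ T : Euc 3 →ₗ[ℝ] Euc 3,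
      LinearMap.det T ≠ 0 ∧ IsCoveringLattice T K ∧ d = |LinearMap.det T|} := by
  refine ⟨√(1024 / 125) * r ^ 3, ?_⟩
  rintro _ ⟨T, hT, hcov, rfl⟩
  exact abs_det_le_of_isCoveringLattice hr hK hT hcov

theorem critCoveringDet_unitBall : critCoveringDet (unitBall 3) = √(1024 / 125) := by
  refine le_antisymm (Real.sSup_le ?_ (Real.sqrt_nonneg _)) critCoveringDet_unitBall_ge
  rintro _ ⟨T, hT, hcov, rfl⟩
  simpa using abs_det_le_of_isCoveringLattice zero_le_one subset_rfl hT hcov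

theorem coveringFraction_lt_of_image {K : Set (Euc 3)} {r : ℝ} (hr : 0 ≤ r)
    (hK : K ⊆ Metric.closedBall 0 r) (S : Euc 3 ≃ₗ[ℝ] Euc 3)
    (hvol : volume.real (S '' K) = volume.real (Metric.ball (0 : Euc 3) 1))
    {T : Euc 3 →ₗ[ℝ] Euc 3} (hT : IsCoveringLattice T (S '' K))
    (hdet : √(1024 / 125) < |LinearMap.det T|) :
    coveringFraction K < coveringFraction (unitBall 3) := by
  have hD : 0 < √(1024 / 125 : ℝ) := Real.sqrt_pos.2 (by norm_num)
  have hV := NearBall.volume_ball_pos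
  have hball : (volume (unitBall 3)).toReal = volume.real (Metric.ball (0 : Euc 3) 1) := by
    have := volume_real_closedBall zero_le_one
    rwa [one_pow, one_mul] at this
  rw [show S '' K = S.symm ⁻¹' K from S.toEquiv.image_eq_preimage_symm K] at hT
  have hcov := hT.of_preimage S.symm
  have hS : |LinearMap.det (S : Euc 3 →ₗ[ℝ] Euc 3)| *
      |LinearMap.det (S.symm : Euc 3 →ₗ[ℝ] Euc 3)| = 1 := by
    rw [← abs_mul, S.det_mul_det_symm, abs_one]
  have hs : 0 < |LinearMap.det (S.symm : Euc 3 →ₗ[ℝ] Euc 3)| :=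
    (abs_nonneg _).lt_of_ne fun h => by rw [← h, mul_zero] at hS; exact zero_ne_one hS
  have hvK : (volume K).toReal = volume.real (Metric.ball (0 : Euc 3) 1) *
      |LinearMap.det (S.symm : Euc 3 →ₗ[ℝ] Euc 3)| := by
    have h1 : volume.real (S '' K) =
        |LinearMap.det (S : Euc 3 →ₗ[ℝ] Euc 3)| * (volume K).toReal := by
      have h2 := Measure.addHaar_image_linearMap volume (S : Euc 3 →ₗ[ℝ] Euc 3) K
      rw [Measure.real]
      refine (congrArg ENNReal.toReal h2).trans ?_
      rw [ENNReal.toReal_mul, ENNReal.toReal_ofReal (abs_nonneg _)]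
    rw [← hvol, h1, mul_right_comm, hS, one_mul]
  have ht : 0 < |LinearMap.det T| := hD.trans hdet
  have hcrit : |LinearMap.det (S.symm : Euc 3 →ₗ[ℝ] Euc 3)| * |LinearMap.det T| ≤
      critCoveringDet K := by
    refine le_csSup (bddAbove_coveringDets hr hK) ⟨_, ?_, hcov, ?_⟩
    · rw [LinearMap.det_comp]
      exact mul_ne_zero (abs_pos.1 hs) (abs_pos.1 ht)
    · rw [LinearMap.det_comp, abs_mul]
  rw [coveringFraction, coveringFraction, critCoveringDet_unitBall, hball, hvK]
  calc volume.real (Metric.ball (0 : Euc 3) 1) *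
        |LinearMap.det (S.symm : Euc 3 →ₗ[ℝ] Euc 3)| / critCoveringDet K
      ≤ volume.real (Metric.ball (0 : Euc 3) 1) *
        |LinearMap.det (S.symm : Euc 3 →ₗ[ℝ] Euc 3)| /
          (|LinearMap.det (S.symm : Euc 3 →ₗ[ℝ] Euc 3)| * |LinearMap.det T|) := by gcongr
    _ = volume.real (Metric.ball (0 : Euc 3) 1) / |LinearMap.det T| := by field_simp
    _ < volume.real (Metric.ball (0 : Euc 3) 1) / √(1024 / 125) := by gcongr

/-- The ball `B³` is relatively worst covering: there is `ε > 0` such that every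
origin-symmetric convex body `K` with `(1−ε)B³ ⊆ K ⊆ (1+ε)B³` which is not an ellipsoid
(not a nonsingular linear image of `B³`) satisfies `θ(K) < θ(B³)`. -/
theorem ball3_relatively_worst_covering :
    ∃ ε : ℝ, 0 < ε ∧ ∀ K : Set (Euc 3), IsSymmConvexBody K →
      (1 - ε) • unitBall 3 ⊆ K → K ⊆ (1 + ε) • unitBall 3 →
      (¬ ∃ T : Euc 3 →ₗ[ℝ] Euc 3, LinearMap.det T ≠ 0 ∧ K = T '' unitBall 3) →
      coveringFraction K < coveringFraction (unitBall 3) := by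
  obtain ⟨η, hη, hη1, hmain⟩ := exists_isCoveringLattice_of_isotropic
  refine ⟨η / 20, by positivity, fun K hK hin hout hne => ?_⟩
  have hball : ∀ t : ℝ, 0 ≤ t → t • unitBall 3 = Metric.closedBall (0 : Euc 3) t := fun t ht => by
    rw [unitBall, smul_unitClosedBall, Real.norm_of_nonneg ht]
  rw [hball _ (by linarith)] at hin hout
  have hnear : NearBall (η / 20) K := ⟨hK.1, hK.2.1, hK.2.2.2, hin, hout⟩
  obtain ⟨S, c, hnearS, hvol, hc⟩ :=
    exists_isotropic_position hnear (by positivity) (by linarith)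
  rw [mul_div_cancel₀ _ (by norm_num : (20 : ℝ) ≠ 0)] at hnearS
  obtain ⟨T, hT, hdet⟩ := hmain _ c hnearS hvol hc fun hS => hne
    ⟨S.symm, (LinearEquiv.isUnit_det' S.symm).ne_zero, by
      rw [unitBall, ← hS, image_image]
      simp⟩
  exact coveringFraction_lt_of_image (by positivity) hout S hvol hT hdet
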